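/- arXiv:2507.05188 — 2 statements merged into one kernel-verified Lean document; each statement's English description precedes it below -/
import Mathlib

section
/- Let D be an atomic integral domain with only finitely many nonprime irreducible elements up to associates (a generalized Cohen–Kaplansky domain). If D is not a unique factorization domain, then D is not square-factorial; that is, there exist irreducible elements u, v, w of D with u² = vw and u not associated to v. -/
/-- An integral domain is *atomic* if every nonzero nonunit can be written as a finite
product of irreducible elements. -/
def IsAtomicDomain (D : Type*) [CommRing D] [IsDomain D] : Prop :=
  ∀ x : D, x ≠ 0 → ¬IsUnit x → ∃ s : Multiset D, (∀ a ∈ s, Irreducible a) ∧ s.prod = x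

section IsLocalRing

open IsLocalRing

variable {L : Type*} [CommRing L]

theorem Ideal.coe_end_apply_mul {I : Ideal L} (f : Module.End L I) (x y : I) :
    (f x : L) * y = x * f y := by
  have h : (y : L) • f x = (x : L) • f y := by
    rw [← map_smul, ← map_smul]
    congr 1
    ext
    simp [mul_comm]
  have := congrArg (Subtype.val) h
  simp only [Submodule.coe_smul, smul_eq_mul] at this
  rw [mul_comm, this]

variable [IsLocalRing L]

theorem Irreducible.coe_linearEquiv_apply (e : maximalIdeal L ≃ₗ[L] maximalIdeal L)
    {u : maximalIdeal L} (hu : Irreducible (u : L)) : Irreducible (e u : L) := by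
  refine ⟨(e u).2, fun p q hpq ↦ ?_⟩
  by_contra! h
  have hp : p ∈ maximalIdeal L := h.1
  have hu' : u = q • e.symm ⟨p, hp⟩ := by
    rw [← map_smul, LinearEquiv.eq_symm_apply]
    ext
    simp [hpq, mul_comm]
  have hu'' : (u : L) = q * e.symm ⟨p, hp⟩ := congrArg Subtype.val hu'
  rcases hu.isUnit_or_isUnit hu'' with h' | h'
  · exact h.2 h'
  · exact (e.symm ⟨p, hp⟩).2 h'

variable [IsDomain L]

/-- If neither `f` nor `1 + f` is surjective, the powers of `1 + f` produce infinitely many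
nonassociated irreducible elements. -/
theorem surjective_or_surjective_one_add_of_finite_irreducible (hfg : (maximalIdeal L).FG)
    (F : Finset L) (hF : ∀ a : L, Irreducible a → ∃ b ∈ F, Associated a b)
    (f : Module.End L (maximalIdeal L)) :
    Function.Surjective f ∨ Function.Surjective (1 + f : Module.End L (maximalIdeal L)) := by
  by_contra! h
  obtain ⟨hf, hg⟩ := h
  set g : Module.End L (maximalIdeal L) := 1 + f with hgdef
  have : Module.Finite L (maximalIdeal L) := Module.Finite.iff_fg.2 hfg
  set N : Submodule L (maximalIdeal L) :=
    LinearMap.range f ⊔ maximalIdeal L • (⊤ : Submodule L (maximalIdeal L)) with hN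
  have hNtop : N ≠ ⊤ := by
    intro h
    apply hf
    rw [← LinearMap.range_eq_top, eq_top_iff]
    refine Submodule.le_of_le_smul_of_le_jacobson_bot (I := maximalIdeal L) Module.Finite.fg_top
      (jacobson_eq_maximalIdeal _ bot_ne_top).ge ?_
    rw [← hN, h]
  obtain ⟨x, hx⟩ : ∃ x, x ∉ N := by
    by_contra! h
    exact hNtop (eq_top_iff.2 fun x _ ↦ h x)
  have hirr : ∀ y : maximalIdeal L, y ∉ N → Irreducible (y : L) := by
    intro y hy
    refine ⟨y.2, fun p q hpq ↦ ?_⟩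
    by_contra! h
    apply hy
    have hp : p ∈ maximalIdeal L := h.1
    have hq : q ∈ maximalIdeal L := h.2
    have : y = p • (⟨q, hq⟩ : maximalIdeal L) := by ext; simpa using hpq
    rw [this]
    exact Submodule.mem_sup_right (Submodule.smul_mem_smul hp trivial)
  have hgx : ∀ n : ℕ, (g ^ n) x ∉ N := by
    intro n
    induction n with
    | zero => simpa using hx
    | succ n ih =>
      intro h
      apply ih
      rw [pow_succ', Module.End.mul_apply, hgdef, LinearMap.add_apply, Module.End.one_apply] at h
      exact (Submodule.add_mem_iff_left _
        (Submodule.mem_sup_left (LinearMap.mem_range_self f _))).1 h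
  choose b hbF hb using fun n ↦ hF _ (hirr _ (hgx n))
  obtain ⟨n, m, hnm, hbnm⟩ := Finite.exists_ne_map_eq_of_infinite (fun n ↦ (⟨b n, hbF n⟩ : F))
  wlog hlt : n < m generalizing n m
  · exact this m n hnm.symm hbnm.symm (by lia)
  have hbeq : b n = b m := congrArg Subtype.val hbnm
  obtain ⟨ε, hε⟩ : Associated ((g ^ n) x : L) ((g ^ m) x : L) :=
    (hb n).trans (hbeq ▸ (hb m).symm)
  obtain ⟨k, rfl⟩ := Nat.exists_eq_add_of_lt hlt
  have hx0 : ((g ^ n) x : L) ≠ 0 := (hirr _ (hgx n)).ne_zero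
  have hkey : ∀ y, (g ^ (k + 1)) y = (ε : L) • y := by
    intro y
    have h := Ideal.coe_end_apply_mul (g ^ (k + 1)) y ((g ^ n) x)
    rw [← Module.End.mul_apply, ← pow_add, show k + 1 + n = n + k + 1 by ring, ← hε] at h
    ext
    apply mul_right_cancel₀ hx0
    rw [h]
    simp only [Submodule.coe_smul, smul_eq_mul]
    ring
  apply hg
  intro y
  refine ⟨(g ^ k) ((↑ε⁻¹ : L) • y), ?_⟩
  rw [← Module.End.mul_apply, ← pow_succ', hkey, smul_smul]
  simp

theorem IsLocalRing.exists_irreducible_sq_eq_mul (hfg : (maximalIdeal L).FG)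
    (hdim : ∀ Q : Ideal L, Q.IsPrime → Q ≠ ⊥ → Q = maximalIdeal L)
    (F : Finset L) (hF : ∀ a : L, Irreducible a → ∃ b ∈ F, Associated a b)
    {a : L} (ha : Irreducible a) (hnp : ¬Prime a) :
    ∃ u v w : L, Irreducible u ∧ Irreducible v ∧ Irreducible w ∧
      u ^ 2 = v * w ∧ ¬Associated u v := by
  have hrad : maximalIdeal L ≤ (Ideal.span {a}).radical := by
    rw [Ideal.radical_eq_sInf]
    refine le_sInf fun Q hQ ↦ (hdim Q hQ.2 ?_).ge
    rintro rfl
    exact ha.ne_zero (by simpa using hQ.1)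
  obtain ⟨k, hk, hkmin⟩ : ∃ k, maximalIdeal L ^ (k + 1) ≤ Ideal.span {a} ∧
      ¬maximalIdeal L ^ k ≤ Ideal.span {a} := by
    classical
    have h := Ideal.exists_pow_le_of_le_radical_of_fg hrad hfg
    have h0 : Nat.find h ≠ 0 := by
      intro h0
      have := Nat.find_spec h
      rw [h0, pow_zero, Ideal.one_eq_top, top_le_iff, Ideal.span_singleton_eq_top] at this
      exact ha.not_isUnit this
    refine ⟨Nat.find h - 1, ?_, Nat.find_min h (by lia)⟩
    rw [Nat.sub_add_cancel (by lia)]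
    exact Nat.find_spec h
  obtain ⟨z, hzk, hz⟩ := SetLike.not_le_iff_exists.1 hkmin
  rw [Ideal.mem_span_singleton] at hz
  have hdvd : ∀ m : maximalIdeal L, a ∣ z * m := fun m ↦
    Ideal.mem_span_singleton.1 (hk (pow_succ (maximalIdeal L) k ▸ Ideal.mul_mem_mul hzk m.2))
  choose φ hφ using hdvd
  have hφm : ∀ m, φ m ∈ maximalIdeal L := by
    intro m hu
    obtain ⟨ε, hε⟩ := hu
    have hm : maximalIdeal L = Ideal.span {(m : L)} := by
      apply le_antisymm
      · intro y hy
        rw [Ideal.mem_span_singleton]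
        refine ⟨φ ⟨y, hy⟩ * ↑ε⁻¹, mul_left_cancel₀ ha.ne_zero ?_⟩
        have h1 := hφ m
        have h2 := hφ ⟨y, hy⟩
        rw [← hε] at h1
        have h3 : a = z * m * ↑ε⁻¹ := by rw [h1, mul_assoc, Units.mul_inv, mul_one]
        calc a * y = (z * y) * (m * ↑ε⁻¹) := by rw [h3]; ring
          _ = a * φ ⟨y, hy⟩ * (m * ↑ε⁻¹) := by rw [← h2]
          _ = _ := by ring
      · rw [Ideal.span_singleton_le_iff_mem]
        exact m.2
    have ham : (m : L) ∣ a := by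
      rw [← Ideal.mem_span_singleton, ← hm]
      exact ha.not_isUnit
    have hassoc : Associated a (m : L) := (ha.dvd_iff.1 ham).resolve_left m.2
    have hm0 : (m : L) ≠ 0 := fun h ↦ ha.ne_zero (by simpa [h] using hassoc)
    refine hnp (hassoc.prime_iff.2 ?_)
    rw [← Ideal.span_singleton_prime hm0, ← hm]
    infer_instance
  let f : Module.End L (maximalIdeal L) :=
    { toFun := fun m ↦ ⟨φ m, hφm m⟩
      map_add' := fun x y ↦ by
        ext
        apply mul_left_cancel₀ ha.ne_zero
        simp only [Submodule.coe_add, mul_add, ← hφ]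
      map_smul' := fun r x ↦ by
        ext
        apply mul_left_cancel₀ ha.ne_zero
        simp only [Submodule.coe_smul, smul_eq_mul, RingHom.id_apply, ← hφ, mul_left_comm _ r] }
  have hf : ∀ m, a * (f m : L) = z * m := fun m ↦ (hφ m).symm
  have hz0 : z ≠ 0 := fun h ↦ hz (h ▸ dvd_zero a)
  have main : ∀ (g : Module.End L (maximalIdeal L)) (y : L), ¬a ∣ y →
      (∀ m, a * (g m : L) = y * m) → Function.Surjective g →
      ∃ u v w : L, Irreducible u ∧ Irreducible v ∧ Irreducible w ∧
        u ^ 2 = v * w ∧ ¬Associated u v := by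
    intro g y hy hg hsurj
    have hy0 : y ≠ 0 := fun h ↦ hy (h ▸ dvd_zero a)
    have hinj : Function.Injective g := by
      intro m n hmn
      ext
      apply mul_left_cancel₀ hy0
      rw [← hg, ← hg, hmn]
    let e := LinearEquiv.ofBijective g ⟨hinj, hsurj⟩
    let u : maximalIdeal L := ⟨a, ha.not_isUnit⟩
    refine ⟨a, e u, e.symm u, ha, Irreducible.coe_linearEquiv_apply e (u := u) ha,
      Irreducible.coe_linearEquiv_apply e.symm (u := u) ha, ?_, ?_⟩
    · have := Ideal.coe_end_apply_mul (e : Module.End L (maximalIdeal L)) u (e.symm u)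
      simp only [LinearEquiv.coe_coe, LinearEquiv.apply_symm_apply] at this
      rw [this, sq]
    · rintro ⟨ε, hε⟩
      have h : a * (a * ε) = y * a := by rw [hε]; exact hg u
      refine hy ⟨ε, mul_right_cancel₀ ha.ne_zero ?_⟩
      rw [← h]
      ring
  rcases surjective_or_surjective_one_add_of_finite_irreducible hfg F hF f with h | h
  · exact main f z hz hf h
  · refine main _ (a + z) (by rwa [dvd_add_right dvd_rfl]) (fun m ↦ ?_) h
    simp [mul_add, add_mul, hf]

end IsLocalRing

section PrimeProducts

variable (D : Type*) [CommRing D]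

/-- The submonoid of products of units and prime elements. -/
def primeProducts : Submonoid D :=
  Submonoid.closure {x | IsUnit x ∨ Prime x}

variable {D}

theorem IsUnit.mem_primeProducts {x : D} (hx : IsUnit x) : x ∈ primeProducts D :=
  Submonoid.subset_closure (Or.inl hx)

theorem Prime.mem_primeProducts {x : D} (hx : Prime x) : x ∈ primeProducts D :=
  Submonoid.subset_closure (Or.inr hx)

theorem not_prime_of_mem_of_disjoint_primeProducts {P : Ideal D}
    (hP : Disjoint (P : Set D) (primeProducts D : Set D)) {a : D} (haP : a ∈ P) : ¬Prime a :=
  fun h ↦ Set.disjoint_left.1 hP haP h.mem_primeProducts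

theorem Irreducible.mem_of_dvd {Q : Ideal D} {c a : D} (ha : Irreducible a)
    (haQ : a ∈ Q) (hc : Irreducible c) (h : c ∣ a) : c ∈ Q :=
  Q.mem_of_dvd ((hc.dvd_irreducible_iff_associated ha).1 h).symm.dvd haQ

variable [IsDomain D]

theorem Irreducible.dvd_of_dvd_mul_of_mem_primeProducts {a e : D} (ha : Irreducible a)
    (hnp : ¬Prime a) (he : e ∈ primeProducts D) : ∀ {t : D}, a ∣ e * t → a ∣ t := by
  induction he using Submonoid.closure_induction with
  | mem e he =>
    rintro t ⟨c, hc⟩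
    rcases he with he | he
    · exact he.dvd_mul_left.1 ⟨c, hc⟩
    · rcases he.dvd_or_dvd ⟨t, hc.symm⟩ with h | ⟨d, rfl⟩
      · exact absurd (((ha.dvd_iff.1 h).resolve_left he.not_isUnit).prime_iff.2 he) hnp
      · refine ⟨d, mul_left_cancel₀ he.ne_zero ?_⟩
        rw [hc]
        ring
  | one => simp
  | mul x y _ _ hx hy =>
    intro t h
    exact hy (hx (by rwa [← mul_assoc]))

theorem Irreducible.not_dvd_of_mem_primeProducts {a e : D} (ha : Irreducible a)
    (hnp : ¬Prime a) (he : e ∈ primeProducts D) : ¬a ∣ e := fun h ↦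
  ha.not_isUnit (isUnit_of_dvd_one
    (ha.dvd_of_dvd_mul_of_mem_primeProducts hnp he (by rwa [mul_one])))

theorem IsAtomicDomain.mem_primeProducts (hat : IsAtomicDomain D) {x : D} (hx : x ≠ 0)
    (h : ∀ c, Irreducible c → c ∣ x → Prime c) : x ∈ primeProducts D := by
  by_cases hu : IsUnit x
  · exact hu.mem_primeProducts
  · obtain ⟨s, hs, rfl⟩ := hat x hx hu
    exact Submonoid.multiset_prod_mem _ _ fun a ha ↦
      (h a (hs a ha) (Multiset.dvd_prod ha)).mem_primeProducts

theorem IsAtomicDomain.exists_irreducible_dvd_mem (hat : IsAtomicDomain D) {Q : Ideal D}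
    [hQ : Q.IsPrime] {x : D} (hx : x ≠ 0) (hxQ : x ∈ Q) :
    ∃ c ∈ Q, Irreducible c ∧ c ∣ x := by
  obtain ⟨s, hs, rfl⟩ := hat x hx fun hu ↦ hQ.ne_top (Ideal.eq_top_of_isUnit_mem _ hxQ hu)
  obtain ⟨c, hcs, hcQ⟩ := (hQ.multiset_prod_mem_iff_exists_mem s).1 hxQ
  exact ⟨c, hcQ, hs c hcs, Multiset.dvd_prod hcs⟩

/-- Only prime elements divide the sum of an irreducible of `Q` and the product of the nonprime
irreducibles outside `Q`. -/
theorem IsAtomicDomain.exists_forall_add_mem_primeProducts (hat : IsAtomicDomain D) (F : Finset D)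
    (hF : ∀ a : D, Irreducible a → ¬Prime a → ∃ b ∈ F, Associated a b)
    (Q : Ideal D) [Q.IsPrime] :
    ∃ b : D, (∀ c, Irreducible c → ¬Prime c → c ∉ Q → c ∣ b) ∧
      ∀ a ∈ Q, Irreducible a → a + b ∈ primeProducts D := by
  classical
  have hb : ∀ c, Irreducible c → ¬Prime c → c ∉ Q → c ∣ ∏ i ∈ F with i ∉ Q, i := by
    intro c hc hcp hcQ
    obtain ⟨d, hdF, hcd⟩ := hF c hc hcp
    refine hcd.dvd.trans (Finset.dvd_prod_of_mem _ (Finset.mem_filter.2 ⟨hdF, fun h ↦ hcQ ?_⟩))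
    exact Q.mem_of_dvd hcd.symm.dvd h
  have hbQ : ∏ i ∈ F with i ∉ Q, i ∉ Q := by
    intro h
    obtain ⟨i, hi, hiQ⟩ := Ideal.IsPrime.prod_mem_iff.1 h
    exact (Finset.mem_filter.1 hi).2 hiQ
  refine ⟨_, hb, fun a haQ ha ↦ hat.mem_primeProducts ?_ fun c hc hcd ↦ ?_⟩
  · intro h
    exact hbQ ((Submodule.add_mem_iff_right _ haQ).1 (by rw [h]; exact Q.zero_mem))
  · by_contra hcp
    by_cases hcQ : c ∈ Q
    · exact hbQ ((Submodule.add_mem_iff_right _ haQ).1 (Q.mem_of_dvd hcd hcQ))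
    · exact hcQ (ha.mem_of_dvd haQ hc ((dvd_add_left (hb c hc hcp hcQ)).1 hcd))

theorem IsAtomicDomain.eq_of_le_of_disjoint_primeProducts (hat : IsAtomicDomain D) (F : Finset D)
    (hF : ∀ a : D, Irreducible a → ¬Prime a → ∃ b ∈ F, Associated a b)
    {P Q : Ideal D} [P.IsPrime] [Q.IsPrime]
    (hP : Disjoint (P : Set D) (primeProducts D : Set D)) (hQ : Q ≠ ⊥) (hQP : Q ≤ P) :
    Q = P := by
  by_contra hne
  obtain ⟨x, hxP, hxQ⟩ := SetLike.exists_of_lt (lt_of_le_of_ne hQP hne)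
  obtain ⟨y, hyQ, hy⟩ := Submodule.exists_mem_ne_zero_of_ne_bot hQ
  obtain ⟨a, haQ, ha, -⟩ := hat.exists_irreducible_dvd_mem hy hyQ
  obtain ⟨c, hcP, hc, hcx⟩ :=
    hat.exists_irreducible_dvd_mem (x := x) (fun h ↦ hxQ (h ▸ Q.zero_mem)) hxP
  obtain ⟨b, hb, hab⟩ := hat.exists_forall_add_mem_primeProducts F hF Q
  have hcb := hb c hc (not_prime_of_mem_of_disjoint_primeProducts hP hcP) fun h ↦
    hxQ (Q.mem_of_dvd hcx h)
  exact Set.disjoint_left.1 hP (P.add_mem (hQP haQ) (P.mem_of_dvd hcb hcP)) (hab a haQ ha)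

theorem IsAtomicDomain.dvd_of_dvd_mul (hat : IsAtomicDomain D) (F : Finset D)
    (hF : ∀ a : D, Irreducible a → ¬Prime a → ∃ b ∈ F, Associated a b)
    {P : Ideal D} [P.IsPrime] (hP : Disjoint (P : Set D) (primeProducts D : Set D))
    {a s t : D} (ha : Irreducible a) (haP : a ∈ P) (hs : s ∉ P) (h : a ∣ s * t) : a ∣ t := by
  have hanp : ¬Prime a := not_prime_of_mem_of_disjoint_primeProducts hP haP
  by_cases hu : IsUnit s
  · exact hu.dvd_mul_left.1 h
  obtain ⟨m, hm, rfl⟩ := hat s (fun h ↦ hs (h ▸ P.zero_mem)) hu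
  clear hu
  obtain ⟨b, hb, hab⟩ := hat.exists_forall_add_mem_primeProducts F hF P
  induction m using Multiset.induction_on with
  | empty => simpa using h
  | cons c m ih =>
    rw [Multiset.prod_cons] at hs h
    refine ih (fun i hi ↦ hm i (Multiset.mem_cons_of_mem hi)) (fun h ↦ hs (P.mul_mem_left _ h)) ?_
    have hc := hm c (Multiset.mem_cons_self c m)
    rw [mul_assoc] at h
    by_cases hcp : Prime c
    · exact ha.dvd_of_dvd_mul_of_mem_primeProducts hanp hcp.mem_primeProducts h
    · refine ha.dvd_of_dvd_mul_of_mem_primeProducts hanp (hab a haP ha) ?_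
      rw [add_mul]
      exact dvd_add (dvd_mul_right _ _)
        (h.trans (mul_dvd_mul_right (hb c hc hcp fun h ↦ hs (P.mul_mem_right _ h)) _))

theorem IsAtomicDomain.multiset_prod_dvd_of_dvd_mul (hat : IsAtomicDomain D) (F : Finset D)
    (hF : ∀ a : D, Irreducible a → ¬Prime a → ∃ b ∈ F, Associated a b)
    {P : Ideal D} [P.IsPrime] (hP : Disjoint (P : Set D) (primeProducts D : Set D))
    {r : Multiset D} (hr : ∀ a ∈ r, Irreducible a ∧ a ∈ P) {s t : D} (hs : s ∉ P)
    (h : r.prod ∣ s * t) : r.prod ∣ t := by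
  induction r using Multiset.induction_on generalizing t with
  | empty => simp
  | cons a r ih =>
    rw [Multiset.prod_cons] at h ⊢
    obtain ⟨ha, haP⟩ := hr a (Multiset.mem_cons_self a r)
    obtain ⟨t, rfl⟩ := hat.dvd_of_dvd_mul F hF hP ha haP hs (dvd_of_mul_right_dvd h)
    refine mul_dvd_mul_left a (ih (fun i hi ↦ hr i (Multiset.mem_cons_of_mem hi)) ?_)
    exact (mul_dvd_mul_iff_left ha.ne_zero).1 (by rwa [mul_left_comm] at h)

theorem IsAtomicDomain.exists_eq_multiset_prod_mul (hat : IsAtomicDomain D)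
    (P : Ideal D) [hP : P.IsPrime] {x : D} (hx : x ≠ 0) :
    ∃ (r : Multiset D) (y : D), (∀ a ∈ r, Irreducible a ∧ a ∈ P) ∧ y ∉ P ∧ x = r.prod * y := by
  classical
  by_cases hu : IsUnit x
  · exact ⟨0, x, by simp, fun h ↦ hP.ne_top (Ideal.eq_top_of_isUnit_mem _ h hu), by simp⟩
  obtain ⟨s, hs, rfl⟩ := hat x hx hu
  refine ⟨s.filter (· ∈ P), (s.filter (· ∉ P)).prod, fun a ha ↦ ?_, fun h ↦ ?_, ?_⟩
  · rw [Multiset.mem_filter] at ha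
    exact ⟨hs a ha.1, ha.2⟩
  · obtain ⟨c, hc, hcP⟩ := (hP.multiset_prod_mem_iff_exists_mem _).1 h
    exact (Multiset.mem_filter.1 hc).2 hcP
  · rw [← Multiset.prod_add, Multiset.filter_add_not]

end PrimeProducts

section Localization

variable {D : Type*} [CommRing D]

theorem Localization.AtPrime.exists_associated_algebraMap {P : Ideal D} [P.IsPrime]
    (x : Localization.AtPrime P) :
    ∃ d, Associated x (algebraMap D (Localization.AtPrime P) d) := by
  obtain ⟨⟨d, s⟩, hd⟩ := IsLocalization.surj P.primeCompl x
  have hs := IsLocalization.map_units (Localization.AtPrime P) s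
  exact ⟨d, hs.unit, by simpa using hd⟩

variable [IsDomain D]

theorem Localization.AtPrime.exists_dvd_mul_of_algebraMap_dvd {P : Ideal D} [P.IsPrime] {x y : D}
    (h : algebraMap D (Localization.AtPrime P) x ∣ algebraMap D (Localization.AtPrime P) y) :
    ∃ s ∉ P, x ∣ s * y := by
  obtain ⟨c, hc⟩ := h
  obtain ⟨⟨d, s⟩, hd⟩ := IsLocalization.surj P.primeCompl c
  refine ⟨s, s.2, d, IsLocalization.injective (Localization.AtPrime P)
    P.primeCompl_le_nonZeroDivisors ?_⟩
  simp only [map_mul] at hd ⊢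
  rw [hc, ← hd]
  ring

theorem IsAtomicDomain.multiset_prod_dvd_of_algebraMap_dvd (hat : IsAtomicDomain D) (F : Finset D)
    (hF : ∀ a : D, Irreducible a → ¬Prime a → ∃ b ∈ F, Associated a b)
    {P : Ideal D} [P.IsPrime] (hP : Disjoint (P : Set D) (primeProducts D : Set D))
    {r : Multiset D} (hr : ∀ a ∈ r, Irreducible a ∧ a ∈ P) {t : D}
    (h : algebraMap D (Localization.AtPrime P) r.prod ∣ algebraMap D (Localization.AtPrime P) t) :
    r.prod ∣ t := by
  obtain ⟨s, hs, h⟩ := Localization.AtPrime.exists_dvd_mul_of_algebraMap_dvd h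
  exact hat.multiset_prod_dvd_of_dvd_mul F hF hP hr hs h

theorem IsAtomicDomain.irreducible_algebraMap (hat : IsAtomicDomain D) (F : Finset D)
    (hF : ∀ a : D, Irreducible a → ¬Prime a → ∃ b ∈ F, Associated a b)
    {P : Ideal D} [P.IsPrime] (hP : Disjoint (P : Set D) (primeProducts D : Set D))
    {a : D} (ha : Irreducible a) (haP : a ∈ P) :
    Irreducible (algebraMap D (Localization.AtPrime P) a) := by
  have hinj := IsLocalization.injective (Localization.AtPrime P) P.primeCompl_le_nonZeroDivisors
  have hunit (x : D) := IsLocalization.AtPrime.isUnit_to_map_iff (Localization.AtPrime P) P x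
  refine ⟨fun h ↦ (hunit a).1 h haP, fun x y hxy ↦ ?_⟩
  have hxy0 : x * y ≠ 0 := hxy ▸ (map_ne_zero_iff _ hinj).2 ha.ne_zero
  obtain ⟨x', hx⟩ := Localization.AtPrime.exists_associated_algebraMap x
  obtain ⟨y', hy⟩ := Localization.AtPrime.exists_associated_algebraMap y
  rw [hx.isUnit_iff, hy.isUnit_iff, hunit, hunit]
  have hx0 : x' ≠ 0 := by
    rintro rfl
    exact left_ne_zero_of_mul hxy0 (by simpa using hx)
  have hy0 : y' ≠ 0 := by
    rintro rfl
    exact right_ne_zero_of_mul hxy0 (by simpa using hy)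
  obtain ⟨r₁, s₁, hr₁, hs₁, rfl⟩ := hat.exists_eq_multiset_prod_mul P hx0
  obtain ⟨r₂, s₂, hr₂, hs₂, rfl⟩ := hat.exists_eq_multiset_prod_mul P hy0
  have hdvd : (r₁ + r₂).prod ∣ a := by
    refine hat.multiset_prod_dvd_of_algebraMap_dvd F hF hP (fun i hi ↦ ?_) ?_
    · exact (Multiset.mem_add.1 hi).elim (hr₁ i) (hr₂ i)
    · rw [hxy, Multiset.prod_add, map_mul]
      exact mul_dvd_mul ((map_dvd _ (dvd_mul_right _ _)).trans hx.symm.dvd)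
        ((map_dvd _ (dvd_mul_right _ _)).trans hy.symm.dvd)
  by_contra! h
  have hmem {r : Multiset D} {s : D} (hs : s ∉ P) (h : r.prod * s ∉ P.primeCompl) : r.prod ∈ P :=
    (Ideal.IsPrime.mem_or_mem ‹_› (not_not.1 h)).resolve_right hs
  obtain ⟨c, hc⟩ := hdvd
  rw [Multiset.prod_add, mul_assoc] at hc
  rcases ha.isUnit_or_isUnit hc with h' | h'
  · exact Ideal.IsPrime.ne_top ‹_› (Ideal.eq_top_of_isUnit_mem _ (hmem hs₁ h.1) h')
  · exact Ideal.IsPrime.ne_top ‹_›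
      (Ideal.eq_top_of_isUnit_mem _ (P.mul_mem_right c (hmem hs₂ h.2)) h')

theorem IsAtomicDomain.exists_irreducible_associated_algebraMap (hat : IsAtomicDomain D)
    {P : Ideal D} [P.IsPrime] {x : Localization.AtPrime P} (hx : Irreducible x) :
    ∃ a ∈ P, Irreducible a ∧ Associated x (algebraMap D (Localization.AtPrime P) a) := by
  obtain ⟨d, hd⟩ := Localization.AtPrime.exists_associated_algebraMap x
  have hunit (x : D) := IsLocalization.AtPrime.isUnit_to_map_iff (Localization.AtPrime P) P x
  have hdP : d ∈ P := by
    by_contra h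
    exact hx.not_isUnit (hd.isUnit_iff.2 ((hunit d).2 h))
  have hd0 : d ≠ 0 := by
    rintro rfl
    exact hx.ne_zero (by simpa using hd)
  obtain ⟨a, haP, ha, had⟩ := hat.exists_irreducible_dvd_mem hd0 hdP
  refine ⟨a, haP, ha, (hx.dvd_iff.1 ((map_dvd _ had).trans hd.symm.dvd)).resolve_left fun h ↦ ?_⟩
  exact (hunit a).1 h haP

theorem IsAtomicDomain.not_prime_algebraMap (hat : IsAtomicDomain D) (F : Finset D)
    (hF : ∀ a : D, Irreducible a → ¬Prime a → ∃ b ∈ F, Associated a b)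
    {P : Ideal D} [P.IsPrime] (hP : Disjoint (P : Set D) (primeProducts D : Set D))
    {a : D} (ha : Irreducible a) (haP : a ∈ P) :
    ¬Prime (algebraMap D (Localization.AtPrime P) a) := by
  intro h
  have hlift {t : D} (h : algebraMap D (Localization.AtPrime P) a ∣
      algebraMap D (Localization.AtPrime P) t) : a ∣ t := by
    obtain ⟨s, hs, h⟩ := Localization.AtPrime.exists_dvd_mul_of_algebraMap_dvd h
    exact hat.dvd_of_dvd_mul F hF hP ha haP hs h
  refine not_prime_of_mem_of_disjoint_primeProducts hP haP
    ⟨ha.ne_zero, ha.not_isUnit, fun x y hxy ↦ ?_⟩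
  refine (h.dvd_or_dvd ?_).imp hlift hlift
  rw [← map_mul]
  exact map_dvd _ hxy

theorem IsAtomicDomain.fg_of_disjoint_primeProducts (hat : IsAtomicDomain D) (F : Finset D)
    (hF : ∀ a : D, Irreducible a → ¬Prime a → ∃ b ∈ F, Associated a b)
    {P : Ideal D} [P.IsPrime] (hP : Disjoint (P : Set D) (primeProducts D : Set D)) : P.FG := by
  classical
  refine ⟨F.filter (· ∈ P), le_antisymm (Submodule.span_le.2 fun x hx ↦ ?_) fun x hx ↦ ?_⟩
  · exact (Finset.mem_filter.1 hx).2
  · by_cases hx0 : x = 0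
    · exact hx0 ▸ zero_mem _
    obtain ⟨a, haP, ha, hax⟩ := hat.exists_irreducible_dvd_mem hx0 hx
    obtain ⟨b, hbF, hab⟩ := hF a ha (not_prime_of_mem_of_disjoint_primeProducts hP haP)
    exact Ideal.mem_of_dvd _ (hab.symm.dvd.trans hax) (Ideal.subset_span
      (Finset.mem_coe.2 (Finset.mem_filter.2 ⟨hbF, P.mem_of_dvd hab.dvd haP⟩)))

end Localization

theorem IsAtomicDomain.exists_irreducible_not_prime {D : Type*} [CommRing D] [IsDomain D]
    (hat : IsAtomicDomain D) (hnot : ¬UniqueFactorizationMonoid D) :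
    ∃ a : D, Irreducible a ∧ ¬Prime a := by
  by_contra! h
  refine hnot (UniqueFactorizationMonoid.of_exists_prime_factors fun x hx ↦ ?_)
  by_cases hu : IsUnit x
  · exact ⟨0, by simp, by simpa using (associated_one_iff_isUnit.2 hu).symm⟩
  · obtain ⟨s, hs, rfl⟩ := hat x hx hu
    exact ⟨s, fun b hb ↦ h b (hs b hb), Associated.refl _⟩

/-- A generalized Cohen–Kaplansky domain that is not a UFD is not square-factorial:
there are irreducibles `u, v, w` with `u² = v * w` and `u` not associated to `v`. -/
theorem generalized_CK_not_UFD_not_squareFactorial (D : Type*) [CommRing D] [IsDomain D]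
    (hat : IsAtomicDomain D)
    (hGCK : ∃ F : Finset D, ∀ a : D, Irreducible a → ¬Prime a → ∃ b ∈ F, Associated a b)
    (hnot : ¬UniqueFactorizationMonoid D) :
    ∃ u v w : D, Irreducible u ∧ Irreducible v ∧ Irreducible w ∧
      u ^ 2 = v * w ∧ ¬Associated u v := by
  obtain ⟨F, hF⟩ := hGCK
  obtain ⟨a, ha, hanp⟩ := hat.exists_irreducible_not_prime hnot
  obtain ⟨P, hPprime, haP, hP⟩ := Ideal.exists_le_prime_disjoint (Ideal.span {a}) (primeProducts D)
    (Set.disjoint_left.2 fun e hae he ↦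
      ha.not_dvd_of_mem_primeProducts hanp he (Ideal.mem_span_singleton.1 hae))
  rw [Ideal.span_singleton_le_iff_mem] at haP
  let φ := algebraMap D (Localization.AtPrime P)
  classical
  obtain ⟨u, v, w, hu, hv, hw, huvw, huv⟩ :=
    IsLocalRing.exists_irreducible_sq_eq_mul (L := Localization.AtPrime P)
      (Localization.AtPrime.map_eq_maximalIdeal (I := P) ▸
        (hat.fg_of_disjoint_primeProducts F hF hP).map φ)
      (fun Q hQ hQ0 ↦ by
        have hQP : Q.comap φ ≤ P := fun x hx ↦
          (IsLocalization.AtPrime.to_map_mem_maximal_iff (Localization.AtPrime P) P x).1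
            (IsLocalRing.le_maximalIdeal hQ.ne_top hx)
        have hmap := IsLocalization.map_under P.primeCompl (Localization.AtPrime P) Q
        rw [← hmap, ← Localization.AtPrime.map_eq_maximalIdeal (I := P)]
        congr 1
        refine hat.eq_of_le_of_disjoint_primeProducts F hF hP (fun h ↦ hQ0 ?_) hQP
        rw [← hmap, h, Ideal.map_bot])
      (F.image φ)
      (fun x hx ↦ by
        obtain ⟨c, hcP, hc, hxc⟩ := hat.exists_irreducible_associated_algebraMap hx
        obtain ⟨b, hbF, hcb⟩ := hF c hc (not_prime_of_mem_of_disjoint_primeProducts hP hcP)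
        exact ⟨φ b, Finset.mem_image_of_mem φ hbF, hxc.trans (hcb.map φ)⟩)
      (hat.irreducible_algebraMap F hF hP ha haP) (hat.not_prime_algebraMap F hF hP ha haP)
  obtain ⟨u', huP, hu', huu⟩ := hat.exists_irreducible_associated_algebraMap hu
  obtain ⟨v', hvP, hv', hvv⟩ := hat.exists_irreducible_associated_algebraMap hv
  obtain ⟨w', hwP, hw', hww⟩ := hat.exists_irreducible_associated_algebraMap hw
  have hassoc : Associated (φ (u' * u')) (φ (v' * w')) := by
    rw [map_mul, map_mul]
    refine (huu.mul_mul huu).symm.trans ?_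
    rw [← sq, huvw]
    exact hvv.mul_mul hww
  have hdvd {x y t : D} (hx : Irreducible x) (hxP : x ∈ P) (hy : Irreducible y) (hyP : y ∈ P)
      (h : φ (x * y) ∣ φ t) : x * y ∣ t := by
    have hxy : ({x, y} : Multiset D).prod = x * y := Multiset.prod_pair x y
    rw [← hxy] at h ⊢
    refine hat.multiset_prod_dvd_of_algebraMap_dvd F hF hP (fun i hi ↦ ?_) h
    rcases Multiset.mem_cons.1 hi with rfl | hi
    · exact ⟨hx, hxP⟩
    · exact Multiset.mem_singleton.1 hi ▸ ⟨hy, hyP⟩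
  obtain ⟨ε, hε⟩ : Associated (v' * w') (u' * u') := associated_of_dvd_dvd
    (hdvd hv' hvP hw' hwP hassoc.symm.dvd) (hdvd hu' huP hu' huP hassoc.dvd)
  refine ⟨u', v', w' * ε, hu', hv', (associated_mul_unit_right w' ε ε.isUnit).irreducible hw', ?_,
    fun h ↦ huv ((huu.trans (h.map φ)).trans hvv.symm)⟩
  rw [sq, ← hε, mul_assoc]
end

section
/- Let K be a number field whose class number is strictly greater than 2. Then the ring of integers of K is an atomic domain that is neither half-factorial nor length-factorial. -/
/-- `D` is a *half-factorial domain* if it is atomic and whenever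
`x₁ ⋯ xₙ = y₁ ⋯ yₘ` with all `xᵢ` and `yⱼ` irreducible, then `n = m`. -/
def IsHalfFactorialDomain (D : Type*) [CommRing D] [IsDomain D] : Prop :=
  IsAtomicDomain D ∧
    ∀ s t : Multiset D, (∀ a ∈ s, Irreducible a) → (∀ a ∈ t, Irreducible a) →
      s.prod = t.prod → Multiset.card s = Multiset.card t

/-- `D` is *length-factorial* if whenever `x₁ ⋯ xₙ = y₁ ⋯ yₙ` with all `xᵢ` and `yⱼ`
irreducible, then there is a permutation matching each `xᵢ` with an associated `yⱼ`. -/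
def IsLengthFactorialDomain (D : Type*) [CommRing D] [IsDomain D] : Prop :=
  ∀ s t : Multiset D, (∀ a ∈ s, Irreducible a) → (∀ a ∈ t, Irreducible a) →
    s.prod = t.prod → Multiset.card s = Multiset.card t →
    Multiset.Rel Associated s t

section PrimesInIdealClasses

open MeasureTheory Set Filter Topology
open scoped ContDiff

section IteratedDifference

variable {E : Type*} [NormedAddCommGroup E]

/-- `DiffBound k B G` says that the `k`-fold iterated differences of `G` along `v₁, …, vₖ` are
bounded by `B * ‖v₁‖ * ⋯ * ‖vₖ‖`. -/
def DiffBound {F : Type*} [NormedAddCommGroup F] : ℕ → ℝ → (E → F) → Prop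
  | 0, B, G => ∀ x, ‖G x‖ ≤ B
  | k + 1, B, G => ∀ v, DiffBound k (B * ‖v‖) fun x ↦ G (x + v) - G x

theorem DiffBound.of_fderiv [NormedSpace ℝ E] {F : Type*} [NormedAddCommGroup F]
    [NormedSpace ℝ F] {k : ℕ} {B : ℝ} {G : E → F} (hG : Differentiable ℝ G)
    (h : DiffBound k B (fderiv ℝ G)) : DiffBound (k + 1) B G := by
  induction k generalizing B G with
  | zero =>
    intro v x
    have := Convex.norm_image_sub_le_of_norm_fderiv_le (𝕜 := ℝ) (s := univ) (f := G) (C := B)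
      (fun x _ ↦ hG x) (fun x _ ↦ h x) convex_univ (mem_univ x) (mem_univ (x + v))
    simpa using this
  | succ k ih =>
    intro v w
    have hd : Differentiable ℝ fun x ↦ G (x + w) - G x :=
      (hG.comp (differentiable_id.add_const w)).sub hG
    have hf : fderiv ℝ (fun x ↦ G (x + w) - G x) =
        fun x ↦ fderiv ℝ G (x + w) - fderiv ℝ G x := by
      ext1 x
      rw [fderiv_fun_sub (f := fun x ↦ G (x + w))
        ((hG.comp (differentiable_id.add_const w)) x) (hG x),
        fderiv_comp_add_right]
    have := ih (B := B * ‖w‖) hd (by rw [hf]; exact h w) v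
    convert this using 1
    · ring
    · ext x
      rw [add_right_comm, sub_sub_sub_comm]

universe u in
theorem exists_diffBound_of_contDiff_aux {E F : Type u} [NormedAddCommGroup E] [NormedSpace ℝ E]
    [NormedAddCommGroup F] [NormedSpace ℝ F] (k : ℕ) {G : E → F} (hG : ContDiff ℝ ∞ G)
    (hc : HasCompactSupport G) : ∃ B, DiffBound k B G := by
  induction k generalizing F with
  | zero =>
    obtain ⟨B, hB⟩ := hc.exists_bound_of_continuous hG.continuous
    exact ⟨B, hB⟩
  | succ k ih =>
    obtain ⟨B, hB⟩ := ih (hG.fderiv_right (m := ∞) (by simp)) (hc.fderiv ℝ)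
    exact ⟨B, hB.of_fderiv (hG.differentiable (by simp))⟩

theorem exists_diffBound_of_contDiff {E : Type*} [NormedAddCommGroup E] [NormedSpace ℝ E]
    (k : ℕ) {G : E → ℝ} (hG : ContDiff ℝ ∞ G) (hc : HasCompactSupport G) :
    ∃ B, DiffBound k B G := by
  cases k with
  | zero =>
    obtain ⟨B, hB⟩ := hc.exists_bound_of_continuous hG.continuous
    exact ⟨B, hB⟩
  | succ k =>
    obtain ⟨B, hB⟩ := exists_diffBound_of_contDiff_aux k
      (hG.fderiv_right (m := ∞) (by simp)) (hc.fderiv ℝ)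
    exact ⟨B, hB.of_fderiv (hG.differentiable (by simp))⟩

theorem DiffBound.integral {Ω : Type*} [MeasurableSpace Ω] {ν : Measure Ω}
    [IsProbabilityMeasure ν] {k : ℕ} {B : ℝ} {H : Ω → E → ℝ}
    (hi : ∀ x, Integrable (fun u ↦ H u x) ν) (h : ∀ᵐ u ∂ν, DiffBound k B (H u)) :
    DiffBound k B fun x ↦ ∫ u, H u x ∂ν := by
  induction k generalizing B H with
  | zero =>
    intro x
    refine (norm_integral_le_of_norm_le_const (C := B) ?_).trans (by simp)
    filter_upwards [h] with u hu using hu x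
  | succ k ih =>
    intro v
    have := ih (B := B * ‖v‖) (H := fun u x ↦ H u (x + v) - H u x)
      (fun x ↦ (hi _).sub (hi _)) (by filter_upwards [h] with u hu using hu v)
    convert this using 2 with x
    rw [integral_sub (hi _) (hi _)]

theorem DiffBound.neg {k : ℕ} {B : ℝ} {G : E → ℝ} (h : DiffBound k B G) :
    DiffBound k B fun x ↦ -G x := by
  induction k generalizing B G with
  | zero => intro x; simpa using h x
  | succ k ih =>
    intro v
    convert ih (h v) using 2
    ring

theorem DiffBound.mono {k : ℕ} {B B' : ℝ} (hB : B ≤ B') {G : E → ℝ} (h : DiffBound k B G) :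
    DiffBound k B' G := by
  induction k generalizing B B' G with
  | zero => intro x; exact (h x).trans hB
  | succ k ih => exact fun v ↦ ih (by gcongr) (h v)

end IteratedDifference

section LocalAverage

variable {E : Type*} [NormedAddCommGroup E] [NormedSpace ℝ E] [MeasurableSpace E]

/-- The average of `G` over the translates of `x` by `h • u`, where `u` is distributed
according to `ν`. -/
noncomputable def localAverage (ν : Measure E) (h : ℝ) (G : E → ℝ) (x : E) : ℝ :=
  ∫ u, G (x + h • u) ∂ν

variable {ν : Measure E} {h c : ℝ} {G : E → ℝ}

theorem localAverage_eq_zero_of_norm {R : ℝ} (hν : ∀ᵐ u ∂ν, ‖u‖ ≤ c) (h0 : 0 ≤ h)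
    (hR : ∀ x, R < ‖x‖ → G x = 0) {x : E} (hx : R + h * c < ‖x‖) :
    localAverage ν h G x = 0 := by
  refine integral_eq_zero_of_ae ?_
  filter_upwards [hν] with u hu
  refine hR _ ?_
  have h1 : ‖x‖ ≤ ‖x + h • u‖ + ‖h • u‖ := by simpa using norm_sub_le (x + h • u) (h • u)
  have h2 : ‖h • u‖ ≤ h * c := by
    rw [norm_smul, Real.norm_of_nonneg h0]; gcongr
  linarith

theorem hasCompactSupport_localAverage [FiniteDimensional ℝ E] (hν : ∀ᵐ u ∂ν, ‖u‖ ≤ c) (h0 : 0 ≤ h)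
    (hc : HasCompactSupport G) : HasCompactSupport (localAverage ν h G) := by
  obtain ⟨R, hR⟩ := hc.isBounded.subset_closedBall (0 : E)
  refine HasCompactSupport.intro (isCompact_closedBall (0 : E) (R + h * c)) fun x hx ↦ ?_
  refine localAverage_eq_zero_of_norm hν h0 (R := R) (fun y hy ↦ ?_) (by simpa using hx)
  by_contra hne
  have := hR (subset_tsupport _ hne)
  simp at this
  linarith

/-- The `k`-fold iterate of `G ↦ G - localAverage ν h G`. -/
noncomputable def iterSubAverage (ν : Measure E) (h : ℝ) (G : E → ℝ) : ℕ → E → ℝ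
  | 0 => G
  | k + 1 => fun x ↦ iterSubAverage ν h G k x - localAverage ν h (iterSubAverage ν h G k) x

theorem iterSubAverage_eq_zero_of_norm {R : ℝ} (hν : ∀ᵐ u ∂ν, ‖u‖ ≤ c) (h0 : 0 ≤ h) (c0 : 0 ≤ c)
    (hR : ∀ x, R < ‖x‖ → G x = 0) (k : ℕ) {x : E} (hx : R + k * (h * c) < ‖x‖) :
    iterSubAverage ν h G k x = 0 := by
  have hpos : 0 ≤ h * c := mul_nonneg h0 c0
  induction k generalizing x with
  | zero => exact hR x (by simpa using hx)
  | succ k ih =>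
    push_cast at hx
    simp only [iterSubAverage]
    rw [ih (by linarith), localAverage_eq_zero_of_norm (R := R + k * (h * c)) hν h0
      (fun y hy ↦ ih hy) (by linarith), sub_zero]

variable [FiniteDimensional ℝ E] [BorelSpace E] [IsProbabilityMeasure ν]

theorem integrable_comp_add_smul (hG : Continuous G) (hc : HasCompactSupport G) (x : E) :
    Integrable (fun u ↦ G (x + h • u)) ν := by
  obtain ⟨B, hB⟩ := hc.exists_bound_of_continuous hG
  exact Integrable.of_bound (by fun_prop) B (ae_of_all _ fun u ↦ hB _)

theorem continuous_localAverage (hG : Continuous G) (hc : HasCompactSupport G) :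
    Continuous (localAverage ν h G) := by
  obtain ⟨B, hB⟩ := hc.exists_bound_of_continuous hG
  exact continuous_of_dominated (bound := fun _ ↦ B)
    (fun x ↦ (integrable_comp_add_smul hG hc x).aestronglyMeasurable)
    (fun x ↦ ae_of_all _ fun u ↦ hB _) (integrable_const _)
    (ae_of_all _ fun u ↦ by fun_prop)

theorem integral_localAverage (μ : Measure E) [μ.IsAddHaarMeasure]
    (hG : Continuous G) (hc : HasCompactSupport G) :
    ∫ x, localAverage ν h G x ∂μ = ∫ x, G x ∂μ := by
  have hGi : Integrable G μ := hG.integrable_of_hasCompactSupport hc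
  unfold localAverage
  rw [integral_integral_swap]
  · simp_rw [integral_add_right_eq_self]
    simp
  · refine (integrable_prod_iff' ?_).2 ⟨ae_of_all _ fun u ↦ ?_, ?_⟩
    · exact (by fun_prop : Continuous
        (Function.uncurry fun x u ↦ G (x + h • u))).aestronglyMeasurable
    · exact hGi.comp_add_right (h • u)
    · have : ∀ u : E, ∫ x, ‖Function.uncurry (fun x u ↦ G (x + h • u)) (x, u)‖ ∂μ = ∫ x, ‖G x‖ ∂μ :=
        fun u ↦ integral_add_right_eq_self (fun x ↦ ‖G x‖) (h • u)
      simp_rw [this]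
      exact integrable_const _

theorem DiffBound.sub_localAverage {k : ℕ} {B : ℝ} (hB0 : 0 ≤ B) (hν : ∀ᵐ u ∂ν, ‖u‖ ≤ c)
    (h0 : 0 ≤ h) (hG : Continuous G) (hc : HasCompactSupport G) (hB : DiffBound (k + 1) B G) :
    DiffBound k (B * (h * c)) fun x ↦ G x - localAverage ν h G x := by
  have hi := fun x ↦ integrable_comp_add_smul (ν := ν) (h := h) hG hc x
  have : (fun x ↦ G x - localAverage ν h G x) =
      fun x ↦ -∫ u, (G (x + h • u) - G x) ∂ν := by
    ext x
    rw [integral_sub (hi x) (integrable_const _)]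
    simp [localAverage]
  rw [this]
  refine (DiffBound.integral (fun x ↦ (hi x).sub (integrable_const _)) ?_).neg
  filter_upwards [hν] with u hu
  refine (hB (h • u)).mono ?_
  rw [norm_smul, Real.norm_of_nonneg h0]
  gcongr

theorem iterSubAverage_continuous_and_hasCompactSupport (hν : ∀ᵐ u ∂ν, ‖u‖ ≤ c) (h0 : 0 ≤ h)
    (hG : Continuous G) (hc : HasCompactSupport G) (k : ℕ) :
    Continuous (iterSubAverage ν h G k) ∧ HasCompactSupport (iterSubAverage ν h G k) := by
  induction k with
  | zero => exact ⟨hG, hc⟩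
  | succ k ih =>
    exact ⟨ih.1.sub (continuous_localAverage ih.1 ih.2),
      ih.2.sub (hasCompactSupport_localAverage hν h0 ih.2)⟩

theorem DiffBound.iterSubAverage {k : ℕ} {B : ℝ} (hB0 : 0 ≤ B) (hν : ∀ᵐ u ∂ν, ‖u‖ ≤ c)
    (h0 : 0 ≤ h) (c0 : 0 ≤ c) (hG : Continuous G) (hc : HasCompactSupport G)
    (hB : DiffBound k B G) (x : E) : |iterSubAverage ν h G k x| ≤ B * (h * c) ^ k := by
  suffices H : ∀ j ≤ k, DiffBound (k - j) (B * (h * c) ^ j) (_root_.iterSubAverage ν h G j) by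
    have := H k le_rfl
    rw [Nat.sub_self] at this
    exact this x
  intro j
  induction j with
  | zero => intro _; simpa [_root_.iterSubAverage] using hB
  | succ j ih =>
    intro hj
    have h1 := ih (by omega)
    rw [show k - j = (k - (j + 1)) + 1 by omega] at h1
    have hcc := iterSubAverage_continuous_and_hasCompactSupport hν h0 hG hc j
    have hpos : 0 ≤ h * c := mul_nonneg h0 c0
    rw [pow_succ, ← mul_assoc]
    exact DiffBound.sub_localAverage (by positivity) hν h0 hcc.1 hcc.2 h1

end LocalAverage

section LatticeSum

variable {E : Type*} [NormedAddCommGroup E] [NormedSpace ℝ E] [FiniteDimensional ℝ E]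
  (L : Submodule ℤ E) [DiscreteTopology L]

theorem finite_support_lattice_smul {G : E → ℝ} (hc : HasCompactSupport G) {h : ℝ} (h0 : 0 < h) :
    (Function.support fun l : L ↦ G (h • (l : E))).Finite := by
  obtain ⟨R, hR⟩ := hc.isBounded.subset_closedBall (0 : E)
  have hfin : (Metric.closedBall (0 : E) (h⁻¹ * R) ∩ (L : Set E)).Finite := by
    have : DiscreteTopology L.toAddSubgroup := (inferInstance : DiscreteTopology L)
    refine Metric.finite_isBounded_inter_isClosed ⟨inferInstance⟩ Metric.isBounded_closedBall ?_
    exact AddSubgroup.isClosed_of_discrete (H := L.toAddSubgroup)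
  refine Finite.of_finite_image (f := Subtype.val) (hfin.subset ?_) Subtype.val_injective.injOn
  rintro _ ⟨l, hl, rfl⟩
  refine ⟨?_, l.2⟩
  have := hR (subset_tsupport _ hl)
  simp only [mem_closedBall_zero_iff, norm_smul, Real.norm_of_nonneg h0.le] at this ⊢
  rwa [le_inv_mul_iff₀ h0]

variable [MeasurableSpace E] [BorelSpace E] [IsZLattice ℝ L]

theorem exists_lattice_average (μ : Measure E) [μ.IsAddHaarMeasure] :
    ∃ (ν : Measure E) (c : ℝ), IsProbabilityMeasure ν ∧ 0 ≤ c ∧ (∀ᵐ u ∂ν, ‖u‖ ≤ c) ∧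
      ∀ (G : E → ℝ), Continuous G → HasCompactSupport G → ∀ h : ℝ, 0 < h →
        ∑' l : L, localAverage ν h G (h • (l : E)) =
          (h ^ Module.finrank ℝ E)⁻¹ * (ZLattice.covolume L μ)⁻¹ * ∫ x, G x ∂μ := by
  let b := Module.Free.chooseBasis ℤ L
  let D := ZSpan.fundamentalDomain (b.ofZLatticeBasis ℝ L)
  have hD : IsAddFundamentalDomain L D μ := ZLattice.isAddFundamentalDomain b μ
  have hbd : Bornology.IsBounded D := ZSpan.fundamentalDomain_isBounded _
  have htop : μ D ≠ ⊤ := hbd.measure_lt_top.ne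
  have h0 : μ D ≠ 0 := ZSpan.measure_fundamentalDomain_ne_zero _
  have hcov : ZLattice.covolume L μ = μ.real D :=
    ZLattice.covolume_eq_measure_fundamentalDomain L μ hD
  obtain ⟨R, hR⟩ := hbd.subset_closedBall (0 : E)
  refine ⟨(μ D)⁻¹ • μ.restrict D, max R 0, ?_, le_max_right _ _, ?_, ?_⟩
  · refine ⟨?_⟩
    simp [ENNReal.inv_mul_cancel h0 htop]
  · refine Measure.ae_smul_measure ?_ _
    refine (ae_restrict_iff' (ZSpan.fundamentalDomain_measurableSet _)).2
      (ae_of_all _ fun u hu ↦ ?_)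
    have := hR hu
    simp only [mem_closedBall_zero_iff] at this
    exact this.trans (le_max_left _ _)
  · intro G hG hc h hh
    have : MeasurableVAdd L E := (inferInstance : MeasurableVAdd L.toAddSubgroup E)
    have : VAddInvariantMeasure L E μ := (inferInstance : VAddInvariantMeasure L.toAddSubgroup E μ)
    have hcount : Countable L := inferInstance
    have hint : Integrable (fun x ↦ G (h • x)) μ :=
      (hG.integrable_of_hasCompactSupport hc).comp_smul hh.ne'
    have key := hD.integral_eq_tsum'' (fun x ↦ G (h • x)) hint
    rw [Measure.integral_comp_smul] at key
    simp only [localAverage, integral_smul_measure]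
    rw [tsum_const_smul'', hcov]
    have e : ∀ l : L, ∫ u in D, G (h • (l : E) + h • u) ∂μ = ∫ u in D, G (h • (l +ᵥ u)) ∂μ := by
      intro l
      simp [Submodule.vadd_def, smul_add]
    simp_rw [e]
    rw [← key, abs_of_nonneg (by positivity), Measure.real, ENNReal.toReal_inv]
    simp only [smul_eq_mul]
    ring

/-- Lattice points are counted by smooth weights with a power-saving error. -/
theorem exists_abs_lattice_sum_sub_le (μ : Measure E) [μ.IsAddHaarMeasure] {G : E → ℝ}
    (hG : ContDiff ℝ ∞ G) (hc : HasCompactSupport G) :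
    ∃ C, ∀ h : ℝ, 0 < h → h ≤ 1 → |∑' l : L, G (h • (l : E)) -
      (h ^ Module.finrank ℝ E)⁻¹ * (ZLattice.covolume L μ)⁻¹ * ∫ x, G x ∂μ| ≤ C * h := by
  obtain ⟨ν, c, hprob, c0, hν, hav⟩ := exists_lattice_average L μ
  set d := Module.finrank ℝ E with hd
  set V := (ZLattice.covolume L μ)⁻¹ with hV
  have hVpos : 0 ≤ V := inv_nonneg.2 (ZLattice.covolume_pos L μ).le
  obtain ⟨B, hB⟩ := exists_diffBound_of_contDiff (d + 1) hG hc
  replace hB := hB.mono (le_max_left B 0)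
  have hB0 : 0 ≤ max B 0 := le_max_right _ _
  set B' := max B 0
  obtain ⟨R, hRs⟩ := hc.isBounded.subset_closedBall (0 : E)
  have hR : ∀ x, max R 1 < ‖x‖ → G x = 0 := fun y hy ↦ by
    by_contra hne
    have := hRs (subset_tsupport _ hne)
    simp only [mem_closedBall_zero_iff] at this
    exact absurd (this.trans (le_max_left _ _)) (not_le.2 hy)
  set R₀ := max R 1
  have hR₀ : 1 ≤ R₀ := le_max_right _ _
  let g : ContDiffBump (0 : E) := ⟨R₀ + (d + 1) * c + c, R₀ + (d + 1) * c + c + 1, by positivity,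
    by linarith⟩
  have hgc : Continuous g := g.continuous
  have hgs : HasCompactSupport g := g.hasCompactSupport
  refine ⟨2 * (B' * c ^ (d + 1) * (V * ∫ x, g x ∂μ)), fun h h0 h1 ↦ ?_⟩
  set M := B' * (h * c) ^ (d + 1) with hM
  have hM0 : 0 ≤ M := by positivity
  have hcc := iterSubAverage_continuous_and_hasCompactSupport hν h0.le hG.continuous hc
  have hbound : ∀ x, |iterSubAverage ν h G (d + 1) x| ≤ M * localAverage ν h g x := by
    intro x
    have hnn : 0 ≤ localAverage ν h g x := integral_nonneg fun u ↦ g.nonneg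
    by_cases hx : R₀ + (d + 1 : ℕ) * (h * c) < ‖x‖
    · rw [iterSubAverage_eq_zero_of_norm hν h0.le c0 hR _ hx]
      simpa using mul_nonneg hM0 hnn
    · have : localAverage ν h g x = 1 := by
        have : localAverage ν h g x = ∫ u, (1 : ℝ) ∂ν := by
          refine integral_congr_ae ?_
          filter_upwards [hν] with u hu
          refine g.one_of_mem_closedBall ?_
          simp only [mem_closedBall_zero_iff]
          refine (norm_add_le _ _).trans ?_
          rw [norm_smul, Real.norm_of_nonneg h0.le]
          push_cast at hx
          have h2 : h * c ≤ c := mul_le_of_le_one_left c0 h1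
          have h3 : h * ‖u‖ ≤ h * c := by gcongr
          have h4 : (d + 1 : ℝ) * (h * c) ≤ (d + 1) * c := by gcongr
          linarith [not_lt.1 hx]
        simpa using this
      rw [this, mul_one]
      exact DiffBound.iterSubAverage hB0 hν h0.le c0 hG.continuous hc hB x
  have hsum : ∀ {H : E → ℝ}, HasCompactSupport H → Summable fun l : L ↦ H (h • (l : E)) :=
    fun hH ↦ summable_of_hasFiniteSupport (finite_support_lattice_smul L hH h0)
  have hinv : ∀ k, ∑' l : L, G (h • (l : E)) - (h ^ d)⁻¹ * V * ∫ x, G x ∂μ =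
      ∑' l : L, iterSubAverage ν h G k (h • (l : E)) -
        (h ^ d)⁻¹ * V * ∫ x, iterSubAverage ν h G k x ∂μ := by
    intro k
    induction k with
    | zero => rfl
    | succ k ih =>
      have hAs := hasCompactSupport_localAverage hν h0.le (hcc k).2
      have hAc := continuous_localAverage (ν := ν) (h := h) (hcc k).1 (hcc k).2
      rw [ih]
      simp only [iterSubAverage]
      rw [(hsum (hcc k).2).tsum_sub (hsum hAs), hav _ (hcc k).1 (hcc k).2 h h0, integral_sub
        ((hcc k).1.integrable_of_hasCompactSupport (hcc k).2)
          (hAc.integrable_of_hasCompactSupport hAs),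
        integral_localAverage μ (hcc k).1 (hcc k).2]
      ring
  have hAs := hasCompactSupport_localAverage hν h0.le hgs
  have hAc := continuous_localAverage (ν := ν) (h := h) hgc hgs
  rw [hinv (d + 1)]
  have hs1 : |∑' l : L, iterSubAverage ν h G (d + 1) (h • (l : E))| ≤
      M * ((h ^ d)⁻¹ * V * ∫ x, g x ∂μ) := by
    rw [← hav g hgc hgs h h0, ← tsum_mul_left]
    refine (norm_tsum_le_tsum_norm (hsum (hcc _).2).norm).trans ?_
    exact (hsum (hcc _).2).norm.tsum_le_tsum (fun l ↦ hbound _) ((hsum hAs).mul_left _)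
  have hs2 : |∫ x, iterSubAverage ν h G (d + 1) x ∂μ| ≤ M * ∫ x, g x ∂μ := by
    rw [← integral_localAverage (ν := ν) (h := h) μ hgc hgs, ← integral_const_mul]
    refine (norm_integral_le_integral_norm (iterSubAverage ν h G (d + 1))).trans
      (integral_mono_of_nonneg
      (ae_of_all _ fun _ ↦ norm_nonneg _)
      ((hAc.integrable_of_hasCompactSupport hAs).const_mul M) (ae_of_all _ fun x ↦ hbound x))
  refine (abs_sub _ _).trans ?_
  rw [abs_mul, abs_of_nonneg (by positivity : 0 ≤ (h ^ d)⁻¹ * V)]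
  calc _ ≤ M * ((h ^ d)⁻¹ * V * ∫ x, g x ∂μ) + (h ^ d)⁻¹ * V * (M * ∫ x, g x ∂μ) := by gcongr
    _ = _ := by
      rw [hM]
      have : (h ^ d)⁻¹ * h ^ (d + 1) = h := by
        rw [pow_succ]; field_simp
      rw [mul_pow]
      linear_combination (2 * (B' * c ^ (d + 1) * (V * ∫ x, g x ∂μ))) * this

end LatticeSum

section Weights

/-- A smooth nonnegative weight on `ℝ` supported in `[1, 3]`. -/
noncomputable def normWeight (t : ℝ) : ℝ :=
  Real.smoothTransition (t - 1) * Real.smoothTransition (3 - t)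

theorem contDiff_normWeight : ContDiff ℝ ∞ normWeight :=
  (Real.smoothTransition.contDiff.comp (by fun_prop)).mul
    (Real.smoothTransition.contDiff.comp (by fun_prop))

theorem continuous_normWeight : Continuous normWeight := contDiff_normWeight.continuous

theorem normWeight_nonneg (t : ℝ) : 0 ≤ normWeight t :=
  mul_nonneg (Real.smoothTransition.nonneg _) (Real.smoothTransition.nonneg _)

theorem normWeight_le_one (t : ℝ) : normWeight t ≤ 1 :=
  mul_le_one₀ (Real.smoothTransition.le_one _) (Real.smoothTransition.nonneg _)
    (Real.smoothTransition.le_one _)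

theorem normWeight_of_le_one {t : ℝ} (h : t ≤ 1) : normWeight t = 0 := by
  simp [normWeight, Real.smoothTransition.zero_of_nonpos (sub_nonpos.2 h)]

theorem normWeight_of_three_le {t : ℝ} (h : 3 ≤ t) : normWeight t = 0 := by
  simp [normWeight, Real.smoothTransition.zero_of_nonpos (sub_nonpos.2 h)]

theorem normWeight_pos {t : ℝ} (h1 : 1 < t) (h3 : t < 3) : 0 < normWeight t :=
  mul_pos (Real.smoothTransition.pos_of_pos (by linarith))
    (Real.smoothTransition.pos_of_pos (by linarith))

/-- A smooth nonnegative bump supported in `[-1, 1]` whose integer translates sum to `1`. -/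
noncomputable def unitBump (x : ℝ) : ℝ :=
  Real.smoothTransition (x + 1) - Real.smoothTransition x

theorem contDiff_unitBump : ContDiff ℝ ∞ unitBump :=
  (Real.smoothTransition.contDiff.comp (by fun_prop)).sub Real.smoothTransition.contDiff

theorem unitBump_nonneg (x : ℝ) : 0 ≤ unitBump x :=
  sub_nonneg.2 (Real.smoothTransition.monotone (by linarith))

theorem unitBump_zero : unitBump 0 = 1 := by
  simp [unitBump]

theorem unitBump_of_one_le {x : ℝ} (h : 1 ≤ x) : unitBump x = 0 := by
  simp [unitBump, Real.smoothTransition.one_of_one_le h,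
    Real.smoothTransition.one_of_one_le (h.trans (by linarith : x ≤ x + 1))]

theorem unitBump_of_le_neg_one {x : ℝ} (h : x ≤ -1) : unitBump x = 0 := by
  simp [unitBump, Real.smoothTransition.zero_of_nonpos (by linarith : x ≤ 0),
    Real.smoothTransition.zero_of_nonpos (by linarith : x + 1 ≤ 0)]

theorem exists_finset_sum_unitBump (x : ℝ) :
    ∃ s : Finset ℤ, (∀ n ∉ s, unitBump (x + n) = 0) ∧ ∑ n ∈ s, unitBump (x + n) = 1 := by
  have h0 := Int.floor_le x
  have h1 := Int.lt_floor_add_one x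
  refine ⟨{-⌊x⌋ - 1, -⌊x⌋}, fun n hn ↦ ?_, ?_⟩
  · simp only [Finset.mem_insert, Finset.mem_singleton, not_or] at hn
    rcases lt_or_ge n (-⌊x⌋ - 1) with h | h
    · refine unitBump_of_le_neg_one ?_
      have : (n : ℝ) ≤ -⌊x⌋ - 2 := by exact_mod_cast (by omega : n ≤ -⌊x⌋ - 2)
      linarith
    · refine unitBump_of_one_le ?_
      have : (-⌊x⌋ + 1 : ℝ) ≤ n := by exact_mod_cast (by omega : -⌊x⌋ + 1 ≤ n)
      linarith
  · rw [Finset.sum_pair (by omega)]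
    push_cast
    rw [unitBump, unitBump, Real.smoothTransition.one_of_one_le (by linarith : 1 ≤ x + -⌊x⌋ + 1),
      Real.smoothTransition.zero_of_nonpos (by linarith : x + (-⌊x⌋ - 1) ≤ 0)]
    ring_nf

theorem hasSum_prod_unitBump {ι : Type*} [Fintype ι] (x : ι → ℝ) :
    HasSum (fun n : ι → ℤ ↦ ∏ i, unitBump (x i + n i)) 1 := by
  classical
  choose s hs hs1 using fun i ↦ exists_finset_sum_unitBump (x i)
  have : ∑ n ∈ Fintype.piFinset s, ∏ i, unitBump (x i + n i) = 1 := by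
    rw [← Finset.prod_univ_sum s (fun i n ↦ unitBump (x i + (n : ℤ)))]
    simp [hs1]
  rw [← this]
  refine hasSum_sum_of_ne_finset_zero fun n hn ↦ ?_
  simp only [Fintype.mem_piFinset, not_forall] at hn
  obtain ⟨i, hi⟩ := hn
  exact Finset.prod_eq_zero (Finset.mem_univ i) (hs i _ hi)

end Weights

section ConeWeight

open NumberField NumberField.Units NumberField.Units.dirichletUnitTheorem NumberField.mixedEmbedding
  NumberField.mixedEmbedding.fundamentalCone NumberField.InfinitePlace Module

variable (K : Type*) [Field K] [NumberField K]

open scoped Classical in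
/-- The coordinates of `logMap v` in the basis given by the fundamental units. -/
noncomputable def logCoord (v : mixedSpace K) (i : Fin (rank K)) : ℝ :=
  ((basisUnitLattice K).ofZLatticeBasis ℝ (unitLattice K)).repr (logMap v) i

/-- A smooth function on the mixed space whose sum over the orbit of `v` under the units only
depends on the norm of `v`. -/
noncomputable def coneWeight (v : mixedSpace K) : ℝ :=
  (∏ i, unitBump (logCoord K v i)) * normWeight (mixedEmbedding.norm v)

theorem coneWeight_nonneg (v : mixedSpace K) : 0 ≤ coneWeight K v :=
  mul_nonneg (Finset.prod_nonneg fun _ _ ↦ unitBump_nonneg _) (normWeight_nonneg _)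

theorem logCoord_unit_smul (u : torsion K) (n : Fin (rank K) → ℤ) {v : mixedSpace K}
    (hv : mixedEmbedding.norm v ≠ 0) (i : Fin (rank K)) :
    logCoord K ((u * ∏ i, fundSystem K i ^ n i : (𝓞 K)ˣ) • v) i = logCoord K v i + n i := by
  classical
  have hu : logEmbedding K (Additive.ofMul (u : (𝓞 K)ˣ)) = 0 := logEmbedding_eq_zero_iff.2 u.2
  unfold logCoord
  rw [logMap_unit_smul _ hv]
  simp only [ofMul_mul, map_add, hu, zero_add, ofMul_prod, map_sum, ofMul_zpow, map_zsmul,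
    logEmbedding_fundSystem]
  have : ∀ j, ((basisUnitLattice K j : unitLattice K) : logSpace K) =
      (basisUnitLattice K).ofZLatticeBasis ℝ (unitLattice K) j := fun j ↦
    ((basisUnitLattice K).ofZLatticeBasis_apply ℝ _ j).symm
  simp only [this, Finsupp.add_apply, Finsupp.coe_finsetSum,
    Finset.sum_apply, Finsupp.coe_smul, Pi.smul_apply, Basis.repr_self]
  rw [Finset.sum_eq_single i]
  · simp [add_comm]
  · intro j _ hj
    simp [hj]
  · simp

theorem hasSum_coneWeight_unit_smul {v : mixedSpace K} (hv : mixedEmbedding.norm v ≠ 0) :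
    HasSum (fun u : (𝓞 K)ˣ ↦ coneWeight K (u • v))
      (torsionOrder K * normWeight (mixedEmbedding.norm v)) := by
  classical
  have hbij : Function.Bijective fun x : torsion K × (Fin (rank K) → ℤ) ↦
      (x.1 * ∏ i, fundSystem K i ^ x.2 i : (𝓞 K)ˣ) := by
    rw [Function.bijective_iff_existsUnique]
    intro u
    obtain ⟨x, hx, hx'⟩ := exist_unique_eq_mul_prod K u
    exact ⟨x, hx.symm, fun y hy ↦ hx' y hy.symm⟩
  rw [← (Equiv.ofBijective _ hbij).hasSum_iff]
  have heq : (fun u : (𝓞 K)ˣ ↦ coneWeight K (u • v)) ∘ (Equiv.ofBijective _ hbij) =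
      fun x : torsion K × (Fin (rank K) → ℤ) ↦ (1 : ℝ) *
        ((∏ i, unitBump (logCoord K v i + x.2 i)) * normWeight (mixedEmbedding.norm v)) := by
    ext x
    simp only [Function.comp_apply, Equiv.ofBijective_apply, coneWeight,
      logCoord_unit_smul K _ _ hv,
      norm_unit_smul, one_mul]
  rw [heq]
  have := Fintype.ofFinite (torsion K)
  have h1 : HasSum (fun _ : torsion K ↦ (1 : ℝ)) (torsionOrder K) := by
    convert hasSum_fintype (fun _ : torsion K ↦ (1 : ℝ))
    simp [torsionOrder]
  have h2 := (hasSum_prod_unitBump (logCoord K v)).mul_right (normWeight (mixedEmbedding.norm v))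
  rw [one_mul] at h2
  refine h1.mul h2 ?_
  exact summable_mul_of_summable_norm (h1.summable.norm) (h2.summable.norm)

open scoped Classical in
theorem contDiffAt_normAtPlace {v : mixedSpace K} {w : InfinitePlace K}
    (hv : normAtPlace w v ≠ 0) : ContDiffAt ℝ ∞ (normAtPlace w) v := by
  rcases w.isReal_or_isComplex with hw | hw
  · have : (normAtPlace w : mixedSpace K → ℝ) = fun x ↦ ‖x.1 ⟨w, hw⟩‖ := by
      ext x; exact normAtPlace_apply_of_isReal hw x
    rw [this]
    refine ContDiffAt.norm ℝ (by fun_prop) fun h ↦ hv ?_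
    simp [normAtPlace_apply_of_isReal hw, h]
  · have : (normAtPlace w : mixedSpace K → ℝ) = fun x ↦ ‖x.2 ⟨w, hw⟩‖ := by
      ext x; exact normAtPlace_apply_of_isComplex hw x
    rw [this]
    refine ContDiffAt.norm ℝ (by fun_prop) fun h ↦ hv ?_
    simp [normAtPlace_apply_of_isComplex hw, h]

open scoped Classical in
theorem contDiff_coneWeight : ContDiff ℝ ∞ (coneWeight K) := by
  rw [contDiff_iff_contDiffAt]
  intro v
  by_cases hv : mixedEmbedding.norm v < 1
  · refine (contDiffAt_const (c := (0 : ℝ))).congr_of_eventuallyEq ?_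
    filter_upwards [(mixedEmbedding.continuous_norm K).continuousAt.eventually_lt_const hv]
      with x hx
    simp [coneWeight, normWeight_of_le_one hx.le]
  · have h0 : mixedEmbedding.norm v ≠ 0 := by linarith
    have hw := mixedEmbedding.norm_ne_zero_iff.1 h0
    have hplace := fun w ↦ contDiffAt_normAtPlace K (hw w)
    have hnorm : ContDiffAt ℝ ∞ (mixedEmbedding.norm : mixedSpace K → ℝ) v := by
      have : (mixedEmbedding.norm : mixedSpace K → ℝ) =
          fun x ↦ ∏ w, (normAtPlace w x) ^ (mult w) := by
        ext x; exact mixedEmbedding.norm_apply x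
      rw [this]
      exact contDiffAt_prod fun w _ ↦ (hplace w).pow _
    have hlog : ContDiffAt ℝ ∞ (logMap : mixedSpace K → logSpace K) v := by
      rw [contDiffAt_pi]
      intro w
      exact contDiffAt_const.mul (((hplace w.1).log (hw w.1)).sub
        ((hnorm.log h0).mul contDiffAt_const))
    refine ContDiffAt.mul (contDiffAt_prod fun i _ ↦ contDiff_unitBump.contDiffAt.comp v ?_)
      (contDiff_normWeight.contDiffAt.comp v hnorm)
    let l := LinearMap.toContinuousLinearMap
      (((basisUnitLattice K).ofZLatticeBasis ℝ (unitLattice K)).coord i)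
    exact l.contDiff.contDiffAt.comp v hlog

open scoped Classical in
theorem hasCompactSupport_coneWeight : HasCompactSupport (coneWeight K) := by
  let b := (basisUnitLattice K).ofZLatticeBasis ℝ (unitLattice K)
  obtain ⟨R, hR⟩ : ∃ R, R = ∑ i, ‖b i‖ := ⟨_, rfl⟩
  have hR0 : 0 ≤ R := hR ▸ Finset.sum_nonneg fun _ _ ↦ norm_nonneg _
  obtain ⟨S, hS⟩ : ∃ S, S = R + Real.log 3 := ⟨_, rfl⟩
  have hl3 : 0 ≤ Real.log 3 := Real.log_nonneg (by norm_num)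
  have hS0 : 0 ≤ S := hS ▸ add_nonneg hR0 hl3
  obtain ⟨Q, hQ⟩ : ∃ Q, Q = S + Real.log 3 +
    (Fintype.card {w : InfinitePlace K // w ≠ w₀}) * (2 * S) := ⟨_, rfl⟩
  have hSQ : S ≤ Q := by
    rw [hQ, add_assoc]
    exact le_add_of_nonneg_right (by positivity)
  refine HasCompactSupport.intro (isCompact_closedBall (0 : mixedSpace K) (Real.exp Q))
    fun v hv ↦ ?_
  by_contra hne
  refine hv ?_
  have hn := right_ne_zero_of_mul hne
  have hn1 : 1 < mixedEmbedding.norm v := by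
    by_contra h; exact hn (normWeight_of_le_one (not_lt.1 h))
  have hn3 : mixedEmbedding.norm v < 3 := by
    by_contra h; exact hn (normWeight_of_three_le (not_lt.1 h))
  have hc : ∀ i, |b.repr (logMap v) i| ≤ 1 := by
    intro i
    have := Finset.prod_ne_zero_iff.1 (left_ne_zero_of_mul hne) i (Finset.mem_univ i)
    rw [abs_le]
    constructor
    · by_contra h; exact this (unitBump_of_le_neg_one (not_le.1 h).le)
    · by_contra h; exact this (unitBump_of_one_le (not_le.1 h).le)
  have hlogmap : ‖logMap v‖ ≤ R := by
    rw [← b.sum_repr (logMap v), hR]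
    refine (norm_sum_le _ _).trans (Finset.sum_le_sum fun i _ ↦ ?_)
    rw [_root_.norm_smul]
    exact mul_le_of_le_one_left (norm_nonneg _) (hc i)
  have hln0 : 0 ≤ Real.log (mixedEmbedding.norm v) := Real.log_nonneg hn1.le
  have hln3 : Real.log (mixedEmbedding.norm v) ≤ Real.log 3 :=
    Real.log_le_log (by linarith) hn3.le
  have hplace := mixedEmbedding.norm_ne_zero_iff.1 (by linarith : mixedEmbedding.norm v ≠ 0)
  have hd : (1 : ℝ) ≤ finrank ℚ K := by exact_mod_cast finrank_pos
  have hbd : ∀ w : {w : InfinitePlace K // w ≠ w₀}, |Real.log (normAtPlace w.1 v)| ≤ S := by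
    intro w
    have h1 := (norm_le_pi_norm (logMap v) w).trans hlogmap
    rw [logMap_apply, norm_mul, Real.norm_eq_abs, Real.norm_eq_abs, Nat.abs_cast] at h1
    have hm : (1 : ℝ) ≤ mult w.1 := by exact_mod_cast one_le_mult
    have h2 := (le_mul_of_one_le_left (abs_nonneg _) hm).trans h1
    have h3 : |Real.log (mixedEmbedding.norm v) * (finrank ℚ K : ℝ)⁻¹| ≤ Real.log 3 := by
      rw [abs_of_nonneg (by positivity)]
      exact (mul_le_of_le_one_right hln0 (inv_le_one_of_one_le₀ hd)).trans hln3
    have := abs_sub_abs_le_abs_sub (Real.log (normAtPlace w.1 v))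
      (Real.log (mixedEmbedding.norm v) * (finrank ℚ K : ℝ)⁻¹)
    linarith
  have hsum : Real.log (mixedEmbedding.norm v) = mult (w₀ : InfinitePlace K) *
      Real.log (normAtPlace w₀ v) +
      ∑ w : {w : InfinitePlace K // w ≠ w₀}, mult w.1 * Real.log (normAtPlace w.1 v) := by
    rw [mixedEmbedding.norm_apply, Real.log_prod (fun w _ ↦ pow_ne_zero _ (hplace w))]
    simp only [Real.log_pow]
    rw [Fintype.sum_eq_add_sum_subtype_ne _ w₀]
  have hw0 : Real.log (normAtPlace w₀ v) ≤ Q := by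
    have hm : (1 : ℝ) ≤ mult (w₀ : InfinitePlace K) := by exact_mod_cast one_le_mult
    have h1 : |∑ w : {w : InfinitePlace K // w ≠ w₀}, mult w.1 * Real.log (normAtPlace w.1 v)| ≤
        (Fintype.card {w : InfinitePlace K // w ≠ w₀}) * (2 * S) := by
      refine (Finset.abs_sum_le_sum_abs _ _).trans ?_
      refine (Finset.sum_le_card_nsmul _ _ (2 * S) fun w _ ↦ ?_).trans (by simp)
      rw [abs_mul, Nat.abs_cast]
      have h2 : (mult w.1 : ℝ) ≤ 2 := by
        have : mult w.1 ≤ 2 := by unfold mult; split_ifs <;> omega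
        exact_mod_cast this
      gcongr
      exact hbd w
    have h2 := (abs_le.1 h1).1
    rcases le_or_gt (Real.log (normAtPlace w₀ v)) 0 with h | h
    · exact h.trans (hS0.trans hSQ)
    · have h3 := le_mul_of_one_le_left h.le hm
      rw [hQ]
      linarith only [h3, h2, hsum, hln3, hS0]
  rw [mem_closedBall_zero_iff, norm_eq_sup'_normAtPlace]
  refine Finset.sup'_le _ _ fun w _ ↦ ?_
  have hpos : 0 < normAtPlace w v := lt_of_le_of_ne (normAtPlace_nonneg _ _) (hplace w).symm
  rw [← Real.log_le_iff_le_exp hpos]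
  by_cases h : w = w₀
  · rw [h]; exact hw0
  · have h1 := (abs_le.1 (hbd ⟨w, h⟩)).2
    exact h1.trans hSQ

open scoped Classical in
theorem integral_coneWeight_pos : 0 < ∫ v, coneWeight K v := by
  have hd : (finrank ℚ K : ℝ) ≠ 0 := by exact_mod_cast finrank_pos.ne'
  refine (contDiff_coneWeight K).continuous.integral_pos_of_hasCompactSupport_nonneg_nonzero
    (hasCompactSupport_coneWeight K) (coneWeight_nonneg K)
    (x := ((2 : ℝ) ^ (finrank ℚ K : ℝ)⁻¹) • (1 : mixedSpace K)) ?_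
  have h1 : mixedEmbedding.norm (((2 : ℝ) ^ (finrank ℚ K : ℝ)⁻¹) • (1 : mixedSpace K)) = 2 := by
    rw [mixedEmbedding.norm_smul, map_one, mul_one, abs_of_pos (by positivity),
      ← Real.rpow_natCast, ← Real.rpow_mul (by norm_num), inv_mul_cancel₀ hd, Real.rpow_one]
  simp only [coneWeight, logCoord, logMap_real, h1, map_zero, Finsupp.coe_zero, Pi.zero_apply,
    unitBump_zero, Finset.prod_const_one, one_mul]
  exact (normWeight_pos (by norm_num) (by norm_num)).ne'

end ConeWeight

section ClassSum

open NumberField NumberField.Units NumberField.mixedEmbedding NumberField.InfinitePlace Module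
open scoped nonZeroDivisors

variable (K : Type*) [Field K] [NumberField K]

/-- The smoothly weighted count of the ideals of norm of size `1 / t` in the ideal class `C`. -/
noncomputable def classTheta (C : ClassGroup (𝓞 K)) (t : ℝ) : ℝ :=
  ∑' I : {I : (Ideal (𝓞 K))⁰ // ClassGroup.mk0 I = C},
    normWeight (t * Ideal.absNorm (I.1 : Ideal (𝓞 K)))

theorem torsionOrder_mul_classTheta {C : ClassGroup (𝓞 K)} {J : (Ideal (𝓞 K))⁰}
    (hJ : ClassGroup.mk0 J = C⁻¹) {h : ℝ} (h0 : 0 < h) :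
    torsionOrder K * classTheta K C (h ^ finrank ℚ K * Ideal.absNorm (J : Ideal (𝓞 K))) =
      ∑' l : idealLattice K (FractionalIdeal.mk0 K J), coneWeight K (h • (l : mixedSpace K)) := by
  classical
  have hprin : ∀ I : {I : (Ideal (𝓞 K))⁰ // ClassGroup.mk0 I = C},
      ∃ a : 𝓞 K, Ideal.span {a} = (I.1 : Ideal (𝓞 K)) * J := by
    intro I
    have h1 : ClassGroup.mk0 (I.1 * J) = 1 := by rw [map_mul, I.2, hJ, mul_inv_cancel]
    obtain ⟨a, ha⟩ := ((ClassGroup.mk0_eq_one_iff (I.1 * J).2).1 h1)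
    exact ⟨a, ha.symm⟩
  choose α hα using hprin
  have hα0 : ∀ I, α I ≠ 0 := by
    intro I h
    have := hα I
    rw [h, Ideal.span_singleton_zero] at this
    exact nonZeroDivisors.coe_ne_zero (I.1 * J) this.symm
  have hmem : ∀ (I) (u : (𝓞 K)ˣ), mixedEmbedding K ((u * α I : 𝓞 K) : K) ∈
      idealLattice K (FractionalIdeal.mk0 K J) := by
    intro I u
    have hm : α I ∈ (J : Ideal (𝓞 K)) := by
      rw [← Ideal.dvd_span_singleton, hα]
      exact dvd_mul_left _ _
    have hm' : (u * α I : 𝓞 K) ∈ (J : Ideal (𝓞 K)) := Ideal.mul_mem_left _ _ hm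
    rw [mem_idealLattice]
    refine ⟨((u * α I : 𝓞 K) : K), ?_, rfl⟩
    rw [FractionalIdeal.coe_mk0]
    exact (FractionalIdeal.mem_coeIdeal _).2 ⟨_, hm', rfl⟩
  let φ : {I : (Ideal (𝓞 K))⁰ // ClassGroup.mk0 I = C} × (𝓞 K)ˣ →
      idealLattice K (FractionalIdeal.mk0 K J) := fun x ↦ ⟨_, hmem x.1 x.2⟩
  have hφ : Function.Injective φ := by
    rintro ⟨I, u⟩ ⟨I', u'⟩ h
    have h1 : (u * α I : 𝓞 K) = u' * α I' :=
      RingOfIntegers.ext ((mixedEmbedding_injective K) (congrArg Subtype.val h))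
    have h2 : (I.1 : Ideal (𝓞 K)) * J = I'.1 * J := by
      rw [← hα, ← hα, Ideal.span_singleton_eq_span_singleton]
      exact ⟨u * u'⁻¹, by
        rw [Units.val_mul, ← mul_assoc, mul_comm (α I), h1]
        rw [mul_right_comm, mul_comm, ← mul_assoc]; simp⟩
    have h3 : I = I' := Subtype.ext (Subtype.ext (mul_right_cancel₀
      (nonZeroDivisors.coe_ne_zero J) h2))
    subst h3
    have := mul_right_cancel₀ (hα0 I) h1
    rw [Units.ext this]
  have hzero : coneWeight K 0 = 0 := by
    simp [coneWeight, normWeight_of_le_one zero_le_one]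
  have hrange : Function.support (fun l : idealLattice K (FractionalIdeal.mk0 K J) ↦
      coneWeight K (h • (l : mixedSpace K))) ⊆ Set.range φ := by
    rintro ⟨l, hl⟩ hne
    rw [mem_idealLattice] at hl
    obtain ⟨y, hy, rfl⟩ := hl
    rw [FractionalIdeal.coe_mk0] at hy
    obtain ⟨a, ha, rfl⟩ := (FractionalIdeal.mem_coeIdeal _).1 hy
    have ha0 : a ≠ 0 := by
      rintro rfl
      simp [hzero] at hne
    obtain ⟨I, hI⟩ : (J : Ideal (𝓞 K)) ∣ Ideal.span {a} := by
      rwa [Ideal.dvd_span_singleton]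
    have hI0 : I ≠ 0 := by
      rintro rfl
      simp [ha0] at hI
    let I' : (Ideal (𝓞 K))⁰ := ⟨I, mem_nonZeroDivisors_of_ne_zero hI0⟩
    have hIC : ClassGroup.mk0 I' = C := by
      have : ClassGroup.mk0 (J * I') = 1 := by
        refine (ClassGroup.mk0_eq_one_iff (J * I').2).2 ⟨a, ?_⟩
        exact hI.symm
      rw [map_mul, hJ, inv_mul_eq_one] at this
      exact this.symm
    have : Ideal.span {α ⟨I', hIC⟩} = Ideal.span {a} := by
      rw [hα, hI, mul_comm]
    obtain ⟨u, hu⟩ := Ideal.span_singleton_eq_span_singleton.1 this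
    refine ⟨(⟨I', hIC⟩, u), Subtype.ext ?_⟩
    simp only [φ]
    rw [mul_comm, hu]
  rw [← hφ.tsum_eq hrange]
  have hsum : Summable fun x ↦ coneWeight K (h • (φ x : mixedSpace K)) :=
    (summable_of_hasFiniteSupport (finite_support_lattice_smul _
      (hasCompactSupport_coneWeight K) h0)).comp_injective hφ
  have hfib : ∀ I, HasSum (fun u ↦ coneWeight K (h • (φ (I, u) : mixedSpace K)))
      (torsionOrder K * normWeight (h ^ finrank ℚ K * Ideal.absNorm (J : Ideal (𝓞 K)) *
        Ideal.absNorm (I.1 : Ideal (𝓞 K)))) := by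
    intro I
    have hn : mixedEmbedding.norm (h • mixedEmbedding K (α I : K)) =
        h ^ finrank ℚ K * Ideal.absNorm (J : Ideal (𝓞 K)) *
        Ideal.absNorm (I.1 : Ideal (𝓞 K)) := by
      rw [mixedEmbedding.norm_smul, mixedEmbedding.norm_eq_norm, abs_of_pos h0, mul_assoc,
        ← Nat.cast_mul, mul_comm (Ideal.absNorm _), ← map_mul, ← hα, Ideal.absNorm_span_singleton]
      congr 1
      rw [← Algebra.coe_norm_int, ← Int.cast_abs, Nat.cast_natAbs]
      simp
    have hn0 : mixedEmbedding.norm (h • mixedEmbedding K (α I : K)) ≠ 0 := by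
      rw [hn]
      have := (Ideal.absNorm_pos_of_nonZeroDivisors J)
      have := (Ideal.absNorm_pos_of_nonZeroDivisors I.1)
      positivity
    have := hasSum_coneWeight_unit_smul K hn0
    rw [hn] at this
    convert this using 3 with u
    simp [φ, unitSMul_smul]
  rw [hsum.tsum_prod' fun I ↦ (hfib I).summable, classTheta, ← tsum_mul_left]
  exact tsum_congr fun I ↦ (hfib I).tsum_eq.symm

theorem exists_classTheta_sub_le : ∃ κ B : ℝ, 0 < κ ∧ ∀ (C : ClassGroup (𝓞 K)) (t : ℝ), 0 < t →
    t ≤ 1 → |classTheta K C t - κ / t| ≤ B * t ^ (finrank ℚ K : ℝ)⁻¹ := by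
  classical
  set c : ℝ := (2⁻¹) ^ nrComplexPlaces K * √|discr K| with hc
  have hc0 : 0 < c := by
    have : discr K ≠ 0 := discr_ne_zero K
    have : (0 : ℝ) < |discr K| := by exact_mod_cast abs_pos.2 this
    positivity
  set w : ℝ := (torsionOrder K : ℝ) with hw
  have hw0 : 0 < w := by rw [hw]; exact_mod_cast torsionOrder_pos K
  have hd : (finrank ℚ K : ℝ) ≠ 0 := by exact_mod_cast (finrank_pos (R := ℚ) (M := K)).ne'
  have hI := integral_coneWeight_pos K
  have hmain : ∀ C : ClassGroup (𝓞 K), ∃ B : ℝ, ∀ t : ℝ, 0 < t → t ≤ 1 →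
      |classTheta K C t - (w⁻¹ * c⁻¹ * ∫ v, coneWeight K v) / t| ≤
        B * t ^ (finrank ℚ K : ℝ)⁻¹ := by
    intro C
    obtain ⟨J, hJ⟩ := ClassGroup.mk0_surjective C⁻¹
    obtain ⟨B, hB⟩ := exists_abs_lattice_sum_sub_le (idealLattice K (FractionalIdeal.mk0 K J))
      volume (contDiff_coneWeight K) (hasCompactSupport_coneWeight K)
    set N : ℝ := (Ideal.absNorm (J : Ideal (𝓞 K)) : ℝ) with hN
    have hN1 : 1 ≤ N := by
      rw [hN]; exact_mod_cast Ideal.absNorm_pos_of_nonZeroDivisors J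
    refine ⟨w⁻¹ * max B 0, fun t ht ht1 ↦ ?_⟩
    set h : ℝ := (t / N) ^ (finrank ℚ K : ℝ)⁻¹ with hh
    have h0 : 0 < h := by positivity
    have hle : h ≤ t ^ (finrank ℚ K : ℝ)⁻¹ := by
      refine Real.rpow_le_rpow (by positivity) (div_le_self ht.le hN1) (by positivity)
    have hh1 : h ≤ 1 := hle.trans (Real.rpow_le_one ht.le ht1 (by positivity))
    have hpow : h ^ finrank ℚ K = t / N := by
      rw [hh, ← Real.rpow_natCast, ← Real.rpow_mul (by positivity), inv_mul_cancel₀ hd,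
        Real.rpow_one]
    have hkey := torsionOrder_mul_classTheta K hJ h0
    rw [hpow, ← hN, div_mul_cancel₀ _ (by positivity)] at hkey
    have := hB h h0 hh1
    rw [← hkey, mixedEmbedding.finrank, hpow, covolume_idealLattice, FractionalIdeal.coe_mk0,
      FractionalIdeal.coeIdeal_absNorm, Rat.cast_natCast, ← hN, mul_assoc N, ← hc, ← hw] at this
    have e : w * classTheta K C t - (t / N)⁻¹ * (N * c)⁻¹ * ∫ v, coneWeight K v =
        w * (classTheta K C t - (w⁻¹ * c⁻¹ * ∫ v, coneWeight K v) / t) := by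
      field_simp
    rw [e, abs_mul, abs_of_pos hw0] at this
    rw [mul_assoc w⁻¹ (max B 0)]
    refine (le_inv_mul_iff₀ hw0).2 ?_
    calc _ ≤ B * h := this
      _ ≤ max B 0 * h := by gcongr; exact le_max_left _ _
      _ ≤ _ := by gcongr
  choose B hB using hmain
  refine ⟨_, ∑ C, |B C|, by positivity, fun C t ht ht1 ↦ (hB C t ht ht1).trans ?_⟩
  gcongr
  exact (le_abs_self _).trans (Finset.single_le_sum (f := fun C ↦ |B C|)
    (fun _ _ ↦ abs_nonneg _) (Finset.mem_univ C))

end ClassSum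

section IdealTheta

open NumberField Module
open scoped nonZeroDivisors

variable (K : Type*) [Field K] [NumberField K]

/-- The norm of a nonzero ideal of the ring of integers, as a real number. -/
noncomputable def idealNorm (I : (Ideal (𝓞 K))⁰) : ℝ := Ideal.absNorm (I : Ideal (𝓞 K))

theorem one_le_idealNorm (I : (Ideal (𝓞 K))⁰) : 1 ≤ idealNorm K I := by
  rw [idealNorm]; exact_mod_cast Ideal.absNorm_pos_of_nonZeroDivisors I

theorem idealNorm_pos (I : (Ideal (𝓞 K))⁰) : 0 < idealNorm K I :=
  one_pos.trans_le (one_le_idealNorm K I)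

theorem idealNorm_mul (I J : (Ideal (𝓞 K))⁰) :
    idealNorm K (I * J) = idealNorm K I * idealNorm K J := by
  simp [idealNorm]

theorem finite_idealNorm_le (x : ℝ) : {I : (Ideal (𝓞 K))⁰ | idealNorm K I ≤ x}.Finite := by
  refine (Ideal.finite_setOfPred_absNorm_le₀ (S := 𝓞 K) ⌈x⌉₊).subset fun I hI ↦ ?_
  have : (Ideal.absNorm (I : Ideal (𝓞 K)) : ℝ) ≤ ⌈x⌉₊ := hI.trans (Nat.le_ceil x)
  exact_mod_cast this

theorem idealNorm_le_of_normWeight_ne_zero {t : ℝ} {I : (Ideal (𝓞 K))⁰} {t₀ : ℝ} (ht₀ : 0 < t₀)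
    (ht : t₀ ≤ t) (h : normWeight (t * idealNorm K I) ≠ 0) : idealNorm K I ≤ 3 / t₀ := by
  rw [le_div_iff₀ ht₀]
  by_contra! h3
  refine h (normWeight_of_three_le (h3.le.trans ?_))
  rw [mul_comm]
  exact mul_le_mul_of_nonneg_right ht (idealNorm_pos K I).le

/-- The smoothly weighted sum over nonzero ideals of a function of the ideal class. -/
noncomputable def idealTheta (a : ClassGroup (𝓞 K) → ℂ) (t : ℝ) : ℂ :=
  ∑' I : (Ideal (𝓞 K))⁰, a (ClassGroup.mk0 I) * (normWeight (t * idealNorm K I) : ℂ)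

variable {K}

theorem idealTheta_eq_finset_sum (a : ClassGroup (𝓞 K) → ℂ) {t₀ t : ℝ} (ht₀ : 0 < t₀)
    (ht : t₀ ≤ t) : idealTheta K a t = ∑ I ∈ (finite_idealNorm_le K (3 / t₀)).toFinset,
      a (ClassGroup.mk0 I) * (normWeight (t * idealNorm K I) : ℂ) := by
  refine tsum_eq_sum fun I hI ↦ ?_
  by_contra h
  refine hI ?_
  simp only [Finite.mem_toFinset, mem_ofPred_eq]
  refine idealNorm_le_of_normWeight_ne_zero K ht₀ ht fun h0 ↦ h ?_
  simp [h0]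

theorem summable_idealTheta (a : ClassGroup (𝓞 K) → ℂ) {t : ℝ} (ht : 0 < t) :
    Summable fun I : (Ideal (𝓞 K))⁰ ↦
      a (ClassGroup.mk0 I) * (normWeight (t * idealNorm K I) : ℂ) := by
  refine summable_of_ne_finset_zero (s := (finite_idealNorm_le K (3 / t)).toFinset) fun I hI ↦ ?_
  by_contra h
  refine hI ?_
  simp only [Finite.mem_toFinset, mem_ofPred_eq]
  refine idealNorm_le_of_normWeight_ne_zero K ht le_rfl fun h0 ↦ h ?_
  simp [h0]

theorem continuousOn_idealTheta (a : ClassGroup (𝓞 K) → ℂ) :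
    ContinuousOn (idealTheta K a) (Ioi 0) := by
  intro t ht
  have ht : 0 < t := ht
  have hc : Continuous fun u : ℝ ↦ ∑ I ∈ (finite_idealNorm_le K (3 / (t / 2))).toFinset,
      a (ClassGroup.mk0 I) * (normWeight (u * idealNorm K I) : ℂ) :=
    continuous_finsetSum _ fun I _ ↦ continuous_const.mul <| Complex.continuous_ofReal.comp <|
      continuous_normWeight.comp (continuous_id.mul continuous_const)
  refine (hc.continuousAt.congr ?_).continuousWithinAt
  filter_upwards [lt_mem_nhds (half_lt_self ht)] with u hu
  exact (idealTheta_eq_finset_sum a (half_pos ht) hu.le).symm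

theorem idealTheta_of_three_le (a : ClassGroup (𝓞 K) → ℂ) {t : ℝ} (ht : 3 ≤ t) :
    idealTheta K a t = 0 := by
  refine (tsum_congr fun I ↦ ?_).trans tsum_zero
  rw [normWeight_of_three_le]
  · simp
  · nlinarith [one_le_idealNorm K I]

theorem idealTheta_eq_sum_classTheta (a : ClassGroup (𝓞 K) → ℂ) {t : ℝ} (ht : 0 < t) :
    idealTheta K a t = ∑ C, a C * (classTheta K C t : ℂ) := by
  have hs := summable_idealTheta a ht
  rw [idealTheta, ← (Equiv.sigmaFiberEquiv (ClassGroup.mk0 (R := 𝓞 K))).tsum_eq,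
    Summable.tsum_sigma, tsum_fintype]
  · refine Finset.sum_congr rfl fun C _ ↦ ?_
    rw [classTheta, Complex.ofReal_tsum, ← tsum_mul_left]
    refine tsum_congr fun I ↦ ?_
    simp [Equiv.sigmaFiberEquiv, I.2, idealNorm]
  · exact (Equiv.sigmaFiberEquiv (ClassGroup.mk0 (R := 𝓞 K))).summable_iff.2 hs

/-- The exponent in the error term of the ideal counting asymptotics. -/
noncomputable def errorExp (K : Type*) [Field K] [NumberField K] : ℝ := (finrank ℚ K : ℝ)⁻¹

theorem errorExp_pos : 0 < errorExp K := by
  have := finrank_pos (R := ℚ) (M := K)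
  rw [errorExp]; positivity

theorem exists_idealTheta_sub_le : ∃ κ : ℝ, 0 < κ ∧ ∀ a : ClassGroup (𝓞 K) → ℂ, ∃ B : ℝ, 0 ≤ B ∧
    ∀ t : ℝ, 0 < t → t ≤ 1 → ‖idealTheta K a t - κ * (∑ C, a C) / t‖ ≤ B * t ^ errorExp K := by
  obtain ⟨κ, B, hκ, hB⟩ := exists_classTheta_sub_le K
  refine ⟨κ, hκ, fun a ↦ ⟨(∑ C, ‖a C‖) * max B 0, by positivity, fun t h0 h1 ↦ ?_⟩⟩
  have e : idealTheta K a t - κ * (∑ C, a C) / t =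
      ∑ C, a C * ((classTheta K C t - κ / t : ℝ) : ℂ) := by
    rw [idealTheta_eq_sum_classTheta a h0, Finset.mul_sum, Finset.sum_div, ← Finset.sum_sub_distrib]
    refine Finset.sum_congr rfl fun C _ ↦ ?_
    push_cast; ring
  rw [e, mul_assoc, Finset.sum_mul]
  refine (norm_sum_le _ _).trans (Finset.sum_le_sum fun C _ ↦ ?_)
  rw [norm_mul, Complex.norm_real, Real.norm_eq_abs]
  gcongr
  exact (hB C t h0 h1).trans (by rw [errorExp]; gcongr; exact le_max_left _ _)

end IdealTheta

section NormWeightMellin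

/-- The real Mellin transform of `normWeight`. -/
noncomputable def normWeightMellin (s : ℝ) : ℝ := ∫ t in Ioi (0 : ℝ), t ^ (s - 1) * normWeight t

theorem mellinConvergent_normWeight (s : ℂ) :
    MellinConvergent (fun t ↦ (normWeight t : ℂ)) s ∧
      DifferentiableAt ℂ (mellin fun t ↦ (normWeight t : ℂ)) s := by
  have hc : Continuous fun t ↦ (normWeight t : ℂ) :=
    Complex.continuous_ofReal.comp continuous_normWeight
  have h1 : LocallyIntegrableOn (fun t ↦ (normWeight t : ℂ)) (Ioi 0) :=
    hc.locallyIntegrable.locallyIntegrableOn _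
  have h2 : (fun t ↦ (normWeight t : ℂ)) =O[atTop] (· ^ (-(s.re + 1))) := by
    refine Asymptotics.IsBigO.of_bound 0 ?_
    filter_upwards [eventually_ge_atTop 3] with t ht
    simp [normWeight_of_three_le ht]
  have h3 : (fun t ↦ (normWeight t : ℂ)) =O[𝓝[>] 0] (· ^ (-(s.re - 1))) := by
    refine Asymptotics.IsBigO.of_bound 0 ?_
    filter_upwards [mem_nhdsWithin_of_mem_nhds (Iio_mem_nhds one_pos)] with t ht
    simp [normWeight_of_le_one (le_of_lt ht)]
  exact ⟨mellinConvergent_of_isBigO_rpow h1 h2 (by linarith) h3 (by linarith),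
    mellin_differentiableAt_of_isBigO_rpow h1 h2 (by linarith) h3 (by linarith)⟩

theorem ofReal_cpow_smul_ofReal {t : ℝ} (ht : 0 < t) (s x : ℝ) :
    (t : ℂ) ^ ((s : ℂ) - 1) • (x : ℂ) = ((t ^ (s - 1) * x : ℝ) : ℂ) := by
  rw [smul_eq_mul, Complex.ofReal_mul, Complex.ofReal_cpow ht.le]
  push_cast; rfl

theorem mellin_ofReal (f : ℝ → ℝ) (s : ℝ) :
    mellin (fun t ↦ (f t : ℂ)) s = ((∫ t in Ioi (0 : ℝ), t ^ (s - 1) * f t : ℝ) : ℂ) := by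
  rw [mellin, ← integral_complex_ofReal]
  exact setIntegral_congr_fun measurableSet_Ioi fun t ht ↦ ofReal_cpow_smul_ofReal ht s _

theorem mellin_normWeight (s : ℝ) :
    mellin (fun t ↦ (normWeight t : ℂ)) s = normWeightMellin s := mellin_ofReal _ _

theorem mellinConvergent_ofReal {f : ℝ → ℝ} {s : ℝ} :
    MellinConvergent (fun t ↦ (f t : ℂ)) s ↔
      IntegrableOn (fun t ↦ t ^ (s - 1) * f t) (Ioi (0 : ℝ)) := by
  have he : EqOn (fun t : ℝ ↦ (t : ℂ) ^ ((s : ℂ) - 1) • (f t : ℂ))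
      (fun t ↦ ((t ^ (s - 1) * f t : ℝ) : ℂ)) (Ioi 0) := fun t ht ↦ ofReal_cpow_smul_ofReal ht s _
  rw [MellinConvergent, integrableOn_congr_fun he measurableSet_Ioi]
  exact ⟨fun h ↦ by simpa using! h.re, fun h ↦ h.ofReal⟩

theorem integrableOn_normWeight_mul {x : ℝ} (hx : 0 < x) (s : ℝ) :
    IntegrableOn (fun t ↦ t ^ (s - 1) * normWeight (t * x)) (Ioi (0 : ℝ)) := by
  rw [← mellinConvergent_ofReal (f := fun t ↦ normWeight (t * x))]
  have := (MellinConvergent.comp_mul_left (f := fun t ↦ (normWeight t : ℂ)) (s := s) hx).2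
    (mellinConvergent_normWeight s).1
  simpa only [mul_comm] using this

theorem integral_normWeight_mul {x : ℝ} (hx : 0 < x) (s : ℝ) :
    ∫ t in Ioi (0 : ℝ), t ^ (s - 1) * normWeight (t * x) = x ^ (-s) * normWeightMellin s := by
  have := mellin_comp_mul_right (fun t ↦ (normWeight t : ℂ)) s hx
  rw [mellin_normWeight, mellin_ofReal fun t ↦ normWeight (t * x), smul_eq_mul,
    ← Complex.ofReal_neg, ← Complex.ofReal_cpow hx.le] at this
  exact_mod_cast this

theorem normWeightMellin_pos (s : ℝ) : 0 < normWeightMellin s := by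
  have hi : IntegrableOn (fun t ↦ t ^ (s - 1) * normWeight t) (Ioi (0 : ℝ)) :=
    mellinConvergent_ofReal.1 (mellinConvergent_normWeight s).1
  rw [normWeightMellin, setIntegral_pos_iff_support_of_nonneg_ae _ hi]
  · refine lt_of_lt_of_le ?_ (measure_mono (s := Ioo 1 3) fun t ht ↦ ⟨?_, ?_⟩)
    · simp
    · have h1 := normWeight_pos ht.1 ht.2
      have h2 := Real.rpow_pos_of_pos (one_pos.trans ht.1) (s - 1)
      exact (mul_pos h2 h1).ne'
    · exact one_pos.trans ht.1
  · filter_upwards [ae_restrict_mem measurableSet_Ioi] with t ht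
    exact mul_nonneg (Real.rpow_nonneg (le_of_lt ht) _) (normWeight_nonneg _)

end NormWeightMellin

section ClassLSeries

open NumberField Module
open scoped nonZeroDivisors

variable {K : Type*} [Field K] [NumberField K]

instance countable_nonZeroIdeal : Countable (Ideal (𝓞 K))⁰ := by
  rw [← Set.countable_univ_iff]
  have : (univ : Set (Ideal (𝓞 K))⁰) = ⋃ n : ℕ, {I | idealNorm K I ≤ n} := by
    ext I
    simpa using exists_nat_ge (idealNorm K I)
  rw [this]
  exact countable_iUnion fun n ↦ (finite_idealNorm_le K n).countable

theorem exists_mellin_idealTheta : ∃ κ : ℝ, 0 < κ ∧ ∀ a : ClassGroup (𝓞 K) → ℂ, ∃ R : ℂ → ℂ,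
    DifferentiableOn ℂ R {s | 0 < s.re} ∧
    (∀ s : ℂ, 1 < s.re → MellinConvergent (idealTheta K a) s ∧
      mellin (idealTheta K a) s = R s + κ * (∑ C, a C) / (s - 1)) ∧
    (∑ C, a C = 0 → R 1 = ∫ t in Ioi (0 : ℝ), idealTheta K a t) := by
  obtain ⟨κ, hκ, H⟩ := exists_idealTheta_sub_le (K := K)
  refine ⟨κ, hκ, fun a ↦ ?_⟩
  obtain ⟨B, hB0, hB⟩ := H a
  obtain ⟨A, hA⟩ : ∃ A : ℂ, A = κ * ∑ C, a C := ⟨_, rfl⟩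
  rw [← hA] at hB ⊢
  let g : ℝ → ℂ := indicator (Ioc 0 1) fun t ↦ (t : ℂ) ^ (-1 : ℂ)
  have hg : ∀ s : ℂ, 1 < s.re → HasMellin (fun t ↦ A * g t) s (A / (s - 1)) := by
    intro s hs
    have h1 := hasMellin_cpow_Ioc (-1) (s := s) (by simpa using hs)
    have h2 := hasMellin_const_smul h1.1 A
    simp only [smul_eq_mul] at h2
    refine ⟨h2.1, h2.2.trans ?_⟩
    rw [h1.2]
    ring
  let r : ℝ → ℂ := fun t ↦ idealTheta K a t - A * g t
  have hrloc : LocallyIntegrableOn r (Ioi 0) := by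
    refine ((continuousOn_idealTheta a).locallyIntegrableOn measurableSet_Ioi).sub ?_
    have h2 : LocallyIntegrableOn (fun t : ℝ ↦ (t : ℂ) ^ (-1 : ℂ)) (Ioi 0) := by
      refine ContinuousOn.locallyIntegrableOn (fun t ht ↦ ?_) measurableSet_Ioi
      exact (Complex.continuousAt_ofReal_cpow_const t (-1)
        (Or.inr (ne_of_gt ht))).continuousWithinAt
    have h3 : LocallyIntegrableOn g (Ioi 0) := by
      intro x hx
      obtain ⟨u, hu, hi⟩ := h2 x hx
      exact ⟨u, hu, hi.indicator measurableSet_Ioc⟩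
    intro x hx
    obtain ⟨u, hu, hi⟩ := h3 x hx
    exact ⟨u, hu, hi.const_mul A⟩
  have hrtop : ∀ b : ℝ, r =O[atTop] (· ^ (-b)) := by
    intro b
    refine Asymptotics.IsBigO.of_bound 0 ?_
    filter_upwards [eventually_ge_atTop 3] with t ht
    have : t ∉ Ioc (0 : ℝ) 1 := fun h ↦ by linarith [h.2]
    simp [r, g, idealTheta_of_three_le a ht, this]
  have hrbot : r =O[𝓝[>] 0] (· ^ (-(0 : ℝ))) := by
    refine Asymptotics.IsBigO.of_bound B ?_
    filter_upwards [Ioc_mem_nhdsGT (one_pos (α := ℝ))] with t ht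
    have h1 := hB t ht.1 ht.2
    have h2 : r t = idealTheta K a t - A / t := by
      simp [r, g, ht, Complex.cpow_neg_one, div_eq_mul_inv]
    rw [h2]
    have h3 : t ^ errorExp K ≤ 1 := Real.rpow_le_one ht.1.le ht.2 errorExp_pos.le
    simp only [neg_zero, Real.rpow_zero, norm_one]
    nlinarith
  refine ⟨mellin r, fun s hs ↦ ?_, fun s hs ↦ ?_, fun h0 ↦ ?_⟩
  · exact (mellin_differentiableAt_of_isBigO_rpow hrloc (hrtop (s.re + 1)) (by linarith)
      hrbot hs).differentiableWithinAt
  · have h1 : MellinConvergent r s := mellinConvergent_of_isBigO_rpow hrloc (hrtop (s.re + 1))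
      (by linarith) hrbot (by linarith)
    have h2 := hasMellin_add h1 (hg s hs).1
    simp only [r, sub_add_cancel] at h2
    exact ⟨h2.1, h2.2.trans (by rw [(hg s hs).2])⟩
  · rw [h0, mul_zero] at hA
    rw [mellin]
    simp [r, hA]

variable (K) in
/-- The Dirichlet series attached to a function on the class group. -/
noncomputable def classLSeries (a : ClassGroup (𝓞 K) → ℂ) (s : ℝ) : ℂ :=
  ∑' I : (Ideal (𝓞 K))⁰, a (ClassGroup.mk0 I) * ((idealNorm K I ^ (-s) : ℝ) : ℂ)

theorem summable_idealNorm_rpow {s : ℝ} (hs : 1 < s) :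
    Summable fun I : (Ideal (𝓞 K))⁰ ↦ idealNorm K I ^ (-s) := by
  obtain ⟨κ, hκ, H⟩ := exists_mellin_idealTheta (K := K)
  obtain ⟨R, -, hR, -⟩ := H fun _ ↦ 1
  have hi : IntegrableOn (fun t ↦ t ^ (s - 1) * ‖idealTheta K (fun _ ↦ 1) t‖) (Ioi (0 : ℝ)) := by
    refine IntegrableOn.congr_fun (hR s (by simpa using hs)).1.norm (fun t ht ↦ ?_)
      measurableSet_Ioi
    have ht : 0 < t := ht
    simp only [norm_smul]
    rw [Complex.norm_cpow_eq_rpow_re_of_pos ht]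
    simp
  have hM := normWeightMellin_pos s
  refine summable_of_sum_le (c := (∫ t in Ioi (0 : ℝ),
    t ^ (s - 1) * ‖idealTheta K (fun _ ↦ 1) t‖) / normWeightMellin s)
    (fun I ↦ Real.rpow_nonneg (idealNorm_pos K I).le _) fun S ↦ ?_
  rw [le_div_iff₀ hM, Finset.sum_mul]
  simp_rw [← integral_normWeight_mul (idealNorm_pos K _)]
  rw [← integral_finsetSum _ fun I _ ↦ integrableOn_normWeight_mul (idealNorm_pos K I) s]
  refine setIntegral_mono_on (integrable_finsetSum _ fun I _ ↦
    integrableOn_normWeight_mul (idealNorm_pos K I) s) hi measurableSet_Ioi fun t ht ↦ ?_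
  have ht : 0 < t := ht
  rw [← Finset.mul_sum]
  refine mul_le_mul_of_nonneg_left ?_ (Real.rpow_nonneg ht.le _)
  have hsum := summable_idealTheta (K := K) (fun _ ↦ 1) ht
  simp only [one_mul] at hsum
  have hsum' := Complex.summable_ofReal.1 hsum
  rw [idealTheta]
  simp only [one_mul]
  rw [← Complex.ofReal_tsum, Complex.norm_real]
  exact (hsum'.sum_le_tsum _ fun _ _ ↦ normWeight_nonneg _).trans (le_abs_self _)

theorem exists_norm_classFun_le (a : ClassGroup (𝓞 K) → ℂ) : ∃ c : ℝ, 0 ≤ c ∧ ∀ C, ‖a C‖ ≤ c :=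
  ⟨∑ C, ‖a C‖, by positivity, fun C ↦
    Finset.single_le_sum (f := fun C ↦ ‖a C‖) (fun _ _ ↦ norm_nonneg _) (Finset.mem_univ C)⟩

theorem mellin_idealTheta (a : ClassGroup (𝓞 K) → ℂ) {s : ℝ} (hs : 1 < s) :
    mellin (idealTheta K a) s = classLSeries K a s * normWeightMellin s := by
  obtain ⟨c, hc0, hc⟩ := exists_norm_classFun_le a
  have hterm : ∀ I : (Ideal (𝓞 K))⁰, ∫ t in Ioi (0 : ℝ), (a (ClassGroup.mk0 I) *
      ((t ^ (s - 1) * normWeight (t * idealNorm K I) : ℝ) : ℂ)) =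
      a (ClassGroup.mk0 I) * ((idealNorm K I ^ (-s) : ℝ) : ℂ) * normWeightMellin s := by
    intro I
    rw [integral_const_mul, integral_complex_ofReal, integral_normWeight_mul (idealNorm_pos K I)]
    push_cast; ring
  have key := (hasSum_integral_of_summable_integral_norm (μ := volume.restrict (Ioi (0 : ℝ)))
    (F := fun (I : (Ideal (𝓞 K))⁰) (t : ℝ) ↦ a (ClassGroup.mk0 I) *
      ((t ^ (s - 1) * normWeight (t * idealNorm K I) : ℝ) : ℂ)) (fun I ↦
        ((integrableOn_normWeight_mul (idealNorm_pos K I) s).ofReal.const_mul _)) ?_)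
  · simp_rw [hterm] at key
    rw [classLSeries, ← tsum_mul_right, key.tsum_eq, mellin]
    refine setIntegral_congr_fun measurableSet_Ioi fun t ht ↦ ?_
    rw [idealTheta, smul_eq_mul, ← tsum_mul_left]
    refine tsum_congr fun I ↦ ?_
    rw [← ofReal_cpow_smul_ofReal ht, smul_eq_mul]
    ring
  · refine Summable.of_nonneg_of_le (fun I ↦ integral_nonneg fun _ ↦ norm_nonneg _) (fun I ↦ ?_)
      (((summable_idealNorm_rpow (K := K) hs).mul_left c).mul_right (normWeightMellin s))
    have : ∫ t in Ioi (0 : ℝ), ‖a (ClassGroup.mk0 I) *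
        ((t ^ (s - 1) * normWeight (t * idealNorm K I) : ℝ) : ℂ)‖ =
        ‖a (ClassGroup.mk0 I)‖ * (idealNorm K I ^ (-s) * normWeightMellin s) := by
      rw [← integral_normWeight_mul (idealNorm_pos K I), ← integral_const_mul]
      refine setIntegral_congr_fun measurableSet_Ioi fun t ht ↦ ?_
      rw [norm_mul, Complex.norm_real, Real.norm_of_nonneg
        (mul_nonneg (Real.rpow_nonneg (le_of_lt ht) _) (normWeight_nonneg _))]
    rw [this, mul_assoc]
    refine mul_le_mul_of_nonneg_right (hc _) (mul_nonneg
      (Real.rpow_nonneg (idealNorm_pos K I).le _) (normWeightMellin_pos s).le)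

theorem exists_classLSeries_continuation : ∃ κ : ℝ, 0 < κ ∧ ∀ a : ClassGroup (𝓞 K) → ℂ,
    ∃ Φ : ℂ → ℂ, ContinuousAt Φ 1 ∧ Φ 1 = κ * ∑ C, a C ∧
      ∀ s : ℝ, 1 < s → (s - 1) * classLSeries K a s = Φ s := by
  obtain ⟨κ, hκ, H⟩ := exists_mellin_idealTheta (K := K)
  have hM1 := normWeightMellin_pos 1
  refine ⟨κ / normWeightMellin 1, by positivity, fun a ↦ ?_⟩
  obtain ⟨R, hR, hRs, -⟩ := H a
  refine ⟨fun s ↦ ((s - 1) * R s + κ * ∑ C, a C) / mellin (fun t ↦ (normWeight t : ℂ)) s,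
    ?_, ?_, fun s hs ↦ ?_⟩
  · have h1 : ContinuousAt R 1 :=
      (hR.differentiableAt ((isOpen_lt continuous_const Complex.continuous_re).mem_nhds
        (by simp))).continuousAt
    refine ContinuousAt.div (by fun_prop) (mellinConvergent_normWeight 1).2.continuousAt ?_
    have := mellin_normWeight 1
    rw [Complex.ofReal_one] at this
    rw [this]; exact_mod_cast hM1.ne'
  · have := mellin_normWeight 1
    rw [Complex.ofReal_one] at this
    simp only [sub_self, zero_mul, zero_add, this]
    push_cast; ring
  · have h1 := (hRs s (by simpa using hs)).2
    rw [mellin_idealTheta a hs] at h1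
    have hM : (normWeightMellin s : ℂ) ≠ 0 := by exact_mod_cast (normWeightMellin_pos s).ne'
    have hs1 : (s : ℂ) - 1 ≠ 0 := by
      rw [sub_ne_zero]; exact_mod_cast hs.ne'
    simp only [mellin_normWeight]
    rw [eq_div_iff hM, mul_assoc, h1, mul_add, mul_div_cancel₀ _ hs1]

theorem exists_classLSeries_analyticAt (a : ClassGroup (𝓞 K) → ℂ) (ha : ∑ C, a C = 0) :
    ∃ Λ : ℂ → ℂ, AnalyticAt ℂ Λ 1 ∧ (∀ s : ℝ, 1 < s → classLSeries K a s = Λ s) ∧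
      (Λ 1 = 0 → ∫ t in Ioi (0 : ℝ), idealTheta K a t = 0) := by
  obtain ⟨κ, hκ, H⟩ := exists_mellin_idealTheta (K := K)
  obtain ⟨R, hR, hRs, hR1⟩ := H a
  have hM1 : mellin (fun t ↦ (normWeight t : ℂ)) 1 ≠ 0 := by
    have := mellin_normWeight 1
    rw [Complex.ofReal_one] at this
    rw [this]; exact_mod_cast (normWeightMellin_pos 1).ne'
  refine ⟨fun s ↦ R s / mellin (fun t ↦ (normWeight t : ℂ)) s, ?_, fun s hs ↦ ?_, fun h ↦ ?_⟩
  · refine AnalyticAt.div (hR.analyticAt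
      ((isOpen_lt continuous_const Complex.continuous_re).mem_nhds (by simp))) ?_ hM1
    exact (Complex.analyticAt_iff_eventually_differentiableAt).2
      (Eventually.of_forall fun s ↦ (mellinConvergent_normWeight s).2)
  · have h1 := (hRs s (by simpa using hs)).2
    rw [mellin_idealTheta a hs, ha, mul_zero, zero_div, add_zero] at h1
    have hM : (normWeightMellin s : ℂ) ≠ 0 := by exact_mod_cast (normWeightMellin_pos s).ne'
    simp only [mellin_normWeight]
    rw [eq_div_iff hM, h1]
  · rw [← hR1 ha]
    simpa [hM1] using h

end ClassLSeries

section DivisorSum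

variable {α : Type*} [CommMonoidWithZero α] [UniqueFactorizationMonoid α]
  [Subsingleton αˣ]

theorem sum_divisors_mul_of_isRelPrime (f : α →* ℝ) {x y : α}
    (hxy : IsRelPrime x y)
    {D Dx Dy : Finset α} (hD : ∀ J, J ∈ D ↔ J ∣ x * y) (hDx : ∀ J, J ∈ Dx ↔ J ∣ x)
    (hDy : ∀ J, J ∈ Dy ↔ J ∣ y) : ∑ J ∈ D, f J = (∑ J ∈ Dx, f J) * ∑ J ∈ Dy, f J := by
  rw [Finset.sum_mul_sum, ← Finset.sum_product']
  symm
  refine Finset.sum_bij (fun p _ ↦ p.1 * p.2) ?_ ?_ ?_ ?_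
  · rintro ⟨a, b⟩ h
    rw [Finset.mem_product, hDx, hDy] at h
    exact (hD _).2 (mul_dvd_mul h.1 h.2)
  · rintro ⟨a, b⟩ h ⟨a', b'⟩ h' he
    rw [Finset.mem_product, hDx, hDy] at h h'
    simp only at h h' he
    have key : ∀ {a b a' b' : α}, a ∣ x → b ∣ y → a' ∣ x → b' ∣ y → a * b = a' * b' →
        a ∣ a' ∧ b ∣ b' := fun ha hb ha' hb' he ↦
      ⟨((hxy.of_dvd_left ha).of_dvd_right hb').dvd_of_dvd_mul_right (he ▸ dvd_mul_right _ _),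
        ((hxy.of_dvd_left ha').of_dvd_right hb).symm.dvd_of_dvd_mul_left (he ▸ dvd_mul_left _ _)⟩
    have h1 := key h.1 h.2 h'.1 h'.2 he
    have h2 := key h'.1 h'.2 h.1 h.2 he.symm
    exact Prod.ext (associated_iff_eq.1 (associated_of_dvd_dvd h1.1 h2.1))
      (associated_iff_eq.1 (associated_of_dvd_dvd h1.2 h2.2))
  · intro J hJ
    obtain ⟨a, b, ha, hb, rfl⟩ := exists_dvd_and_dvd_of_dvd_mul ((hD J).1 hJ)
    exact ⟨(a, b), Finset.mem_product.2 ⟨(hDx _).2 ha, (hDy _).2 hb⟩, rfl⟩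
  · rintro ⟨a, b⟩ -
    simp

theorem sum_divisors_prime_pow (f : α →* ℝ) {p : α} (hp : Prime p) (i : ℕ) {D : Finset α}
    (hD : ∀ J, J ∈ D ↔ J ∣ p ^ i) : ∑ J ∈ D, f J = ∑ j ∈ Finset.range (i + 1), f p ^ j := by
  symm
  refine Finset.sum_bij (fun j _ ↦ p ^ j) ?_ ?_ ?_ ?_
  · intro j hj
    exact (hD _).2 (pow_dvd_pow p (Nat.lt_succ_iff.1 (Finset.mem_range.1 hj)))
  · intro j _ k _ h
    exact pow_injective_of_not_isUnit hp.not_isUnit hp.ne_zero h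
  · intro J hJ
    obtain ⟨j, hj, h⟩ := (dvd_prime_pow hp i).1 ((hD J).1 hJ)
    exact ⟨j, Finset.mem_range.2 (Nat.lt_succ_of_le hj), (associated_iff_eq.1 h).symm⟩
  · intro j _
    rw [map_pow]

theorem geom_sum_nonneg_of_sign {x : ℝ} (hx : x = 1 ∨ x = -1) (i : ℕ) :
    0 ≤ ∑ j ∈ Finset.range (i + 1), x ^ j := by
  rcases hx with rfl | rfl
  · simp; positivity
  · rw [neg_one_geom_sum]; split_ifs <;> norm_num

theorem one_le_geom_sum_of_sign {x : ℝ} (hx : x = 1 ∨ x = -1) (i : ℕ) :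
    1 ≤ ∑ j ∈ Finset.range (2 * i + 1), x ^ j := by
  rcases hx with rfl | rfl
  · simp
  · rw [neg_one_geom_sum, if_neg (by simp)]

theorem sum_divisors_nonneg (f : α →* ℝ) (hf : ∀ x ≠ 0, f x = 1 ∨ f x = -1) (I : α) :
    I ≠ 0 → ∀ D : Finset α, (∀ J, J ∈ D ↔ J ∣ I) → 0 ≤ ∑ J ∈ D, f J := by
  classical
  refine UniqueFactorizationMonoid.induction_on_coprime I ?_ ?_ ?_ ?_
  · exact fun h ↦ absurd rfl h
  · intro x hx _ D hD
    refine Finset.sum_nonneg fun J hJ ↦ ?_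
    have : J = 1 := associated_iff_eq.1
      (associated_one_iff_isUnit.2 (isUnit_of_dvd_unit ((hD J).1 hJ) hx))
    rw [this, map_one]; exact zero_le_one
  · intro p i hp _ D hD
    rw [sum_divisors_prime_pow f hp i hD]
    exact geom_sum_nonneg_of_sign (hf p hp.ne_zero) i
  · intro x y hxy hx hy h0 D hD
    have h1 : ∀ J, J ∈ D.filter (· ∣ x) ↔ J ∣ x := fun J ↦ by
      rw [Finset.mem_filter, hD, and_iff_right_iff_imp]; exact fun h ↦ h.mul_right y
    have h2 : ∀ J, J ∈ D.filter (· ∣ y) ↔ J ∣ y := fun J ↦ by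
      rw [Finset.mem_filter, hD, and_iff_right_iff_imp]; exact fun h ↦ h.mul_left x
    rw [sum_divisors_mul_of_isRelPrime f hxy hD h1 h2]
    exact mul_nonneg (hx (left_ne_zero_of_mul h0) _ h1) (hy (right_ne_zero_of_mul h0) _ h2)

end DivisorSum

section IdealDivisorSum

open NumberField Module
open scoped nonZeroDivisors

variable {K : Type*} [Field K] [NumberField K]

open scoped Classical in
/-- The extension by zero of a character of the class group to all ideals. -/
noncomputable def idealCharacter (ψ : ClassGroup (𝓞 K) →* ℝ) : Ideal (𝓞 K) →* ℝ where
  toFun I := if h : I ∈ (Ideal (𝓞 K))⁰ then ψ (ClassGroup.mk0 ⟨I, h⟩) else 0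
  map_one' := by
    rw [dif_pos (one_mem _)]
    exact (congrArg ψ (map_one ClassGroup.mk0)).trans (map_one ψ)
  map_mul' I J := by
    by_cases hI : I ∈ (Ideal (𝓞 K))⁰
    · by_cases hJ : J ∈ (Ideal (𝓞 K))⁰
      · rw [dif_pos (mul_mem hI hJ), dif_pos hI, dif_pos hJ, ← map_mul, ← map_mul]
        rfl
      · rw [dif_neg hJ, dif_neg fun h ↦ hJ (mul_mem_nonZeroDivisors.1 h).2, mul_zero]
    · rw [dif_neg hI, dif_neg fun h ↦ hI (mul_mem_nonZeroDivisors.1 h).1, zero_mul]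

theorem idealCharacter_coe (ψ : ClassGroup (𝓞 K) →* ℝ) (I : (Ideal (𝓞 K))⁰) :
    idealCharacter ψ I = ψ (ClassGroup.mk0 I) := dif_pos I.2

theorem sum_pairs_eq_sum_divisors (ψ : ClassGroup (𝓞 K) →* ℝ) (I : (Ideal (𝓞 K))⁰)
    {S : Finset ((Ideal (𝓞 K))⁰ × (Ideal (𝓞 K))⁰)} (hS : ∀ p, p ∈ S ↔ p.1 * p.2 = I) :
    ∃ D : Finset (Ideal (𝓞 K)), (∀ J, J ∈ D ↔ J ∣ (I : Ideal (𝓞 K))) ∧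
      ∑ p ∈ S, ψ (ClassGroup.mk0 p.2) = ∑ J ∈ D, idealCharacter ψ J := by
  classical
  refine ⟨S.image fun p ↦ (p.2 : Ideal (𝓞 K)), fun J ↦ ?_, ?_⟩
  · rw [Finset.mem_image]
    constructor
    · rintro ⟨p, hp, rfl⟩
      rw [← (hS p).1 hp]
      exact Dvd.intro_left _ rfl
    · rintro ⟨A, hA⟩
      have hI := I.2
      rw [hA, mul_mem_nonZeroDivisors] at hI
      exact ⟨(⟨A, hI.2⟩, ⟨J, hI.1⟩), (hS _).2 (Subtype.ext ((mul_comm _ _).trans hA.symm)), rfl⟩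
  · rw [Finset.sum_image]
    · exact Finset.sum_congr rfl fun p _ ↦ (idealCharacter_coe ψ p.2).symm
    · intro p hp q hq h
      have h2 : p.2 = q.2 := Subtype.ext h
      have h3 : p.1 * p.2 = q.1 * p.2 := by rw [(hS p).1 hp, h2, (hS q).1 hq]
      exact Prod.ext (mul_right_cancel h3) h2

theorem sum_pairs_nonneg (ψ : ClassGroup (𝓞 K) →* ℝ) (hψ : ∀ C, ψ C = 1 ∨ ψ C = -1)
    (I : (Ideal (𝓞 K))⁰) {S : Finset ((Ideal (𝓞 K))⁰ × (Ideal (𝓞 K))⁰)}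
    (hS : ∀ p, p ∈ S ↔ p.1 * p.2 = I) : 0 ≤ ∑ p ∈ S, ψ (ClassGroup.mk0 p.2) := by
  obtain ⟨D, hD, h⟩ := sum_pairs_eq_sum_divisors ψ I hS
  rw [h]
  refine sum_divisors_nonneg _ (fun J hJ ↦ ?_) _ (nonZeroDivisors.coe_ne_zero I) D hD
  have := idealCharacter_coe ψ ⟨J, mem_nonZeroDivisors_of_ne_zero hJ⟩
  rw [this]
  exact hψ _

theorem one_le_sum_pairs (ψ : ClassGroup (𝓞 K) →* ℝ) (hψ : ∀ C, ψ C = 1 ∨ ψ C = -1)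
    (P : (Ideal (𝓞 K))⁰) (hP : Prime (P : Ideal (𝓞 K))) (k : ℕ)
    {S : Finset ((Ideal (𝓞 K))⁰ × (Ideal (𝓞 K))⁰)}
    (hS : ∀ p, p ∈ S ↔ p.1 * p.2 = P ^ (2 * k)) : 1 ≤ ∑ p ∈ S, ψ (ClassGroup.mk0 p.2) := by
  obtain ⟨D, hD, h⟩ := sum_pairs_eq_sum_divisors ψ _ hS
  rw [h, sum_divisors_prime_pow _ hP (2 * k) (by simpa using hD), idealCharacter_coe]
  exact one_le_geom_sum_of_sign (hψ _) k

end IdealDivisorSum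

section WeightConvolution

/-- The multiplicative convolution square of `normWeight`. -/
noncomputable def normWeightConv (x : ℝ) : ℝ :=
  ∫ u in Ioi (0 : ℝ), u⁻¹ * (normWeight (x / u) * normWeight u)

theorem integrableOn_inv_mul_normWeight {x : ℝ} (hx : 0 < x) :
    IntegrableOn (fun u ↦ u⁻¹ * normWeight (u * x)) (Ioi (0 : ℝ)) := by
  have := integrableOn_normWeight_mul hx 0
  simpa only [zero_sub, Real.rpow_neg_one] using this

theorem integrableOn_normWeightConv (c : ℝ) {x : ℝ} (hx : 0 < x) :
    IntegrableOn (fun u ↦ u⁻¹ * (normWeight (c / u) * normWeight (u * x))) (Ioi (0 : ℝ)) := by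
  have h1 : AEStronglyMeasurable (fun u ↦ normWeight (c / u)) (volume.restrict (Ioi (0 : ℝ))) :=
    (continuous_normWeight.measurable.comp
      (measurable_const.div measurable_id)).aestronglyMeasurable
  have h2 := (integrableOn_inv_mul_normWeight hx).bdd_mul (c := 1) h1
    (Eventually.of_forall fun u ↦ by
      rw [Real.norm_of_nonneg (normWeight_nonneg _)]; exact normWeight_le_one _)
  exact IntegrableOn.congr_fun h2 (fun u _ ↦ by ring) measurableSet_Ioi

theorem integral_normWeight_div_mul (c : ℝ) {x : ℝ} (hx : 0 < x) :
    ∫ u in Ioi (0 : ℝ), u⁻¹ * (normWeight (c / u) * normWeight (u * x)) =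
      normWeightConv (c * x) := by
  have := integral_comp_mul_right_Ioi
    (fun u ↦ u⁻¹ * (normWeight (c * x / u) * normWeight u)) 0 hx
  rw [zero_mul, smul_eq_mul, ← normWeightConv] at this
  rw [← mul_inv_cancel_left₀ hx.ne' (normWeightConv (c * x)), ← this, ← integral_const_mul]
  refine setIntegral_congr_fun measurableSet_Ioi fun u hu ↦ ?_
  have hu : 0 < u := hu
  have e : c * x / (u * x) = c / u := by field_simp
  simp only [e]
  field_simp

theorem normWeightConv_nonneg (x : ℝ) : 0 ≤ normWeightConv x :=
  setIntegral_nonneg measurableSet_Ioi fun _ hu ↦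
    mul_nonneg (inv_nonneg.2 (le_of_lt hu)) (mul_nonneg (normWeight_nonneg _) (normWeight_nonneg _))

theorem normWeightConv_of_nine_le {x : ℝ} (hx : 9 ≤ x) : normWeightConv x = 0 := by
  rw [normWeightConv]
  refine setIntegral_eq_zero_of_forall_eq_zero fun u hu ↦ ?_
  have hu : 0 < u := hu
  rcases le_total 3 u with h | h
  · simp [normWeight_of_three_le h]
  · have : 3 ≤ x / u := by rw [le_div_iff₀ hu]; linarith
    simp [normWeight_of_three_le this]

theorem normWeightConv_four_pos : 0 < normWeightConv 4 := by
  have hi : IntegrableOn (fun u ↦ u⁻¹ * (normWeight (4 / u) * normWeight u)) (Ioi (0 : ℝ)) := by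
    simpa using integrableOn_normWeightConv 4 one_pos
  rw [normWeightConv, setIntegral_pos_iff_support_of_nonneg_ae _ hi]
  · refine lt_of_lt_of_le ?_ (measure_mono (s := Ioo (4 / 3) 3) fun t ht ↦ ?_)
    · simp; norm_num
    · have h0 : 0 < t := by linarith [ht.1]
      have h1 := normWeight_pos (t := t) (by linarith [ht.1]) ht.2
      have h2 := normWeight_pos (t := 4 / t) (by rw [lt_div_iff₀ h0]; linarith [ht.2])
        (by rw [div_lt_iff₀ h0]; linarith [ht.1])
      exact ⟨(mul_pos (inv_pos.2 h0) (mul_pos h2 h1)).ne', h0⟩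
  · filter_upwards [ae_restrict_mem measurableSet_Ioi] with u hu
    exact mul_nonneg (inv_nonneg.2 (le_of_lt hu))
      (mul_nonneg (normWeight_nonneg _) (normWeight_nonneg _))

end WeightConvolution

section RealCharacter

open NumberField Module
open scoped nonZeroDivisors

variable {K : Type*} [Field K] [NumberField K]

theorem mellinConvergent_idealTheta_of_sum_eq_zero {a : ClassGroup (𝓞 K) → ℂ}
    (ha : ∑ C, a C = 0) {s : ℂ} (hs : -errorExp K < s.re) :
    MellinConvergent (idealTheta K a) s := by
  obtain ⟨κ, hκ, H⟩ := exists_idealTheta_sub_le (K := K)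
  obtain ⟨B, hB0, hB⟩ := H a
  refine mellinConvergent_of_isBigO_rpow (a := s.re + 1) (b := -errorExp K)
    ((continuousOn_idealTheta a).locallyIntegrableOn measurableSet_Ioi) ?_ (by linarith) ?_ hs
  · refine Asymptotics.IsBigO.of_bound 0 ?_
    filter_upwards [eventually_ge_atTop 3] with t ht
    simp [idealTheta_of_three_le a ht]
  · refine Asymptotics.IsBigO.of_bound B ?_
    filter_upwards [Ioc_mem_nhdsGT (one_pos (α := ℝ))] with t ht
    have h1 := hB t ht.1 ht.2
    rw [ha, mul_zero, zero_div, sub_zero] at h1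
    rwa [neg_neg, Real.norm_of_nonneg (Real.rpow_nonneg ht.1.le _)]

variable (K) in
/-- The pairing of the theta functions of the trivial and of a given class function. -/
noncomputable def thetaConv (a : ClassGroup (𝓞 K) → ℂ) (t : ℝ) : ℂ :=
  ∫ u in Ioi (0 : ℝ), idealTheta K (fun _ ↦ 1) (t / u) * ((u⁻¹ : ℝ) * idealTheta K a u)

theorem thetaConv_eq_sum (ψ : ClassGroup (𝓞 K) → ℝ) {t : ℝ} (ht : 0 < t) :
    thetaConv K (fun C ↦ (ψ C : ℂ)) t = ((∑ p ∈ (finite_idealNorm_le K (3 / (t / 3))).toFinset ×ˢ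
      (finite_idealNorm_le K (3 / (t / 3))).toFinset, ψ (ClassGroup.mk0 p.2) *
        normWeightConv (t * (idealNorm K p.1 * idealNorm K p.2)) : ℝ) : ℂ) := by
  simp_rw [← mul_assoc t, ← integral_normWeight_div_mul _ (idealNorm_pos K _),
    ← integral_const_mul]
  rw [← integral_finsetSum _ fun p _ ↦
    (integrableOn_normWeightConv _ (idealNorm_pos K _)).const_mul _, ← integral_complex_ofReal,
    thetaConv]
  refine setIntegral_congr_fun measurableSet_Ioi fun u hu ↦ ?_
  have hu : 0 < u := hu
  rcases le_total 3 u with h3 | h3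
  · rw [idealTheta_of_three_le _ h3, mul_zero, mul_zero, Finset.sum_eq_zero, Complex.ofReal_zero]
    intro p _
    rw [normWeight_of_three_le (t := u * idealNorm K p.2)]
    · ring
    · nlinarith [one_le_idealNorm K p.2]
  rcases le_total 3 (t / u) with h4 | h4
  · rw [idealTheta_of_three_le _ h4, zero_mul, Finset.sum_eq_zero, Complex.ofReal_zero]
    intro p _
    rw [normWeight_of_three_le (t := t * idealNorm K p.1 / u)]
    · ring
    · rw [mul_div_right_comm]
      nlinarith [one_le_idealNorm K p.1]
  rw [idealTheta_eq_finset_sum (fun _ ↦ 1) (t₀ := t / 3) (by positivity)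
    (div_le_div_of_nonneg_left ht.le hu h3), idealTheta_eq_finset_sum _ (t₀ := t / 3) (t := u)
      (by positivity) (by rw [div_le_iff₀ hu] at h4; linarith), Finset.mul_sum,
      Finset.sum_mul_sum, ← Finset.sum_product', Complex.ofReal_sum]
  refine Finset.sum_congr rfl fun p _ ↦ ?_
  rw [mul_div_right_comm]
  push_cast
  ring

theorem le_sum_normWeightConv (ψ : ClassGroup (𝓞 K) →* ℝ) (hψ : ∀ C, ψ C = 1 ∨ ψ C = -1)
    (P : (Ideal (𝓞 K))⁰) (hP : Prime (P : Ideal (𝓞 K))) (k : ℕ) {t : ℝ} (ht : 0 < t)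
    (h4 : t * idealNorm K (P ^ (2 * k)) = 4) :
    normWeightConv 4 ≤ ∑ p ∈ (finite_idealNorm_le K (3 / (t / 3))).toFinset ×ˢ
      (finite_idealNorm_le K (3 / (t / 3))).toFinset, ψ (ClassGroup.mk0 p.2) *
        normWeightConv (t * (idealNorm K p.1 * idealNorm K p.2)) := by
  classical
  obtain ⟨S, hS⟩ : ∃ S, S = (finite_idealNorm_le K (3 / (t / 3))).toFinset := ⟨_, rfl⟩
  rw [← hS]
  have hmem : ∀ I, I ∈ S ↔ t * idealNorm K I ≤ 9 := by
    intro I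
    rw [hS, Finite.mem_toFinset, mem_ofPred_eq, le_div_iff₀ (by positivity)]
    constructor <;> intro h <;> linarith
  have hfib : ∀ I : (Ideal (𝓞 K))⁰, t * idealNorm K I ≤ 9 →
      ∀ p, p ∈ (S ×ˢ S).filter (fun p ↦ p.1 * p.2 = I) ↔ p.1 * p.2 = I := by
    intro I hI p
    rw [Finset.mem_filter, and_iff_right_iff_imp, Finset.mem_product, hmem, hmem]
    rintro rfl
    rw [idealNorm_mul] at hI
    have h1 := one_le_idealNorm K p.1
    have h2 := one_le_idealNorm K p.2
    constructor
    · refine le_trans ?_ hI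
      gcongr
      nlinarith
    · refine le_trans ?_ hI
      gcongr
      nlinarith
  rw [← Finset.sum_fiberwise_of_maps_to (s := S ×ˢ S) (t := (S ×ˢ S).image fun p ↦ p.1 * p.2)
    (g := fun p ↦ p.1 * p.2) fun p hp ↦ Finset.mem_image_of_mem _ hp]
  have hinner : ∀ I : (Ideal (𝓞 K))⁰,
      ∑ p ∈ (S ×ˢ S).filter (fun p ↦ p.1 * p.2 = I), ψ (ClassGroup.mk0 p.2) *
        normWeightConv (t * (idealNorm K p.1 * idealNorm K p.2)) =
      (∑ p ∈ (S ×ˢ S).filter (fun p ↦ p.1 * p.2 = I), ψ (ClassGroup.mk0 p.2)) *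
        normWeightConv (t * idealNorm K I) := by
    intro I
    rw [Finset.sum_mul]
    refine Finset.sum_congr rfl fun p hp ↦ ?_
    rw [← (Finset.mem_filter.1 hp).2, idealNorm_mul]
  simp_rw [hinner]
  have hnn : ∀ I ∈ (S ×ˢ S).image (fun p ↦ p.1 * p.2),
      0 ≤ (∑ p ∈ (S ×ˢ S).filter (fun p ↦ p.1 * p.2 = I), ψ (ClassGroup.mk0 p.2)) *
        normWeightConv (t * idealNorm K I) := by
    intro I _
    rcases le_total (t * idealNorm K I) 9 with h | h
    · exact mul_nonneg (sum_pairs_nonneg ψ hψ I (hfib I h)) (normWeightConv_nonneg _)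
    · rw [normWeightConv_of_nine_le h, mul_zero]
  have hm : P ^ (2 * k) ∈ (S ×ˢ S).image (fun p ↦ p.1 * p.2) := by
    refine Finset.mem_image.2 ⟨(P ^ (2 * k), 1), Finset.mem_product.2 ⟨?_, ?_⟩, mul_one _⟩
    · rw [hmem, h4]; norm_num
    · rw [hmem]
      have h1 : idealNorm K 1 = 1 := by simp [idealNorm]
      have := one_le_idealNorm K (P ^ (2 * k))
      simp only [h1, mul_one]
      nlinarith
  refine le_trans ?_ (Finset.single_le_sum hnn hm)
  rw [h4]
  exact le_mul_of_one_le_left (normWeightConv_nonneg _)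
    (one_le_sum_pairs ψ hψ P hP k (hfib _ (by rw [h4]; norm_num)))

theorem tendsto_thetaConv_zero {a : ClassGroup (𝓞 K) → ℂ} (ha : ∑ C, a C = 0)
    (h0 : ∫ t in Ioi (0 : ℝ), idealTheta K a t = 0) :
    Tendsto (thetaConv K a) (𝓝[>] 0) (𝓝 0) := by
  obtain ⟨κ, hκ, H⟩ := exists_idealTheta_sub_le (K := K)
  obtain ⟨B, hB0, hB⟩ := H fun _ ↦ 1
  obtain ⟨A, hA⟩ : ∃ A : ℂ, A = κ * ∑ C : ClassGroup (𝓞 K), (1 : ℂ) := ⟨_, rfl⟩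
  rw [← hA] at hB
  let E : ℝ → ℂ := fun v ↦ idealTheta K (fun _ ↦ 1) v - A / v
  have hEc : ContinuousOn E (Ioi 0) := by
    refine (continuousOn_idealTheta _).sub (continuousOn_const.div
      Complex.continuous_ofReal.continuousOn fun v hv ↦ ?_)
    exact_mod_cast (ne_of_gt hv)
  have hE0 : Tendsto E (𝓝[>] 0) (𝓝 0) := by
    refine squeeze_zero_norm' (a := fun v ↦ B * v ^ errorExp K) ?_ ?_
    · filter_upwards [Ioc_mem_nhdsGT (one_pos (α := ℝ))] with v hv
      exact hB v hv.1 hv.2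
    · have h1 : Tendsto (fun v : ℝ ↦ v ^ errorExp K) (𝓝[>] 0) (𝓝 (0 ^ errorExp K)) :=
        (Real.continuousAt_rpow_const 0 _ (Or.inr errorExp_pos.le)).tendsto.mono_left
          nhdsWithin_le_nhds
      rw [Real.zero_rpow errorExp_pos.ne'] at h1
      simpa using h1.const_mul B
  obtain ⟨M, hM⟩ : ∃ M, ∀ v ∈ Ioi (0 : ℝ), ‖E v‖ ≤ M := by
    obtain ⟨M₁, hM₁⟩ := (isCompact_Icc (a := (1 : ℝ)) (b := 3)).exists_bound_of_continuousOn
      (hEc.mono fun v hv ↦ one_pos.trans_le hv.1)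
    refine ⟨B + |M₁| + ‖A‖, fun v hv ↦ ?_⟩
    have hv : 0 < v := hv
    rcases le_total v 1 with h1 | h1
    · have h2 : v ^ errorExp K ≤ 1 := Real.rpow_le_one hv.le h1 errorExp_pos.le
      have h3 := hB v hv h1
      have : ‖E v‖ ≤ B := h3.trans (by nlinarith)
      linarith [abs_nonneg M₁, norm_nonneg A]
    rcases le_total v 3 with h3 | h3
    · linarith [hM₁ v ⟨h1, h3⟩, norm_nonneg A, le_abs_self M₁]
    · have : ‖E v‖ ≤ ‖A‖ := by
        simp only [E, idealTheta_of_three_le _ h3, zero_sub, norm_neg, norm_div,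
          Complex.norm_real, Real.norm_of_nonneg hv.le]
        exact div_le_self (norm_nonneg _) h1
      linarith [abs_nonneg M₁]
  let q : ℝ → ℂ := fun u ↦ (u⁻¹ : ℝ) * idealTheta K a u
  have hq : IntegrableOn q (Ioi 0) := by
    have := mellinConvergent_idealTheta_of_sum_eq_zero ha (s := 0) (by simpa using errorExp_pos)
    simpa [MellinConvergent, Complex.cpow_neg_one, q] using this
  have hθ : IntegrableOn (idealTheta K a) (Ioi 0) := by
    have := mellinConvergent_idealTheta_of_sum_eq_zero ha (s := 1)
      (by have := errorExp_pos (K := K); rw [Complex.one_re]; linarith)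
    simpa [MellinConvergent] using this
  have hmeas : ∀ t : ℝ, 0 < t →
      AEStronglyMeasurable (fun u ↦ E (t / u)) (volume.restrict (Ioi 0)) := by
    intro t ht
    refine ContinuousOn.aestronglyMeasurable ?_ measurableSet_Ioi
    refine hEc.comp (continuousOn_const.div continuousOn_id fun u hu ↦ ne_of_gt hu) fun u hu ↦ ?_
    exact div_pos ht hu
  have hlim : Tendsto (fun t : ℝ ↦ ∫ u in Ioi (0 : ℝ), E (t / u) * q u) (𝓝[>] 0) (𝓝 0) := by
    have := tendsto_integral_filter_of_dominated_convergence (l := 𝓝[>] (0 : ℝ))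
      (F := fun t u ↦ E (t / u) * q u) (f := fun _ ↦ 0) (μ := volume.restrict (Ioi (0 : ℝ)))
      (fun u ↦ M * ‖q u‖) ?_ ?_ (hq.norm.const_mul M) ?_
    · simpa using this
    · filter_upwards [self_mem_nhdsWithin] with t ht
      exact (hmeas t ht).mul hq.aestronglyMeasurable
    · filter_upwards [self_mem_nhdsWithin] with t ht
      filter_upwards [ae_restrict_mem measurableSet_Ioi] with u hu
      rw [norm_mul]
      have h1 : t / u ∈ Ioi (0 : ℝ) := mem_Ioi.2 (div_pos (mem_Ioi.1 ht) (mem_Ioi.1 hu))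
      exact mul_le_mul_of_nonneg_right (hM _ h1) (norm_nonneg _)
    · filter_upwards [ae_restrict_mem measurableSet_Ioi] with u hu
      have hu : 0 < u := hu
      have h1 : Tendsto (fun t : ℝ ↦ t / u) (𝓝[>] 0) (𝓝[>] 0) := by
        refine tendsto_nhdsWithin_iff.2 ⟨?_, ?_⟩
        · have : Tendsto (fun t : ℝ ↦ t / u) (𝓝 0) (𝓝 (0 / u)) := tendsto_id.div_const u
          rw [zero_div] at this
          exact this.mono_left nhdsWithin_le_nhds
        · filter_upwards [self_mem_nhdsWithin] with t ht
          exact div_pos ht hu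
      simpa using (hE0.comp h1).mul_const (q u)
  refine hlim.congr' ?_
  filter_upwards [self_mem_nhdsWithin] with t ht
  have ht : 0 < t := ht
  have hEq : IntegrableOn (fun u ↦ E (t / u) * q u) (Ioi 0) := by
    refine hq.bdd_mul (c := M) (hmeas t ht) ?_
    filter_upwards [ae_restrict_mem measurableSet_Ioi] with u hu
    have h1 : t / u ∈ Ioi (0 : ℝ) := div_pos ht hu
    exact hM _ h1
  have h1 : ∫ u in Ioi (0 : ℝ), A / t * idealTheta K a u = 0 := by
    rw [integral_const_mul, h0, mul_zero]
  rw [← add_zero (∫ u in Ioi (0 : ℝ), E (t / u) * q u), ← h1,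
    ← integral_add hEq (hθ.const_mul _), thetaConv]
  refine setIntegral_congr_fun measurableSet_Ioi fun u hu ↦ ?_
  have hu : (u : ℂ) ≠ 0 := by exact_mod_cast (ne_of_gt hu)
  have ht' : (t : ℂ) ≠ 0 := by exact_mod_cast ht.ne'
  simp only [E, q]
  push_cast
  field_simp
  ring

variable (K) in
theorem exists_prime_nonZeroIdeal : ∃ P : (Ideal (𝓞 K))⁰, Prime (P : Ideal (𝓞 K)) := by
  obtain ⟨M, hM⟩ := Ideal.exists_maximal (𝓞 K)
  have h0 : M ≠ ⊥ := Ring.ne_bot_of_isMaximal_of_not_isField hM (RingOfIntegers.not_isField K)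
  exact ⟨⟨M, mem_nonZeroDivisors_of_ne_zero h0⟩, Ideal.prime_of_isPrime h0 hM.isPrime⟩

theorem two_le_idealNorm {P : (Ideal (𝓞 K))⁰} (hP : Prime (P : Ideal (𝓞 K))) :
    2 ≤ idealNorm K P := by
  have h1 : Ideal.absNorm (P : Ideal (𝓞 K)) ≠ 1 := fun h ↦
    hP.not_isUnit (Ideal.isUnit_iff.2 (Ideal.absNorm_eq_one_iff.1 h))
  have h2 := Ideal.absNorm_pos_of_nonZeroDivisors P
  have : 2 ≤ Ideal.absNorm (P : Ideal (𝓞 K)) := by omega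
  rw [idealNorm]; exact_mod_cast this

theorem idealNorm_pow (I : (Ideal (𝓞 K))⁰) (n : ℕ) : idealNorm K (I ^ n) = idealNorm K I ^ n := by
  simp [idealNorm]

theorem integral_idealTheta_ne_zero (ψ : ClassGroup (𝓞 K) →* ℝ) (hψ : ∀ C, ψ C = 1 ∨ ψ C = -1)
    (hsum : ∑ C, (ψ C : ℂ) = 0) :
    ∫ t in Ioi (0 : ℝ), idealTheta K (fun C ↦ (ψ C : ℂ)) t ≠ 0 := by
  intro h0
  obtain ⟨P, hP⟩ := exists_prime_nonZeroIdeal K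
  have hN := two_le_idealNorm hP
  have hpos : ∀ k : ℕ, 0 < idealNorm K (P ^ (2 * k)) := fun k ↦ idealNorm_pos K _
  have htend : Tendsto (fun k : ℕ ↦ 4 / idealNorm K (P ^ (2 * k))) atTop (𝓝[>] 0) := by
    refine tendsto_nhdsWithin_iff.2 ⟨Tendsto.const_div_atTop ?_ 4,
      Eventually.of_forall fun k ↦ div_pos (by norm_num) (hpos k)⟩
    have : Tendsto (fun k : ℕ ↦ (idealNorm K P ^ 2) ^ k) atTop atTop :=
      tendsto_pow_atTop_atTop_of_one_lt (by nlinarith)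
    refine this.congr fun k ↦ ?_
    rw [idealNorm_pow, pow_mul]
  have hlim := ((tendsto_thetaConv_zero hsum h0).comp htend).norm
  rw [norm_zero] at hlim
  refine absurd (ge_of_tendsto' hlim fun k ↦ ?_) (not_le.2 normWeightConv_four_pos)
  have ht : 0 < 4 / idealNorm K (P ^ (2 * k)) := div_pos (by norm_num) (hpos k)
  rw [Function.comp_apply, thetaConv_eq_sum _ ht, Complex.norm_real]
  exact (le_sum_normWeightConv ψ hψ P hP k ht (div_mul_cancel₀ _ (hpos k).ne')).trans
    (le_abs_self _)

end RealCharacter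

section PrimePowers

open NumberField Module IsDedekindDomain
open scoped nonZeroDivisors

variable {K : Type*} [Field K] [NumberField K]

/-- A nonzero prime ideal, as an element of the monoid of nonzero ideals. -/
def primeIdeal (v : HeightOneSpectrum (𝓞 K)) : (Ideal (𝓞 K))⁰ :=
  ⟨v.asIdeal, mem_nonZeroDivisors_of_ne_zero v.ne_bot⟩

/-- The positive powers of nonzero prime ideals. -/
def primePow (x : HeightOneSpectrum (𝓞 K) × ℕ) : (Ideal (𝓞 K))⁰ := primeIdeal x.1 ^ (x.2 + 1)

/-- The value of the von Mangoldt function at a prime power. -/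
noncomputable def primeLog (x : HeightOneSpectrum (𝓞 K) × ℕ) : ℝ :=
  Real.log (idealNorm K (primeIdeal x.1))

theorem prime_primeIdeal (v : HeightOneSpectrum (𝓞 K)) :
    Prime (primeIdeal v : Ideal (𝓞 K)) := v.prime

theorem primePow_injective : Function.Injective (primePow (K := K)) := by
  rintro ⟨v, k⟩ ⟨w, l⟩ h
  have h : v.asIdeal ^ (k + 1) = w.asIdeal ^ (l + 1) := congrArg Subtype.val h
  have hvw : v.asIdeal = w.asIdeal := by
    have h1 : v.asIdeal ∣ w.asIdeal ^ (l + 1) := h ▸ dvd_pow_self _ (Nat.succ_ne_zero k)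
    exact associated_iff_eq.1 <|
      (v.prime.dvd_prime_iff_associated w.prime).1 (v.prime.dvd_of_dvd_pow h1)
  have hkl : k + 1 = l + 1 := by
    rw [hvw] at h
    exact pow_injective_of_not_isUnit w.prime.not_isUnit w.prime.ne_zero h
  exact Prod.ext (HeightOneSpectrum.ext hvw) (Nat.succ_injective hkl)

theorem primeLog_nonneg (x : HeightOneSpectrum (𝓞 K) × ℕ) : 0 ≤ primeLog x :=
  Real.log_nonneg (one_le_idealNorm K _)

theorem primeLog_le (x : HeightOneSpectrum (𝓞 K) × ℕ) :
    primeLog x ≤ Real.log (idealNorm K (primePow x)) := by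
  refine Real.log_le_log (idealNorm_pos K _) ?_
  rw [primePow, idealNorm_pow]
  exact le_self_pow₀ (one_le_idealNorm K _) (Nat.succ_ne_zero _)

theorem exists_finset_primePow_dvd (I : (Ideal (𝓞 K))⁰) :
    ∃ S : Finset (HeightOneSpectrum (𝓞 K) × ℕ), (∀ x, x ∈ S ↔ ∃ J, primePow x * J = I) ∧
      ∑ x ∈ S, primeLog x = Real.log (idealNorm K I) := by
  classical
  have hI : (I : Ideal (𝓞 K)) ≠ 0 := nonZeroDivisors.coe_ne_zero I
  set c : HeightOneSpectrum (𝓞 K) → ℕ := fun v ↦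
    (Associates.mk v.asIdeal).count (Associates.mk (I : Ideal (𝓞 K))).factors with hc
  have hdvd : ∀ v k, v.asIdeal ^ k ∣ (I : Ideal (𝓞 K)) ↔ k ≤ c v := fun v k ↦ by
    rw [hc, ← Associates.prime_pow_dvd_iff_le (Associates.mk_ne_zero.2 hI) v.associates_irreducible,
      ← Associates.mk_pow, Associates.mk_le_mk_iff_dvd]
  have hfin : (Function.mulSupport fun v : HeightOneSpectrum (𝓞 K) ↦
      v.maxPowDividing (I : Ideal (𝓞 K))).Finite := Ideal.hasFiniteMulSupport hI
  set T := hfin.toFinset with hT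
  have hmemT : ∀ v, 0 < c v → v ∈ T := fun v hv ↦ by
    rw [hT, Set.Finite.mem_toFinset, Function.mem_mulSupport]
    intro h1
    have : v.asIdeal ^ (c v) = 1 := h1
    exact v.prime.not_isUnit (isUnit_of_dvd_one (this ▸ dvd_pow_self _ hv.ne'))
  refine ⟨(T.sigma fun v ↦ Finset.range (c v)).map
    ⟨fun p ↦ (p.1, p.2), fun p q h ↦ by
      obtain ⟨a, b⟩ := p; obtain ⟨a', b'⟩ := q
      simp only [Prod.mk.injEq] at h; obtain ⟨rfl, rfl⟩ := h; rfl⟩, fun x ↦ ?_, ?_⟩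
  · have h1 : (∃ J, primePow x * J = I) ↔ x.1.asIdeal ^ (x.2 + 1) ∣ (I : Ideal (𝓞 K)) := by
      constructor
      · rintro ⟨J, rfl⟩
        exact Dvd.intro _ rfl
      · rintro ⟨J, hJ⟩
        have hI' := I.2
        rw [hJ, mul_mem_nonZeroDivisors] at hI'
        exact ⟨⟨J, hI'.2⟩, Subtype.ext hJ.symm⟩
    rw [h1, hdvd]
    simp only [Finset.mem_map, Finset.mem_sigma, Finset.mem_range]
    constructor
    · rintro ⟨p, ⟨-, hp⟩, rfl⟩
      exact hp
    · intro h
      exact ⟨⟨x.1, x.2⟩, ⟨hmemT _ (Nat.succ_pos _ |>.trans_le h), h⟩, rfl⟩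
  · have h2 : (I : Ideal (𝓞 K)) = ∏ v ∈ T, v.asIdeal ^ c v := by
      conv_lhs => rw [← Ideal.finprod_heightOneSpectrum_factorization hI]
      rw [finprod_eq_prod_of_mulSupport_subset _ (s := T) (by rw [hT, Set.Finite.coe_toFinset])]
      rfl
    have h3 : idealNorm K I = ∏ v ∈ T, idealNorm K (primeIdeal v) ^ c v := by
      rw [idealNorm, h2, map_prod]
      push_cast
      refine Finset.prod_congr rfl fun v _ ↦ ?_
      rw [map_pow]; push_cast; rfl
    rw [Finset.sum_map, Finset.sum_sigma, h3, Real.log_prod]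
    · refine Finset.sum_congr rfl fun v _ ↦ ?_
      rw [Real.log_pow]
      have hsum : ∀ m : ℕ, ∑ _k ∈ Finset.range m, Real.log (idealNorm K (primeIdeal v)) =
          m * Real.log (idealNorm K (primeIdeal v)) := fun m ↦ by simp
      exact hsum (c v)
    · exact fun v _ ↦ pow_ne_zero _ (idealNorm_pos K _).ne'

theorem summable_log_mul_idealNorm_rpow {s : ℝ} (hs : 1 < s) :
    Summable fun I : (Ideal (𝓞 K))⁰ ↦ Real.log (idealNorm K I) * idealNorm K I ^ (-s) := by
  have hε : 0 < (s - 1) / 2 := by linarith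
  refine Summable.of_nonneg_of_le (fun I ↦ mul_nonneg (Real.log_nonneg (one_le_idealNorm K I))
    (Real.rpow_nonneg (idealNorm_pos K I).le _)) (fun I ↦ ?_)
    ((summable_idealNorm_rpow (K := K) (s := s - (s - 1) / 2) (by linarith)).mul_left
      ((s - 1) / 2)⁻¹)
  have h := mul_le_mul_of_nonneg_right (Real.log_le_rpow_div (idealNorm_pos K I).le hε)
    (Real.rpow_nonneg (idealNorm_pos K I).le (-s))
  refine h.trans (le_of_eq ?_)
  rw [div_eq_inv_mul, mul_assoc, ← Real.rpow_add (idealNorm_pos K I)]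
  congr 2; ring

theorem summable_primeLog {s : ℝ} (hs : 1 < s) :
    Summable fun x : HeightOneSpectrum (𝓞 K) × ℕ ↦
      primeLog x * idealNorm K (primePow x) ^ (-s) :=
  Summable.of_nonneg_of_le (fun x ↦ mul_nonneg (primeLog_nonneg x)
      (Real.rpow_nonneg (idealNorm_pos K _).le _))
    (fun x ↦ mul_le_mul_of_nonneg_right (primeLog_le x) (Real.rpow_nonneg (idealNorm_pos K _).le _))
    ((summable_log_mul_idealNorm_rpow hs).comp_injective primePow_injective)

theorem summable_norm_classFun_mul {ι : Type*} {a : ClassGroup (𝓞 K) → ℂ} (C : ι → ClassGroup (𝓞 K))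
    {f : ι → ℝ} (hf : Summable f) (h0 : ∀ i, 0 ≤ f i) :
    Summable fun i ↦ ‖a (C i) * (f i : ℂ)‖ := by
  obtain ⟨c, hc, ha⟩ := exists_norm_classFun_le a
  refine Summable.of_nonneg_of_le (fun _ ↦ norm_nonneg _) (fun i ↦ ?_) (hf.mul_left c)
  rw [norm_mul, Complex.norm_of_nonneg (h0 i)]
  exact mul_le_mul_of_nonneg_right (ha _) (h0 i)

variable (K) in
/-- The Dirichlet series attached to the von Mangoldt function weighted by a function on the class
group. -/
noncomputable def classVonMangoldt (a : ClassGroup (𝓞 K) → ℂ) (s : ℝ) : ℂ :=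
  ∑' x : HeightOneSpectrum (𝓞 K) × ℕ, a (ClassGroup.mk0 (primePow x)) *
    ((primeLog x * idealNorm K (primePow x) ^ (-s) : ℝ) : ℂ)

theorem summable_classVonMangoldt (a : ClassGroup (𝓞 K) → ℂ) {s : ℝ} (hs : 1 < s) :
    Summable fun x : HeightOneSpectrum (𝓞 K) × ℕ ↦ ‖a (ClassGroup.mk0 (primePow x)) *
      ((primeLog x * idealNorm K (primePow x) ^ (-s) : ℝ) : ℂ)‖ :=
  summable_norm_classFun_mul _ (summable_primeLog hs) fun x ↦
    mul_nonneg (primeLog_nonneg x) (Real.rpow_nonneg (idealNorm_pos K _).le _)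

theorem hasDerivAt_classLSeries (a : ClassGroup (𝓞 K) → ℂ) {s : ℝ} (hs : 1 < s) :
    HasDerivAt (classLSeries K a) (∑' I : (Ideal (𝓞 K))⁰, a (ClassGroup.mk0 I) *
      ((-(Real.log (idealNorm K I) * idealNorm K I ^ (-s)) : ℝ) : ℂ)) s := by
  obtain ⟨c, hc, ha⟩ := exists_norm_classFun_le a
  have hs' : 1 < (1 + s) / 2 := by linarith
  refine hasDerivAt_tsum_of_isPreconnected (𝕜 := ℝ) (F := ℂ)
    (g := fun (I : (Ideal (𝓞 K))⁰) (s : ℝ) ↦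
      a (ClassGroup.mk0 I) * ((idealNorm K I ^ (-s) : ℝ) : ℂ))
    (g' := fun (I : (Ideal (𝓞 K))⁰) (s : ℝ) ↦ a (ClassGroup.mk0 I) *
      ((-(Real.log (idealNorm K I) * idealNorm K I ^ (-s)) : ℝ) : ℂ))
    (t := Ioi ((1 + s) / 2)) (y₀ := s) (y := s)
    ((summable_log_mul_idealNorm_rpow (K := K) hs').mul_left c) isOpen_Ioi isPreconnected_Ioi
    (fun I y _ ↦ ?_) (fun I y hy ↦ ?_) (mem_Ioi.2 (by linarith)) ?_ (mem_Ioi.2 (by linarith))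
  · have := ((hasDerivAt_neg y).const_rpow (idealNorm_pos K I)).ofReal_comp.const_mul
      (a (ClassGroup.mk0 I))
    convert! this using 3
    ring
  · have hy : (1 + s) / 2 < y := hy
    have hl := Real.log_nonneg (one_le_idealNorm K I)
    rw [norm_mul, Complex.norm_real, norm_neg, Real.norm_of_nonneg
      (mul_nonneg hl (Real.rpow_nonneg (idealNorm_pos K _).le _))]
    refine mul_le_mul (ha _) (mul_le_mul_of_nonneg_left ?_ hl)
      (mul_nonneg hl (Real.rpow_nonneg (idealNorm_pos K _).le _)) hc
    exact Real.rpow_le_rpow_of_exponent_le (one_le_idealNorm K I) (by linarith)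
  · exact (summable_norm_classFun_mul _ (summable_idealNorm_rpow hs) fun I ↦
      Real.rpow_nonneg (idealNorm_pos K _).le _).of_norm

theorem classVonMangoldt_mul_classLSeries (χ : ClassGroup (𝓞 K) →* ℂ) {s : ℝ} (hs : 1 < s) :
    classVonMangoldt K χ s * classLSeries K χ s = ∑' I : (Ideal (𝓞 K))⁰, χ (ClassGroup.mk0 I) *
      ((Real.log (idealNorm K I) * idealNorm K I ^ (-s) : ℝ) : ℂ) := by
  have h1 := summable_classVonMangoldt (χ : ClassGroup (𝓞 K) → ℂ) hs
  have h2 : Summable fun I : (Ideal (𝓞 K))⁰ ↦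
      ‖χ (ClassGroup.mk0 I) * ((idealNorm K I ^ (-s) : ℝ) : ℂ)‖ :=
    summable_norm_classFun_mul _ (summable_idealNorm_rpow hs) fun I ↦
      Real.rpow_nonneg (idealNorm_pos K _).le _
  have h3 := summable_mul_of_summable_norm h1 h2
  rw [classVonMangoldt, classLSeries, tsum_mul_tsum_of_summable_norm h1 h2]
  set π : (HeightOneSpectrum (𝓞 K) × ℕ) × (Ideal (𝓞 K))⁰ → (Ideal (𝓞 K))⁰ :=
    fun p ↦ primePow p.1 * p.2 with hπ
  rw [← (Equiv.sigmaFiberEquiv π).tsum_eq, Summable.tsum_sigma]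
  swap
  · exact (Equiv.sigmaFiberEquiv π).summable_iff.2 h3
  refine tsum_congr fun I ↦ ?_
  obtain ⟨S, hS, hlog⟩ := exists_finset_primePow_dvd I
  have hterm : ∀ p : {p // π p = I}, χ (ClassGroup.mk0 (primePow p.1.1)) *
      ((primeLog p.1.1 * idealNorm K (primePow p.1.1) ^ (-s) : ℝ) : ℂ) *
      (χ (ClassGroup.mk0 p.1.2) * ((idealNorm K p.1.2 ^ (-s) : ℝ) : ℂ)) =
      χ (ClassGroup.mk0 I) * ((idealNorm K I ^ (-s) : ℝ) : ℂ) * (primeLog p.1.1 : ℂ) := by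
    rintro ⟨p, rfl⟩
    simp only [hπ]
    rw [idealNorm_mul, Real.mul_rpow (idealNorm_pos K _).le (idealNorm_pos K _).le, map_mul,
      map_mul]
    push_cast
    ring
  refine (tsum_congr hterm).trans ?_
  rw [tsum_mul_left]
  have hbij : Function.Bijective (fun p : {p // π p = I} ↦
      (⟨p.1.1, (hS _).2 ⟨p.1.2, p.2⟩⟩ : {x // x ∈ S})) := by
    constructor
    · rintro ⟨⟨x, J⟩, hp⟩ ⟨⟨y, J'⟩, hq⟩ h
      have hxy : x = y := congrArg Subtype.val h
      subst hxy
      have : J = J' := mul_left_cancel (hp.trans hq.symm)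
      subst this
      rfl
    · rintro ⟨x, hx⟩
      obtain ⟨J, hJ⟩ := (hS x).1 hx
      exact ⟨⟨(x, J), hJ⟩, rfl⟩
  have h4 := (Equiv.ofBijective _ hbij).tsum_eq fun x : {x // x ∈ S} ↦ (primeLog x.1 : ℂ)
  have h5 : ∑' p : {p // π p = I}, (primeLog p.1.1 : ℂ) = (Real.log (idealNorm K I) : ℂ) := by
    refine h4.trans ?_
    rw [Finset.tsum_subtype S fun x ↦ (primeLog x : ℂ), ← hlog]
    push_cast; rfl
  rw [h5]
  push_cast
  ring

theorem hasDerivAt_classLSeries_eq (χ : ClassGroup (𝓞 K) →* ℂ) {s : ℝ} (hs : 1 < s) :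
    HasDerivAt (classLSeries K χ) (-(classVonMangoldt K χ s * classLSeries K χ s)) s := by
  have h := hasDerivAt_classLSeries (χ : ClassGroup (𝓞 K) → ℂ) hs
  rw [classVonMangoldt_mul_classLSeries χ hs, ← tsum_neg]
  convert! h using 3
  push_cast; ring

theorem tendsto_classLSeries_atTop (χ : ClassGroup (𝓞 K) →* ℂ) :
    Tendsto (classLSeries K χ) atTop (𝓝 1) := by
  classical
  obtain ⟨c, hc, ha⟩ := exists_norm_classFun_le (χ : ClassGroup (𝓞 K) → ℂ)
  have key := tendsto_tsum_of_dominated_convergence (𝓕 := atTop)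
    (f := fun (s : ℝ) (I : (Ideal (𝓞 K))⁰) ↦
      χ (ClassGroup.mk0 I) * ((idealNorm K I ^ (-s) : ℝ) : ℂ))
    (g := fun I ↦ if I = 1 then 1 else 0)
    ((summable_idealNorm_rpow (K := K) one_lt_two).mul_left c) (fun I ↦ ?_) ?_
  · rw [tsum_ite_eq] at key
    exact key
  · split_ifs with h
    · subst h
      have : idealNorm K 1 = 1 := by simp [idealNorm]
      simp [this]
    · have h1 : 1 < idealNorm K I := by
        refine (one_le_idealNorm K I).lt_of_ne fun h1 ↦ h (Subtype.ext ?_)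
        have : Ideal.absNorm (I : Ideal (𝓞 K)) = 1 := by
          rw [idealNorm] at h1; exact_mod_cast h1.symm
        simpa using Ideal.absNorm_eq_one_iff.1 this
      have h2 : Tendsto (fun s : ℝ ↦ idealNorm K I ^ (-s)) atTop (𝓝 0) := by
        have := (tendsto_rpow_atBot_of_base_gt_one _ h1).comp tendsto_neg_atTop_atBot
        exact this
      have h3 := ((Complex.continuous_ofReal.tendsto 0).comp h2).const_mul (χ (ClassGroup.mk0 I))
      simpa using h3
  · filter_upwards [eventually_ge_atTop 2] with s hs I
    rw [norm_mul, Complex.norm_of_nonneg (Real.rpow_nonneg (idealNorm_pos K _).le _)]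
    refine mul_le_mul (ha _) ?_ (Real.rpow_nonneg (idealNorm_pos K _).le _) hc
    exact Real.rpow_le_rpow_of_exponent_le (one_le_idealNorm K I) (by linarith)

end PrimePowers

section LogarithmicDerivative

theorem one_le_norm_of_hasDerivAt {F E : ℝ → ℂ} {b : ℝ}
    (hF : ∀ s, b < s → HasDerivAt F (-(E s * F s)) s)
    (hE : ∀ s, b < s → 0 ≤ (E s).re) (hlim : Tendsto F atTop (𝓝 1)) {s : ℝ} (hs : b < s) :
    1 ≤ ‖F s‖ := by
  have hd : ∀ t, b < t → HasDerivAt (fun u ↦ ‖F u‖ ^ 2) (-(2 * ((E t).re * ‖F t‖ ^ 2))) t := by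
    intro t ht
    convert! (hF t ht).norm_sq using 1
    have : -(E t * F t) * (starRingEnd ℂ) (F t) = -(E t * ((‖F t‖ ^ 2 : ℝ) : ℂ)) := by
      rw [neg_mul, mul_assoc, Complex.mul_conj, Complex.normSq_eq_norm_sq]
    rw [Complex.inner, this, Complex.neg_re, Complex.re_mul_ofReal]
    ring
  have hanti : AntitoneOn (fun u ↦ ‖F u‖ ^ 2) (Ioi b) := by
    refine antitoneOn_of_deriv_nonpos (convex_Ioi b)
      (fun t ht ↦ (hd t ht).continuousAt.continuousWithinAt) ?_ ?_
    · rw [interior_Ioi]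
      exact fun t ht ↦ (hd t ht).differentiableAt.differentiableWithinAt
    · rw [interior_Ioi]
      intro t ht
      rw [(hd t ht).deriv]
      have := hE t ht
      have : 0 ≤ (E t).re * ‖F t‖ ^ 2 := by positivity
      linarith
  have hl : Tendsto (fun u ↦ ‖F u‖ ^ 2) atTop (𝓝 1) := by
    simpa using hlim.norm.pow 2
  have h1 : 1 ≤ ‖F s‖ ^ 2 := by
    refine le_of_tendsto hl ?_
    filter_upwards [eventually_ge_atTop s] with u hu
    exact hanti hs (mem_Ioi.2 (hs.trans_le hu)) hu
  exact (one_le_sq_iff₀ (norm_nonneg _)).1 h1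

theorem norm_bounded_of_hasDerivAt {F E : ℝ → ℂ} {a b B : ℝ}
    (hF : ∀ s, a < s → s ≤ b → HasDerivAt F (-(E s * F s)) s)
    (hE : ∀ s, a < s → s ≤ b → (E s).re ≤ B) {s : ℝ} (hs : a < s) (hsb : s ≤ b) :
    ‖F s‖ * Real.exp (B * s) ≤ ‖F b‖ * Real.exp (B * b) := by
  have hd : ∀ t, a < t → t ≤ b → HasDerivAt (fun u ↦ ‖F u‖ ^ 2 * Real.exp (2 * B * u))
      (2 * ((B - (E t).re) * (‖F t‖ ^ 2 * Real.exp (2 * B * t)))) t := by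
    intro t ht htb
    have h1 := (hF t ht htb).norm_sq.mul ((hasDerivAt_id t).const_mul (2 * B)).exp
    convert! h1 using 1
    have : -(E t * F t) * (starRingEnd ℂ) (F t) = -(E t * ((‖F t‖ ^ 2 : ℝ) : ℂ)) := by
      rw [neg_mul, mul_assoc, Complex.mul_conj, Complex.normSq_eq_norm_sq]
    rw [Complex.inner, this, Complex.neg_re, Complex.re_mul_ofReal]
    simp only [id]
    ring
  have hmono : MonotoneOn (fun u ↦ ‖F u‖ ^ 2 * Real.exp (2 * B * u)) (Ioc a b) := by
    refine monotoneOn_of_deriv_nonneg (convex_Ioc a b)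
      (fun t ht ↦ (hd t ht.1 ht.2).continuousAt.continuousWithinAt) ?_ ?_
    · rw [interior_Ioc]
      exact fun t ht ↦ (hd t ht.1 ht.2.le).differentiableAt.differentiableWithinAt
    · rw [interior_Ioc]
      intro t ht
      rw [(hd t ht.1 ht.2.le).deriv]
      have := sub_nonneg.2 (hE t ht.1 ht.2.le)
      positivity
  have h1 := hmono ⟨hs, hsb⟩ ⟨hs.trans_le hsb, le_rfl⟩ hsb
  have h2 : ∀ u, ‖F u‖ ^ 2 * Real.exp (2 * B * u) = (‖F u‖ * Real.exp (B * u)) ^ 2 := fun u ↦ by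
    rw [mul_pow, ← Real.exp_nat_mul]; push_cast; ring_nf
  simp only [h2] at h1
  exact (pow_le_pow_iff_left₀ (by positivity) (by positivity) two_ne_zero).1 h1

end LogarithmicDerivative

section Nonvanishing

open NumberField Module IsDedekindDomain
open scoped nonZeroDivisors

variable {K : Type*} [Field K] [NumberField K]

theorem classVonMangoldt_sum {ι : Type*} (T : Finset ι) (c : ι → ℂ)
    (a : ι → ClassGroup (𝓞 K) → ℂ) {s : ℝ} (hs : 1 < s) :
    classVonMangoldt K (fun C ↦ ∑ i ∈ T, c i * a i C) s =
      ∑ i ∈ T, c i * classVonMangoldt K (a i) s := by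
  simp only [classVonMangoldt, ← tsum_mul_left]
  rw [← Summable.tsum_finsetSum fun i _ ↦ ((summable_classVonMangoldt (a i) hs).of_norm.mul_left _)]
  refine tsum_congr fun x ↦ ?_
  rw [Finset.sum_mul]
  exact Finset.sum_congr rfl fun i _ ↦ mul_assoc _ _ _

theorem re_classVonMangoldt_nonneg {a : ClassGroup (𝓞 K) → ℂ} (ha : ∀ C, 0 ≤ (a C).re) {s : ℝ}
    (hs : 1 < s) : 0 ≤ (classVonMangoldt K a s).re := by
  rw [classVonMangoldt, Complex.re_tsum (summable_classVonMangoldt a hs).of_norm]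
  refine tsum_nonneg fun x ↦ ?_
  rw [Complex.re_mul_ofReal]
  exact mul_nonneg (ha _) (mul_nonneg (primeLog_nonneg x)
    (Real.rpow_nonneg (idealNorm_pos K _).le _))

theorem norm_classCharacter (χ : ClassGroup (𝓞 K) →* ℂ) (C : ClassGroup (𝓞 K)) : ‖χ C‖ = 1 := by
  have h : ‖χ C‖ ^ Fintype.card (ClassGroup (𝓞 K)) = 1 := by
    rw [← norm_pow, ← map_pow, pow_card_eq_one, map_one, norm_one]
  exact (pow_eq_one_iff_of_nonneg (norm_nonneg _) Fintype.card_ne_zero).1 h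

theorem three_add_four_mul_re_nonneg {z : ℂ} (hz : ‖z‖ = 1) : 0 ≤ (3 + 4 * z + z ^ 2).re := by
  have h : z.re ^ 2 + z.im ^ 2 = 1 := by
    have := Complex.normSq_eq_norm_sq z
    rw [hz, Complex.normSq_apply] at this
    linarith
  have : (3 + 4 * z + z ^ 2).re = 2 * (1 + z.re) ^ 2 := by
    simp [pow_two]
    linarith
  rw [this]; positivity

theorem one_le_norm_classLSeries_product (χ : ClassGroup (𝓞 K) →* ℂ) {s : ℝ} (hs : 1 < s) :
    1 ≤ ‖classLSeries K (1 : ClassGroup (𝓞 K) →* ℂ) s ^ 3 * classLSeries K χ s ^ 4 *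
      classLSeries K (χ ^ 2 : ClassGroup (𝓞 K) →* ℂ) s‖ := by
  refine one_le_norm_of_hasDerivAt
    (F := fun s : ℝ ↦ classLSeries K (1 : ClassGroup (𝓞 K) →* ℂ) s ^ 3 *
      classLSeries K χ s ^ 4 * classLSeries K (χ ^ 2 : ClassGroup (𝓞 K) →* ℂ) s)
    (E := fun s : ℝ ↦ 3 * classVonMangoldt K (1 : ClassGroup (𝓞 K) →* ℂ) s +
      4 * classVonMangoldt K χ s + classVonMangoldt K (χ ^ 2 : ClassGroup (𝓞 K) →* ℂ) s)
    (b := 1) (fun s hs ↦ ?_) (fun s hs ↦ ?_) ?_ hs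
  · have h := (((hasDerivAt_classLSeries_eq (K := K) 1 hs).pow 3).mul
      ((hasDerivAt_classLSeries_eq χ hs).pow 4)).mul (hasDerivAt_classLSeries_eq (χ ^ 2) hs)
    convert! h using 1
    simp only [Pi.mul_apply, Pi.pow_apply]
    push_cast
    ring
  · have h := classVonMangoldt_sum (K := K) Finset.univ ![3, 4, 1] ![(1 : ClassGroup (𝓞 K) →* ℂ), χ,
      (χ ^ 2 : ClassGroup (𝓞 K) →* ℂ)] hs
    simp only [Fin.sum_univ_three, Matrix.cons_val_zero, Matrix.cons_val_one, Matrix.cons_val,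
      one_mul] at h
    rw [← h]
    refine re_classVonMangoldt_nonneg (fun C ↦ ?_) hs
    simpa using three_add_four_mul_re_nonneg (norm_classCharacter χ C)
  · simpa using (((tendsto_classLSeries_atTop (K := K) 1).pow 3).mul
      ((tendsto_classLSeries_atTop χ).pow 4)).mul (tendsto_classLSeries_atTop (χ ^ 2))

theorem tendsto_ofReal_nhdsGT_one :
    Tendsto (fun s : ℝ ↦ (s : ℂ)) (𝓝[>] 1) (𝓝[≠] 1) := by
  refine tendsto_nhdsWithin_iff.2 ⟨?_, ?_⟩
  · have := (Complex.continuous_ofReal.tendsto 1).mono_left (nhdsWithin_le_nhds (s := Ioi (1 : ℝ)))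
    simpa using this
  · filter_upwards [self_mem_nhdsWithin] with s hs
    have hs : 1 < s := hs
    exact mem_compl_singleton_iff.2 (by exact_mod_cast hs.ne')

theorem classLSeries_continuation_ne_zero {χ : ClassGroup (𝓞 K) →* ℂ} (hχ : χ ≠ 1) :
    ∃ Λ : ℂ → ℂ, AnalyticAt ℂ Λ 1 ∧ (∀ s : ℝ, 1 < s → classLSeries K χ s = Λ s) ∧ Λ 1 ≠ 0 := by
  obtain ⟨Λ, hΛ, hs, h0⟩ := exists_classLSeries_analyticAt χ (sum_hom_units_eq_zero χ hχ)
  refine ⟨Λ, hΛ, hs, fun hz ↦ ?_⟩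
  by_cases h2 : χ ^ 2 = 1
  · have hsign : ∀ C, χ C = 1 ∨ χ C = -1 := fun C ↦ by
      have : χ C ^ 2 = 1 := by
        rw [← MonoidHom.pow_apply, h2, MonoidHom.one_apply]
      exact sq_eq_one_iff.1 this
    have him : ∀ C, (χ C).im = 0 := fun C ↦ by rcases hsign C with h | h <;> simp [h]
    let ψ : ClassGroup (𝓞 K) →* ℝ :=
      { toFun := fun C ↦ (χ C).re
        map_one' := by simp
        map_mul' := fun C D ↦ by simp [him] }
    have hψ : ∀ C, ((ψ C : ℝ) : ℂ) = χ C := fun C ↦ Complex.ext (by simp [ψ]) (by simp [him])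
    refine integral_idealTheta_ne_zero ψ (fun C ↦ ?_) ?_ ?_
    · rcases hsign C with h | h <;> simp [ψ, h]
    · simp only [hψ]
      exact sum_hom_units_eq_zero χ hχ
    · simp only [hψ]
      exact h0 hz
  · obtain ⟨κ, -, H⟩ := exists_classLSeries_continuation (K := K)
    obtain ⟨Φ, hΦ, -, hΦs⟩ := H (1 : ClassGroup (𝓞 K) →* ℂ)
    obtain ⟨Λ₂, hΛ₂, hs₂, -⟩ := exists_classLSeries_analyticAt _ (sum_hom_units_eq_zero (χ ^ 2) h2)
    have t0 := tendsto_ofReal_nhdsGT_one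
    have t1 := t0.mono_right nhdsWithin_le_nhds
    have l1 := hΦ.tendsto.comp t1
    have l2 := hΛ₂.continuousAt.tendsto.comp t1
    have l3 := (hasDerivAt_iff_tendsto_slope.1 hΛ.differentiableAt.hasDerivAt).comp t0
    have l4 := (((l1.pow 3).mul (l3.pow 4)).mul l2).mul (t1.sub_const 1)
    rw [sub_self, mul_zero] at l4
    have l5 := l4.norm
    rw [norm_zero] at l5
    have : (1 : ℝ) ≤ 0 := by
      refine ge_of_tendsto l5 ?_
      filter_upwards [self_mem_nhdsWithin] with s hs1
      have hs1 : 1 < s := hs1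
      refine (one_le_norm_classLSeries_product χ hs1).trans (le_of_eq (congrArg _ ?_))
      have hne : (s : ℂ) - 1 ≠ 0 := sub_ne_zero.2 (by exact_mod_cast hs1.ne')
      simp only [Function.comp_apply, slope_def_field]
      rw [← hΦs s hs1, ← hs₂ s hs1, ← hs s hs1, hz]
      field_simp
      ring
    linarith

theorem exists_tendsto_classVonMangoldt {χ : ClassGroup (𝓞 K) →* ℂ} (hχ : χ ≠ 1) :
    ∃ l, Tendsto (classVonMangoldt K χ) (𝓝[>] 1) (𝓝 l) := by
  obtain ⟨Λ, hΛ, hs, h0⟩ := classLSeries_continuation_ne_zero hχ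
  have t0 := tendsto_ofReal_nhdsGT_one
  have t1 := t0.mono_right nhdsWithin_le_nhds
  have l1 := (hΛ.deriv.continuousAt.tendsto.comp t1).div (hΛ.continuousAt.tendsto.comp t1) h0
  refine ⟨_, l1.neg.congr' ?_⟩
  filter_upwards [self_mem_nhdsWithin, t1.eventually hΛ.eventually_analyticAt,
    t1.eventually (hΛ.continuousAt.eventually_ne h0)] with s hs1 ha hne
  have hs1 : 1 < s := hs1
  have d1 := ha.differentiableAt.hasDerivAt.comp_ofReal
  have d2 := hasDerivAt_classLSeries_eq χ hs1
  have d3 : HasDerivAt (fun y : ℝ ↦ Λ y) (-(classVonMangoldt K χ s * classLSeries K χ s)) s := by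
    refine d2.congr_of_eventuallyEq ?_
    filter_upwards [lt_mem_nhds hs1] with y hy
    exact (hs y hy).symm
  have := d1.unique d3
  simp only [Function.comp_apply, Pi.div_apply]
  rw [this, hs s hs1]
  field_simp

theorem not_eventually_re_classVonMangoldt_le (B : ℝ) :
    ¬ ∀ᶠ s in 𝓝[>] (1 : ℝ), (classVonMangoldt K (1 : ClassGroup (𝓞 K) →* ℂ) s).re ≤ B := by
  intro h
  obtain ⟨b, hb, hB⟩ := mem_nhdsGT_iff_exists_Ioc_subset.1 h
  have hb : 1 < b := hb
  obtain ⟨κ, hκ, H⟩ := exists_classLSeries_continuation (K := K)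
  obtain ⟨Φ, hΦ, hΦ1, hΦs⟩ := H (1 : ClassGroup (𝓞 K) →* ℂ)
  have t1 := tendsto_ofReal_nhdsGT_one.mono_right nhdsWithin_le_nhds
  have l1 := (hΦ.tendsto.comp t1).norm
  have hexp : Tendsto (fun s : ℝ ↦ Real.exp (B * s)) (𝓝[>] 1) (𝓝 (Real.exp (B * 1))) :=
    ((Real.continuous_exp.comp (continuous_const.mul continuous_id)).tendsto 1).mono_left
      nhdsWithin_le_nhds
  have l2 := l1.mul hexp
  have l3 := (t1.sub_const 1).norm.mul_const
    (‖classLSeries K (1 : ClassGroup (𝓞 K) →* ℂ) b‖ * Real.exp (B * b))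
  rw [sub_self, norm_zero, zero_mul] at l3
  have hle : ‖Φ 1‖ * Real.exp (B * 1) ≤ 0 := by
    refine le_of_tendsto_of_tendsto l2 l3 ?_
    filter_upwards [Ioc_mem_nhdsGT hb] with s hs
    have := norm_bounded_of_hasDerivAt (a := 1) (b := b)
      (fun s hs _ ↦ hasDerivAt_classLSeries_eq (K := K) 1 hs) (fun s h1 h2 ↦ hB ⟨h1, h2⟩) hs.1 hs.2
    simp only [Function.comp_apply]
    rw [← hΦs s hs.1, norm_mul, mul_assoc]
    exact mul_le_mul_of_nonneg_left this (norm_nonneg _)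
  have hne : Φ 1 ≠ 0 := by
    rw [hΦ1]
    simp [hκ.ne']
  have : 0 < ‖Φ 1‖ * Real.exp (B * 1) := by positivity
  linarith

end Nonvanishing

section GroupCharacter

variable {G : Type*} [CommGroup G]

/-- An additive character of `Additive G` as a multiplicative character of `G`. -/
noncomputable def groupCharacter (ψ : AddChar (Additive G) ℂ) : G →* ℂ where
  toFun C := ψ (Additive.ofMul C)
  map_one' := by rw [ofMul_one, AddChar.map_zero_eq_one]
  map_mul' C D := by rw [ofMul_mul, AddChar.map_add_eq_mul]

theorem groupCharacter_zero : groupCharacter (0 : AddChar (Additive G) ℂ) = 1 := rfl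

theorem groupCharacter_ne_one {ψ : AddChar (Additive G) ℂ} (hψ : ψ ≠ 0) :
    groupCharacter ψ ≠ 1 := fun h ↦ hψ <| DFunLike.ext _ _ fun C ↦
  DFunLike.congr_fun h (Additive.toMul C)

theorem sum_groupCharacter [Fintype G] [DecidableEq G] (C D : G) :
    ∑ ψ, groupCharacter ψ D⁻¹ * groupCharacter ψ C =
      if C = D then (Fintype.card G : ℂ) else 0 := by
  have h := AddChar.sum_apply_eq_ite (Additive.ofMul (D⁻¹ * C))
  simp only [ofMul_eq_zero, inv_mul_eq_one, Fintype.card_congr (Additive.toMul (α := G))] at h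
  simp only [← map_mul]
  refine h.trans ?_
  simp only [eq_comm]

end GroupCharacter

section PrimesInClasses

open NumberField Module IsDedekindDomain
open scoped nonZeroDivisors

variable {K : Type*} [Field K] [NumberField K]

theorem two_le_idealNorm_primeIdeal (v : HeightOneSpectrum (𝓞 K)) :
    2 ≤ idealNorm K (primeIdeal v) := two_le_idealNorm (prime_primeIdeal v)

open scoped Classical in
theorem exists_norm_classVonMangoldt_le {C : ClassGroup (𝓞 K)}
    (hC : {v : HeightOneSpectrum (𝓞 K) | ClassGroup.mk0 (primeIdeal v) = C}.Finite) :
    ∃ B : ℝ, ∀ s : ℝ, 1 < s →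
      ‖classVonMangoldt K (fun D ↦ if D = C then (Fintype.card (ClassGroup (𝓞 K)) : ℂ) else 0) s‖
        ≤ B := by
  set h : ℝ := (Fintype.card (ClassGroup (𝓞 K)) : ℝ) with hh
  set ℓ : HeightOneSpectrum (𝓞 K) → ℝ := fun v ↦ Real.log (idealNorm K (primeIdeal v)) with hℓ
  have hℓ0 : ∀ v, 0 ≤ ℓ v := fun v ↦ Real.log_nonneg (one_le_idealNorm K _)
  set w : HeightOneSpectrum (𝓞 K) → ℝ := fun v ↦
    2 * (ℓ v * idealNorm K (primeIdeal v) ^ (-2 : ℝ)) +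
      if ClassGroup.mk0 (primeIdeal v) = C then ℓ v else 0 with hw
  have hsw : Summable w := by
    refine Summable.add (Summable.mul_left _ ?_) (summable_of_ne_finset_zero (s := hC.toFinset)
      fun v hv ↦ ?_)
    · have := (summable_primeLog (K := K) one_lt_two).comp_injective
        (i := fun v : HeightOneSpectrum (𝓞 K) ↦ (v, 0)) fun v v' e ↦ congrArg Prod.fst e
      simpa [Function.comp_def, primeLog, primePow] using this
    · rw [if_neg]
      simpa using hv
  have hw0 : ∀ v, 0 ≤ 2 * (ℓ v * idealNorm K (primeIdeal v) ^ (-2 : ℝ)) := fun v ↦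
    mul_nonneg zero_le_two (mul_nonneg (hℓ0 v) (Real.rpow_nonneg (idealNorm_pos K _).le _))
  have hi0 : ∀ v, 0 ≤ if ClassGroup.mk0 (primeIdeal v) = C then ℓ v else 0 := fun v ↦ by
    split_ifs
    exacts [hℓ0 v, le_rfl]
  have hwnn : ∀ v, 0 ≤ w v := fun v ↦ add_nonneg (hw0 v) (hi0 v)
  have hsu : Summable fun x : HeightOneSpectrum (𝓞 K) × ℕ ↦ h * (w x.1 * (1 / 2 : ℝ) ^ x.2) :=
    (hsw.mul_of_nonneg summable_geometric_two hwnn fun k ↦ by positivity).mul_left h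
  refine ⟨∑' x : HeightOneSpectrum (𝓞 K) × ℕ, h * (w x.1 * (1 / 2 : ℝ) ^ x.2), fun s hs ↦ ?_⟩
  refine tsum_of_norm_bounded hsu.hasSum fun ⟨v, k⟩ ↦ ?_
  have hN := one_le_idealNorm K (primeIdeal v)
  have hN0 := idealNorm_pos K (primeIdeal v)
  have hN2 := two_le_idealNorm_primeIdeal v
  rw [norm_mul, Complex.norm_of_nonneg (mul_nonneg (primeLog_nonneg _)
    (Real.rpow_nonneg (idealNorm_pos K _).le _))]
  have hr0 : 0 ≤ ℓ v * idealNorm K (primePow (v, k)) ^ (-s) :=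
    mul_nonneg (hℓ0 v) (Real.rpow_nonneg (idealNorm_pos K _).le _)
  have hnorm : ‖if ClassGroup.mk0 (primePow (v, k)) = C then
      (Fintype.card (ClassGroup (𝓞 K)) : ℂ) else 0‖ ≤ h := by
    split_ifs <;> simp [hh]
  have hle : idealNorm K (primePow (v, k)) ^ (-s) ≤ (idealNorm K (primeIdeal v) ^ (k + 1))⁻¹ := by
    rw [primePow, idealNorm_pow, ← Real.rpow_neg_one]
    exact Real.rpow_le_rpow_of_exponent_le (one_le_pow₀ hN) (by linarith)
  rcases k with _ | k
  · by_cases hv : ClassGroup.mk0 (primeIdeal v) = C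
    · refine mul_le_mul hnorm ?_ hr0 (by positivity)
      have h1 : w v = 2 * (ℓ v * idealNorm K (primeIdeal v) ^ (-2 : ℝ)) + ℓ v := by
        simp only [hw, if_pos hv]
      have h2 : (idealNorm K (primeIdeal v) ^ (0 + 1))⁻¹ ≤ 1 :=
        inv_le_one_of_one_le₀ (one_le_pow₀ hN)
      have h3 : ℓ v * idealNorm K (primePow (v, 0)) ^ (-s) ≤ ℓ v * 1 :=
        mul_le_mul_of_nonneg_left (hle.trans h2) (hℓ0 v)
      have := hw0 v
      rw [pow_zero, mul_one, h1]
      exact h3.trans (by linarith)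
    · have h1 : primePow (v, 0) = primeIdeal v := pow_one _
      simp only [h1, if_neg hv, norm_zero, zero_mul]
      have := hwnn v
      positivity
  · refine mul_le_mul hnorm ?_ hr0 (by positivity)
    have h1 : (idealNorm K (primeIdeal v) ^ (k + 1 + 1))⁻¹ ≤
        2 * idealNorm K (primeIdeal v) ^ (-2 : ℝ) * (1 / 2 : ℝ) ^ (k + 1) := by
      have e : idealNorm K (primeIdeal v) ^ (-2 : ℝ) = (idealNorm K (primeIdeal v) ^ 2)⁻¹ := by
        rw [Real.rpow_neg hN0.le]; norm_cast
      rw [e, show k + 1 + 1 = 2 + k by ring, pow_add, mul_inv, pow_succ (1 / 2 : ℝ) k, one_div,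
        inv_pow]
      have h4 : (idealNorm K (primeIdeal v) ^ k)⁻¹ ≤ ((2 : ℝ) ^ k)⁻¹ :=
        inv_anti₀ (by positivity) (pow_le_pow_left₀ zero_le_two hN2 k)
      have h5 : 0 ≤ (idealNorm K (primeIdeal v) ^ 2)⁻¹ := by positivity
      nlinarith [mul_le_mul_of_nonneg_left h4 h5]
    have h2 := mul_le_mul_of_nonneg_left (hle.trans h1) (hℓ0 v)
    refine h2.trans ?_
    have h3 : 2 * (ℓ v * idealNorm K (primeIdeal v) ^ (-2 : ℝ)) ≤ w v := by
      simp only [hw]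
      linarith [hi0 v]
    have h4 := mul_le_mul_of_nonneg_right h3 (by positivity : (0 : ℝ) ≤ (1 / 2) ^ (k + 1))
    exact le_trans (le_of_eq (by ring)) h4

/-- Every ideal class of a number field contains infinitely many prime ideals. -/
theorem infinite_primeIdeal_class (C : ClassGroup (𝓞 K)) :
    {v : HeightOneSpectrum (𝓞 K) | ClassGroup.mk0 (primeIdeal v) = C}.Infinite := by
  classical
  intro hfin
  obtain ⟨B, hB⟩ := exists_norm_classVonMangoldt_le hfin
  have hlim : ∃ l, Tendsto (fun s ↦ ∑ ψ ∈ Finset.univ.erase (0 : AddChar (Additive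
      (ClassGroup (𝓞 K))) ℂ), groupCharacter ψ C⁻¹ * classVonMangoldt K (groupCharacter ψ) s)
      (𝓝[>] 1) (𝓝 l) := by
    choose! l hl using fun (ψ : AddChar (Additive (ClassGroup (𝓞 K))) ℂ) (h : ψ ≠ 0) ↦
      exists_tendsto_classVonMangoldt (groupCharacter_ne_one h)
    exact ⟨_, tendsto_finsetSum _ fun ψ hψ ↦ (hl ψ (Finset.ne_of_mem_erase hψ)).const_mul _⟩
  obtain ⟨l, hl⟩ := hlim
  refine not_eventually_re_classVonMangoldt_le (K := K) (B + (‖l‖ + 1)) ?_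
  filter_upwards [self_mem_nhdsWithin, hl.norm.eventually_lt_const (lt_add_one ‖l‖)] with s hs1 hs
  have hs1 : 1 < s := hs1
  have h1 := classVonMangoldt_sum (K := K) Finset.univ (fun ψ ↦ groupCharacter ψ C⁻¹)
    (fun ψ ↦ groupCharacter ψ) hs1
  simp only [sum_groupCharacter] at h1
  rw [← Finset.add_sum_erase _ _ (Finset.mem_univ (0 : AddChar (Additive (ClassGroup (𝓞 K))) ℂ)),
    groupCharacter_zero, MonoidHom.one_apply, one_mul] at h1
  have h2 := eq_sub_of_add_eq h1.symm
  rw [h2]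
  refine (Complex.re_le_norm _).trans ((norm_sub_le _ _).trans (add_le_add (hB s hs1) hs.le))

end PrimesInClasses

section Factorization

variable {D : Type*} [CommRing D] [IsDomain D]

theorem isAtomicDomain_of_wfDvdMonoid [WfDvdMonoid D] : IsAtomicDomain D := fun x hx hu ↦ by
  obtain ⟨s, hs, hp, -⟩ := (WfDvdMonoid.not_isUnit_iff_exists_factors_eq x hx).1 hu
  exact ⟨s, hs, hp⟩

theorem IsHalfFactorialDomain.card_eq_of_associated (h : IsHalfFactorialDomain D) {a : D}
    {s t : Multiset D} (hs : ∀ b ∈ a ::ₘ s, Irreducible b) (ht : ∀ b ∈ t, Irreducible b)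
    (hst : Associated (a ::ₘ s).prod t.prod) :
    Multiset.card (a ::ₘ s) = Multiset.card t := by
  obtain ⟨u, hu⟩ := hst
  have h1 := h.2 ((a * u) ::ₘ s) t (fun b hb ↦ ?_) ht ?_
  · simpa using h1
  · rcases Multiset.mem_cons.1 hb with rfl | hb
    · exact (irreducible_mul_units u).2 (hs a (Multiset.mem_cons_self a s))
    · exact hs b (Multiset.mem_cons_of_mem hb)
  · rw [← hu, Multiset.prod_cons, Multiset.prod_cons, mul_right_comm]

theorem IsLengthFactorialDomain.associated_or_associated (h : IsLengthFactorialDomain D)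
    {a b c d : D} (ha : Irreducible a) (hb : Irreducible b) (hc : Irreducible c)
    (hd : Irreducible d) (habcd : Associated (a * b) (c * d)) :
    Associated a c ∨ Associated a d := by
  obtain ⟨u, hu⟩ := habcd
  have h1 := h {a * u, b} {c, d} (by simp [hb, (irreducible_mul_units u).2 ha]) (by simp [hc, hd])
    (by simp [← hu, mul_right_comm]) (by simp)
  obtain ⟨e, he, hae⟩ := Multiset.exists_mem_of_rel_of_mem h1 (a := a * u) (by simp)
  have hau : Associated a e := (associated_mul_unit_right a _ u.isUnit).trans hae
  rcases Multiset.mem_cons.1 he with rfl | he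
  · exact Or.inl hau
  · rw [Multiset.mem_singleton.1 he] at hau
    exact Or.inr hau

end Factorization

section IrreducibleElements

open NumberField Module IsDedekindDomain
open scoped nonZeroDivisors

variable {K : Type*} [Field K] [NumberField K]

theorem mk0_prod_primeIdeal_eq_one_iff {ι : Type*} (t : Finset ι)
    (P : ι → HeightOneSpectrum (𝓞 K)) :
    ∏ i ∈ t, ClassGroup.mk0 (primeIdeal (P i)) = 1 ↔
      ∃ x : 𝓞 K, Ideal.span {x} = ∏ i ∈ t, (P i).asIdeal := by
  have hI : ∏ i ∈ t, (P i).asIdeal ∈ (Ideal (𝓞 K))⁰ :=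
    prod_mem fun i _ ↦ (primeIdeal (P i)).2
  have h1 : ∏ i ∈ t, primeIdeal (P i) = ⟨∏ i ∈ t, (P i).asIdeal, hI⟩ :=
    Subtype.ext (by simp [primeIdeal])
  rw [← map_prod, h1, ClassGroup.mk0_eq_one_iff]
  constructor
  · rintro ⟨x, hx⟩
    exact ⟨x, hx.symm⟩
  · rintro ⟨x, hx⟩
    exact ⟨x, hx.symm⟩

/-- A minimal product-one family of prime ideal classes yields an irreducible element. -/
theorem exists_irreducible_span_eq_prod {ι : Type*} [Fintype ι] [Nonempty ι]
    (P : ι → HeightOneSpectrum (𝓞 K))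
    (h1 : ∏ i, ClassGroup.mk0 (primeIdeal (P i)) = 1)
    (hmin : ∀ t : Finset ι, ∏ i ∈ t, ClassGroup.mk0 (primeIdeal (P i)) = 1 →
      t = ∅ ∨ t = Finset.univ) :
    ∃ x : 𝓞 K, Irreducible x ∧ Ideal.span {x} = ∏ i, (P i).asIdeal := by
  classical
  obtain ⟨x, hx⟩ := (mk0_prod_primeIdeal_eq_one_iff _ P).1 h1
  refine ⟨x, ⟨fun hu ↦ ?_, fun a b hab ↦ ?_⟩, hx⟩
  · rw [Ideal.span_singleton_eq_top.2 hu, ← Ideal.one_eq_top] at hx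
    obtain ⟨i⟩ := ‹Nonempty ι›
    have h2 : (P i).asIdeal ∣ 1 := hx ▸ Finset.dvd_prod_of_mem _ (Finset.mem_univ i)
    exact (P i).prime.not_isUnit (isUnit_of_dvd_one h2)
  · have h2 : Ideal.span {a} * Ideal.span {b} = 1 * ∏ i, (P i).asIdeal := by
      rw [one_mul, ← hx, hab, Ideal.span_singleton_mul_span_singleton]
    obtain ⟨t, u, c, d, htu, hdisj, hcd, ha, hb⟩ := mul_eq_mul_prime_prod
      (fun i _ ↦ (P i).prime) h2
    have hc : c = 1 := eq_one_of_mul_right hcd.symm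
    have hd : d = 1 := eq_one_of_mul_left hcd.symm
    rw [hc, one_mul] at ha
    rw [hd, one_mul] at hb
    rcases hmin t ((mk0_prod_primeIdeal_eq_one_iff t P).2 ⟨a, ha⟩) with rfl | rfl
    · left
      rw [Finset.prod_empty, Ideal.one_eq_top] at ha
      exact Ideal.span_singleton_eq_top.1 ha
    · right
      have : u = ∅ := by
        rw [Finset.disjoint_left] at hdisj
        exact Finset.eq_empty_of_forall_notMem fun i hi ↦ hdisj (Finset.mem_univ i) hi
      rw [this, Finset.prod_empty, Ideal.one_eq_top] at hb
      exact Ideal.span_singleton_eq_top.1 hb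

theorem exists_irreducible_of_orderOf {g : ClassGroup (𝓞 K)} {n : ℕ} (hn : 0 < n)
    (hg : orderOf g = n) (P : Fin n → HeightOneSpectrum (𝓞 K))
    (hP : ∀ i, ClassGroup.mk0 (primeIdeal (P i)) = g) :
    ∃ x : 𝓞 K, Irreducible x ∧ Ideal.span {x} = ∏ i, (P i).asIdeal := by
  have : Nonempty (Fin n) := ⟨⟨0, hn⟩⟩
  refine exists_irreducible_span_eq_prod P ?_ fun t ht ↦ ?_
  · simp only [hP, Finset.prod_const, Finset.card_univ, Fintype.card_fin]
    exact hg ▸ pow_orderOf_eq_one g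
  · simp only [hP, Finset.prod_const] at ht
    have h1 := orderOf_dvd_of_pow_eq_one ht
    rw [hg] at h1
    have h2 : t.card ≤ n := by simpa using t.card_le_univ
    rcases Nat.eq_zero_or_pos t.card with h0 | h0
    · exact Or.inl (Finset.card_eq_zero.1 h0)
    · right
      rw [← Finset.card_eq_iff_eq_univ, Fintype.card_fin]
      exact h2.antisymm (Nat.le_of_dvd h0 h1)

theorem exists_irreducible_span_eq_pow {v : HeightOneSpectrum (𝓞 K)} {n : ℕ} (hn : 0 < n)
    (hv : orderOf (ClassGroup.mk0 (primeIdeal v)) = n) :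
    ∃ x : 𝓞 K, Irreducible x ∧ Ideal.span {x} = v.asIdeal ^ n := by
  simpa using exists_irreducible_of_orderOf hn hv (fun _ ↦ v) fun _ ↦ rfl

theorem exists_irreducible_span_eq_mul {v w : HeightOneSpectrum (𝓞 K)}
    (hv : ClassGroup.mk0 (primeIdeal v) ≠ 1)
    (hvw : ClassGroup.mk0 (primeIdeal v) * ClassGroup.mk0 (primeIdeal w) = 1) :
    ∃ x : 𝓞 K, Irreducible x ∧ Ideal.span {x} = v.asIdeal * w.asIdeal := by
  have hw : ClassGroup.mk0 (primeIdeal w) ≠ 1 := fun h ↦ hv (by simpa [h] using hvw)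
  have := exists_irreducible_span_eq_prod ![v, w] (by simpa using hvw) fun t ht ↦ ?_
  · simpa using this
  · have hall : ∀ t : Finset (Fin 2), t = ∅ ∨ t = {0} ∨ t = {1} ∨ t = Finset.univ := by decide
    rcases hall t with rfl | rfl | rfl | rfl
    · exact Or.inl rfl
    · exact absurd (by simpa using ht) hv
    · exact absurd (by simpa using ht) hw
    · exact Or.inr rfl

theorem exists_irreducible_span_eq_mul_mul {u v w : HeightOneSpectrum (𝓞 K)}
    (hu : ClassGroup.mk0 (primeIdeal u) ≠ 1) (hv : ClassGroup.mk0 (primeIdeal v) ≠ 1)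
    (hw : ClassGroup.mk0 (primeIdeal w) ≠ 1)
    (huvw : ClassGroup.mk0 (primeIdeal u) * ClassGroup.mk0 (primeIdeal v) *
      ClassGroup.mk0 (primeIdeal w) = 1) :
    ∃ x : 𝓞 K, Irreducible x ∧ Ideal.span {x} = u.asIdeal * v.asIdeal * w.asIdeal := by
  have := exists_irreducible_span_eq_prod ![u, v, w]
    (by simpa [Fin.prod_univ_three] using huvw) fun t ht ↦ ?_
  · simpa [Fin.prod_univ_three] using this
  · have hall : ∀ t : Finset (Fin 3), t = ∅ ∨ t = {0} ∨ t = {1} ∨ t = {2} ∨ t = {0, 1} ∨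
        t = {0, 2} ∨ t = {1, 2} ∨ t = Finset.univ := by decide
    rcases hall t with rfl | rfl | rfl | rfl | rfl | rfl | rfl | rfl
    · exact Or.inl rfl
    · exact absurd (by simpa using ht) hu
    · exact absurd (by simpa using ht) hv
    · exact absurd (by simpa using ht) hw
    · rw [Finset.prod_pair (by decide)] at ht
      have ht : ClassGroup.mk0 (primeIdeal u) * ClassGroup.mk0 (primeIdeal v) = 1 := ht
      rw [ht, one_mul] at huvw
      exact absurd huvw hw
    · rw [Finset.prod_pair (by decide)] at ht
      rw [mul_right_comm] at huvw
      have ht : ClassGroup.mk0 (primeIdeal u) * ClassGroup.mk0 (primeIdeal w) = 1 := ht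
      rw [ht, one_mul] at huvw
      exact absurd huvw hv
    · rw [Finset.prod_pair (by decide)] at ht
      rw [mul_assoc] at huvw
      have ht : ClassGroup.mk0 (primeIdeal v) * ClassGroup.mk0 (primeIdeal w) = 1 := ht
      rw [ht, mul_one] at huvw
      exact absurd huvw hu
    · exact Or.inr rfl

theorem exists_primeIdeal_class (C : ClassGroup (𝓞 K)) :
    ∃ v : HeightOneSpectrum (𝓞 K), ClassGroup.mk0 (primeIdeal v) = C :=
  (infinite_primeIdeal_class C).nonempty

theorem not_isLengthFactorialDomain {g : ClassGroup (𝓞 K)} (hg : g ≠ 1) :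
    ¬IsLengthFactorialDomain (𝓞 K) := by
  intro H
  obtain ⟨v, hv, w, hw, hvw⟩ := (infinite_primeIdeal_class g).nontrivial
  have hv : ClassGroup.mk0 (primeIdeal v) = g := hv
  have hw : ClassGroup.mk0 (primeIdeal w) = g := hw
  obtain ⟨m, hm⟩ : ∃ m, orderOf g = m + 1 := Nat.exists_eq_succ_of_ne_zero (orderOf_pos g).ne'
  have hm0 : m ≠ 0 := by
    rintro rfl
    exact hg (orderOf_eq_one_iff.1 hm)
  obtain ⟨a, ha, hav⟩ := exists_irreducible_span_eq_pow m.succ_pos (hv.symm ▸ hm)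
  obtain ⟨b, hb, hbw⟩ := exists_irreducible_span_eq_pow m.succ_pos (hw.symm ▸ hm)
  obtain ⟨c, hc, hcs⟩ := exists_irreducible_of_orderOf m.succ_pos hm
    (Fin.cons w fun _ ↦ v) (Fin.cases (by simpa using hw) fun i ↦ by simpa using hv)
  obtain ⟨d, hd, hds⟩ := exists_irreducible_of_orderOf m.succ_pos hm
    (Fin.cons v fun _ ↦ w) (Fin.cases (by simpa using hv) fun i ↦ by simpa using hw)
  simp only [Fin.prod_univ_succ, Fin.cons_zero, Fin.cons_succ, Finset.prod_const,
    Finset.card_univ, Fintype.card_fin] at hcs hds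
  have hne : v.asIdeal ≠ w.asIdeal := fun h ↦ hvw (HeightOneSpectrum.ext h)
  have hassoc : Associated (a * b) (c * d) := by
    rw [← Ideal.span_singleton_eq_span_singleton, ← Ideal.span_singleton_mul_span_singleton,
      ← Ideal.span_singleton_mul_span_singleton, hav, hbw, hcs, hds, pow_succ, pow_succ]
    ring
  rcases H.associated_or_associated ha hb hc hd hassoc with h | h
  · rw [← Ideal.span_singleton_eq_span_singleton, hav, hcs, pow_succ'] at h
    exact hne (mul_right_cancel₀ (pow_ne_zero m v.ne_bot) h)
  · rw [← Ideal.span_singleton_eq_span_singleton, hav, hds, pow_succ'] at h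
    have h2 := mul_left_cancel₀ v.ne_bot h
    exact hne <| associated_iff_eq.1 <| (v.prime.dvd_prime_iff_associated w.prime).1 <|
      v.prime.dvd_of_dvd_pow (h2 ▸ dvd_pow_self v.asIdeal hm0)

theorem not_isHalfFactorialDomain_of_sq_ne_one {g : ClassGroup (𝓞 K)} (hg : g ^ 2 ≠ 1) :
    ¬IsHalfFactorialDomain (𝓞 K) := by
  intro H
  obtain ⟨v, hv⟩ := exists_primeIdeal_class g
  obtain ⟨w, hw⟩ := exists_primeIdeal_class g⁻¹
  have hg1 : g ≠ 1 := by
    rintro rfl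
    exact hg (one_pow 2)
  obtain ⟨a, ha, hav⟩ := exists_irreducible_span_eq_pow (orderOf_pos g) (by rw [hv])
  obtain ⟨b, hb, hbw⟩ := exists_irreducible_span_eq_pow (orderOf_pos g)
    (by rw [hw, orderOf_inv])
  obtain ⟨c, hc, hcs⟩ := exists_irreducible_span_eq_mul (v := v) (w := w) (by rwa [hv])
    (by rw [hv, hw, mul_inv_cancel])
  have hcard := H.card_eq_of_associated (a := a) (s := {b})
    (t := Multiset.replicate (orderOf g) c) (by simp [ha, hb])
    (fun x hx ↦ Multiset.eq_of_mem_replicate hx ▸ hc) (by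
      rw [← Ideal.span_singleton_eq_span_singleton, Multiset.prod_cons, Multiset.prod_singleton,
        Multiset.prod_replicate, ← Ideal.span_singleton_mul_span_singleton,
        ← Ideal.span_singleton_pow, hav, hbw, hcs, mul_pow])
  simp only [Multiset.card_cons, Multiset.card_singleton, Multiset.card_replicate] at hcard
  exact hg (by rw [← one_add_one_eq_two, hcard, pow_orderOf_eq_one])

theorem not_isHalfFactorialDomain_of_forall_sq_eq_one {a b : ClassGroup (𝓞 K)}
    (hsq : ∀ g : ClassGroup (𝓞 K), g ^ 2 = 1) (ha : a ≠ 1) (hb : b ≠ 1) (hab : a ≠ b) :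
    ¬IsHalfFactorialDomain (𝓞 K) := by
  intro H
  have hab1 : a * b ≠ 1 := fun h ↦ hab <| by
    have h2 := hsq b
    rw [pow_two] at h2
    exact mul_right_cancel (h.trans h2.symm)
  have hord : ∀ g : ClassGroup (𝓞 K), g ≠ 1 → orderOf g = 2 := fun g hg ↦
    orderOf_eq_prime (hsq g) hg
  obtain ⟨u, hu⟩ := exists_primeIdeal_class a
  obtain ⟨v, hv⟩ := exists_primeIdeal_class b
  obtain ⟨w, hw⟩ := exists_primeIdeal_class (a * b)
  obtain ⟨x, hx, hxu⟩ := exists_irreducible_span_eq_pow (v := u) two_pos (by rw [hu, hord a ha])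
  obtain ⟨y, hy, hyv⟩ := exists_irreducible_span_eq_pow (v := v) two_pos (by rw [hv, hord b hb])
  obtain ⟨z, hz, hzw⟩ := exists_irreducible_span_eq_pow (v := w) two_pos
    (by rw [hw, hord _ hab1])
  obtain ⟨c, hc, hcs⟩ := exists_irreducible_span_eq_mul_mul (u := u) (v := v) (w := w)
    (by rwa [hu]) (by rwa [hv]) (by rwa [hw]) (by rw [hu, hv, hw, ← pow_two, hsq])
  have hcard := H.card_eq_of_associated (a := c) (s := {c}) (t := {x, y, z})
    (by simp [hc]) (by simp [hx, hy, hz]) (by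
      simp only [Multiset.insert_eq_cons, Multiset.prod_cons, Multiset.prod_singleton]
      rw [← Ideal.span_singleton_eq_span_singleton]
      simp only [← Ideal.span_singleton_mul_span_singleton, hxu, hyv, hzw, hcs]
      ring)
  simp at hcard

end IrreducibleElements

end PrimesInIdealClasses

/-- The ring of integers of a number field of class number greater than 2 is an atomic
domain that is neither half-factorial nor length-factorial. -/
theorem ringOfIntegers_classNumber_gt_two (K : Type*) [Field K] [NumberField K]
    (h : 2 < NumberField.classNumber K) :
    IsAtomicDomain (NumberField.RingOfIntegers K) ∧
      ¬IsHalfFactorialDomain (NumberField.RingOfIntegers K) ∧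
      ¬IsLengthFactorialDomain (NumberField.RingOfIntegers K) := by
  obtain ⟨a, ha, b, hb, hab⟩ : ∃ a : ClassGroup (NumberField.RingOfIntegers K), a ≠ 1 ∧
      ∃ b : ClassGroup (NumberField.RingOfIntegers K), b ≠ 1 ∧ a ≠ b := by
    obtain ⟨x, y, z, hxy, hxz, hyz⟩ := Fintype.two_lt_card_iff.1 h
    by_cases hx : x = 1
    · exact ⟨y, fun hy ↦ hxy (hx.trans hy.symm), z, fun hz ↦ hxz (hx.trans hz.symm), hyz⟩
    · by_cases hy : y = 1
      · exact ⟨x, hx, z, fun hz ↦ hyz (hy.trans hz.symm), hxz⟩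
      · exact ⟨x, hx, y, hy, hxy⟩
  refine ⟨isAtomicDomain_of_wfDvdMonoid, ?_, not_isLengthFactorialDomain ha⟩
  by_cases hsq : ∀ g : ClassGroup (NumberField.RingOfIntegers K), g ^ 2 = 1
  · exact not_isHalfFactorialDomain_of_forall_sq_eq_one hsq ha hb hab
  · obtain ⟨g, hg⟩ := not_forall.1 hsq
    exact not_isHalfFactorialDomain_of_sq_ne_one hg
end
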